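/- There exist absolute constants c, C > 0 such that the following holds. If σ ≤ c·(σ_min(A)/κ⁴)·√n/(√d·(√(nd)+√m+√(2γ n log n))), then with probability at least 1 − C·n^{−γ+2} the limit S^∞ of the GPM sequence is the unique global maximizer, modulo right multiplication by a common orthogonal matrix, of the nonconvex program max_{O∈O(d)^{⊗n}} ⟨C, OO^T⟩, and S^∞(S^∞)^T is the unique global maximizer of the SDP relaxation: maximize ⟨C,G⟩ over symmetric G ∈ ℝ^{nd×nd} with G ⪰ 0 and each i-th diagonal d×d block G_ii = I_d. -/

import Mathlib

open MeasureTheory Matrix Filter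

namespace GOPP

/-- Frobenius norm of a real matrix. -/
noncomputable def frob {α β : Type*} [Fintype α] [Fintype β] (X : Matrix α β ℝ) : ℝ :=
  Real.sqrt (∑ i, ∑ j, X i j ^ 2)

/-- Euclidean norm of a vector. -/
noncomputable def vnorm {β : Type*} [Fintype β] (v : β → ℝ) : ℝ :=
  Real.sqrt (∑ j, v j ^ 2)

/-- Operator (spectral) norm: the supremum of ‖Xu‖ over unit vectors u. -/
noncomputable def opNorm {α β : Type*} [Fintype α] [Fintype β] (X : Matrix α β ℝ) : ℝ :=
  sSup {r : ℝ | ∃ u : β → ℝ, vnorm u = 1 ∧ r = vnorm (X.mulVec u)}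

/-- Smallest singular value: the infimum of ‖uᵀX‖ over unit vectors u (for a d×m matrix
with d ≤ m this is the d-th largest singular value; for square matrices it is σ_min). -/
noncomputable def sigmaMin {α β : Type*} [Fintype α] [Fintype β] (X : Matrix α β ℝ) : ℝ :=
  sInf {r : ℝ | ∃ u : α → ℝ, vnorm u = 1 ∧ r = vnorm (Matrix.vecMul u X)}

/-- Condition number κ = σ_max/σ_min. -/
noncomputable def kappa {d m : ℕ} (A : Matrix (Fin d) (Fin m) ℝ) : ℝ :=
  opNorm A / sigmaMin A

/-- Q is an orthogonal matrix. -/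
def IsOrth {d : ℕ} (Q : Matrix (Fin d) (Fin d) ℝ) : Prop :=
  Qᵀ * Q = 1 ∧ Q * Qᵀ = 1

/-- Nuclear norm, via the dual characterization ‖M‖_* = max_{Q ∈ O(d)} ⟨Q, M⟩. -/
noncomputable def nuclearNorm {d : ℕ} (M : Matrix (Fin d) (Fin d) ℝ) : ℝ :=
  sSup {r : ℝ | ∃ Q : Matrix (Fin d) (Fin d) ℝ, IsOrth Q ∧ r = Matrix.trace (Qᵀ * M)}

/-- The i-th d×k block of an (nd)×k block matrix. -/
def blk {n d k : ℕ} (S : Matrix (Fin n × Fin d) (Fin k) ℝ) (i : Fin n) :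
    Matrix (Fin d) (Fin k) ℝ :=
  Matrix.of fun a b => S (i, a) b

/-- The i-th diagonal d×d block of an (nd)×(nd) matrix. -/
def dblk {n d : ℕ} (G : Matrix (Fin n × Fin d) (Fin n × Fin d) ℝ) (i : Fin n) :
    Matrix (Fin d) (Fin d) ℝ :=
  Matrix.of fun a b => G (i, a) (i, b)

/-- S ∈ O(d)^{⊗n}: each of the n d×d blocks of S is orthogonal. -/
def OrthBlocks {n d : ℕ} (S : Matrix (Fin n × Fin d) (Fin d) ℝ) : Prop :=
  ∀ i, IsOrth (blk S i)

/-- Z ∈ ℝ^{nd×d}: the vertical stack of n copies of I_d. -/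
def ZStack (n d : ℕ) : Matrix (Fin n × Fin d) (Fin d) ℝ :=
  Matrix.of fun p j => if p.2 = j then 1 else 0

/-- Vertical stack of n given d×k matrices. -/
def stack {n d k : ℕ} (B : Fin n → Matrix (Fin d) (Fin k) ℝ) :
    Matrix (Fin n × Fin d) (Fin k) ℝ :=
  Matrix.of fun p b => B p.1 p.2 b

/-- d_F(X,Y) = min_{Q ∈ O(d)} ‖X − YQ‖_F. -/
noncomputable def dF {n d : ℕ} (X Y : Matrix (Fin n × Fin d) (Fin d) ℝ) : ℝ :=
  sInf {r : ℝ | ∃ Q, IsOrth Q ∧ r = frob (X - Y * Q)}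

/-- R is a polar factor P(X) of X: an orthogonal global minimizer of ‖X − Q‖_F over O(d). -/
def IsPolar {d : ℕ} (X R : Matrix (Fin d) (Fin d) ℝ) : Prop :=
  IsOrth R ∧ ∀ Q : Matrix (Fin d) (Fin d) ℝ, IsOrth Q → frob (X - R) ≤ frob (X - Q)

/-- S = P_n(X): blockwise polar factor. -/
def IsPolarBlocks {n d : ℕ} (X S : Matrix (Fin n × Fin d) (Fin d) ℝ) : Prop :=
  ∀ i, IsPolar (blk X i) (blk S i)

/-- U collects (an orthonormal basis of the span of) the top d left singular vectors of D:
U has orthonormal columns and maximizes the Ky Fan quantity trace(Uᵀ(DDᵀ)U). -/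
def IsTopSingVecs {N : Type*} [Fintype N] {d m : ℕ} (D : Matrix N (Fin m) ℝ)
    (U : Matrix N (Fin d) ℝ) : Prop :=
  Uᵀ * U = 1 ∧ ∀ Q : Matrix N (Fin d) ℝ, Qᵀ * Q = 1 →
    Matrix.trace (Qᵀ * (D * Dᵀ) * Q) ≤ Matrix.trace (Uᵀ * (D * Dᵀ) * U)

/-- (U, S, V) is a top-d singular triple of D: orthonormal U, V, diagonal nonnegative S,
DV = US, DᵀU = VS, and U spans a top-d left singular subspace. -/
def IsSVDTriple {N : Type*} [Fintype N] {d m : ℕ} (D : Matrix N (Fin m) ℝ)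
    (U : Matrix N (Fin d) ℝ) (S : Matrix (Fin d) (Fin d) ℝ)
    (V : Matrix (Fin m) (Fin d) ℝ) : Prop :=
  Vᵀ * V = 1 ∧ (∀ a b, a ≠ b → S a b = 0) ∧ (∀ a, 0 ≤ S a a) ∧
    D * V = U * S ∧ Dᵀ * U = V * S ∧ IsTopSingVecs D U

/-- The generalized power method sequence with spectral initialization, run on the data
matrix D (so with C = DDᵀ): S⁰ = P_n(U) for top singular vectors U of D, and
S^{t+1} = P_n(C Sᵗ). -/
def IsGPM {n d m : ℕ} (D : Matrix (Fin n × Fin d) (Fin m) ℝ)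
    (S : ℕ → Matrix (Fin n × Fin d) (Fin d) ℝ) : Prop :=
  (∃ U, IsTopSingVecs D U ∧ IsPolarBlocks U (S 0)) ∧
    ∀ t, IsPolarBlocks (D * Dᵀ * S t) (S (t + 1))

/-- W^(i): W with its i-th block row replaced by 0. -/
def mask {n d m : ℕ} (W : Matrix (Fin n × Fin d) (Fin m) ℝ) (i : Fin n) :
    Matrix (Fin n × Fin d) (Fin m) ℝ :=
  Matrix.of fun p b => if p.1 = i then 0 else W p b

/-- The noise matrix Δ = WAᵀZᵀ + ZAWᵀ + σWWᵀ. -/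
noncomputable def delta {n d m : ℕ} (A : Matrix (Fin d) (Fin m) ℝ)
    (W : Matrix (Fin n × Fin d) (Fin m) ℝ) (σ : ℝ) :
    Matrix (Fin n × Fin d) (Fin n × Fin d) ℝ :=
  W * Aᵀ * (ZStack n d)ᵀ + ZStack n d * A * Wᵀ + σ • (W * Wᵀ)

/-- The i-th block column Δ_i = WAᵀ + ZAW_iᵀ + σWW_iᵀ of Δ. -/
noncomputable def deltaCol {n d m : ℕ} (A : Matrix (Fin d) (Fin m) ℝ)
    (W : Matrix (Fin n × Fin d) (Fin m) ℝ) (σ : ℝ) (i : Fin n) :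
    Matrix (Fin n × Fin d) (Fin d) ℝ :=
  W * Aᵀ + ZStack n d * A * (blk W i)ᵀ + σ • (W * (blk W i)ᵀ)

/-- The operator L S = C S/(n‖A‖²) with C = ZAAᵀZᵀ + σΔ. -/
noncomputable def Lop {n d m : ℕ} (A : Matrix (Fin d) (Fin m) ℝ)
    (W : Matrix (Fin n × Fin d) (Fin m) ℝ) (σ : ℝ)
    (S : Matrix (Fin n × Fin d) (Fin d) ℝ) : Matrix (Fin n × Fin d) (Fin d) ℝ :=
  ((n : ℝ) * opNorm A ^ 2)⁻¹ •
    ((ZStack n d * A * Aᵀ * (ZStack n d)ᵀ + σ • delta A W σ) * S)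

/-- √(nd) + √m + √(2γ n log n). -/
noncomputable def bnd1 (n d m : ℕ) (γ : ℝ) : ℝ :=
  Real.sqrt ((n : ℝ) * d) + Real.sqrt (m : ℝ) + Real.sqrt (2 * γ * n * Real.log n)

/-- √(nd) + √m + √(2γ log n). -/
noncomputable def bnd2 (n d m : ℕ) (γ : ℝ) : ℝ :=
  Real.sqrt ((n : ℝ) * d) + Real.sqrt (m : ℝ) + Real.sqrt (2 * γ * Real.log n)

/-- The basin of attraction N_ε. -/
def memNeps {n d : ℕ} (ε : ℝ) (S : Matrix (Fin n × Fin d) (Fin d) ℝ) : Prop :=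
  OrthBlocks S ∧ dF S (ZStack n d) ≤ ε * Real.sqrt ((n : ℝ) * d)

/-- The basin of attraction N_{ξ,∞}. -/
def memNxi {n d m : ℕ} (W : Matrix (Fin n × Fin d) (Fin m) ℝ) (γ ξ : ℝ)
    (S : Matrix (Fin n × Fin d) (Fin d) ℝ) : Prop :=
  OrthBlocks S ∧ ∀ i, frob (blk W i * Wᵀ * S) ≤ ξ * Real.sqrt (d : ℝ) * bnd1 n d m γ ^ 2

/-- The distribution of a matrix with i.i.d. standard Gaussian N(0,1) entries. -/
noncomputable def stdGaussian (ι κ : Type*) [Fintype ι] [Fintype κ] :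
    Measure (ι → κ → ℝ) :=
  Measure.pi fun _ : ι => Measure.pi fun _ : κ => ProbabilityTheory.gaussianReal 0 1

section Norms

variable {α β γ : Type*} [Fintype α] [Fintype β] [Fintype γ]

lemma vnorm_eq_norm (v : β → ℝ) : vnorm v = ‖WithLp.toLp 2 v‖ := by
  simp [vnorm, EuclideanSpace.norm_eq]

lemma vnorm_nonneg (v : β → ℝ) : 0 ≤ vnorm v := Real.sqrt_nonneg _

lemma vnorm_sq (v : β → ℝ) : vnorm v ^ 2 = v ⬝ᵥ v := by
  rw [vnorm, Real.sq_sqrt (Finset.sum_nonneg fun _ _ => sq_nonneg _)]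
  simp [dotProduct, sq]

lemma vnorm_add_le (v w : β → ℝ) : vnorm (v + w) ≤ vnorm v + vnorm w := by
  simpa [vnorm_eq_norm] using norm_add_le (WithLp.toLp 2 v) (WithLp.toLp 2 w)

lemma vnorm_smul (c : ℝ) (v : β → ℝ) : vnorm (c • v) = |c| * vnorm v := by
  simp [vnorm_eq_norm, norm_smul]

lemma vnorm_neg (v : β → ℝ) : vnorm (-v) = vnorm v := by simp [vnorm]

lemma vnorm_eq_zero {v : β → ℝ} : vnorm v = 0 ↔ v = 0 := by
  simp [vnorm_eq_norm]

lemma dotProduct_le (v w : β → ℝ) : v ⬝ᵥ w ≤ vnorm v * vnorm w := by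
  have := real_inner_le_norm (WithLp.toLp 2 v) (WithLp.toLp 2 w)
  simpa [vnorm_eq_norm, PiLp.inner_apply, dotProduct, mul_comm] using this

lemma transpose_mulVec_dotProduct (X : Matrix α β ℝ) (w : α → ℝ) (v : β → ℝ) :
    (Xᵀ *ᵥ w) ⬝ᵥ v = w ⬝ᵥ (X *ᵥ v) := by
  rw [Matrix.dotProduct_mulVec, Matrix.mulVec_transpose]

/-- Frobenius inner product. -/
def ip (X Y : Matrix α β ℝ) : ℝ := Matrix.trace (Xᵀ * Y)

lemma ip_eq_sum (X Y : Matrix α β ℝ) : ip X Y = ∑ i, ∑ j, X i j * Y i j := by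
  simp only [ip, Matrix.trace, Matrix.diag, Matrix.mul_apply, Matrix.transpose_apply]
  exact Finset.sum_comm

lemma ip_comm (X Y : Matrix α β ℝ) : ip X Y = ip Y X := by
  simp [ip_eq_sum, mul_comm]

lemma ip_add_left (X Y Z : Matrix α β ℝ) : ip (X + Y) Z = ip X Z + ip Y Z := by
  simp [ip, Matrix.add_mul, Matrix.trace_add]

lemma ip_add_right (X Y Z : Matrix α β ℝ) : ip X (Y + Z) = ip X Y + ip X Z := by
  simp [ip, Matrix.mul_add, Matrix.trace_add]

lemma ip_sub_left (X Y Z : Matrix α β ℝ) : ip (X - Y) Z = ip X Z - ip Y Z := by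
  simp [ip, Matrix.sub_mul, Matrix.trace_sub]

lemma ip_sub_right (X Y Z : Matrix α β ℝ) : ip X (Y - Z) = ip X Y - ip X Z := by
  simp [ip, Matrix.mul_sub, Matrix.trace_sub]

lemma ip_smul_left (c : ℝ) (X Y : Matrix α β ℝ) : ip (c • X) Y = c * ip X Y := by
  simp [ip, Matrix.trace_smul]

lemma ip_smul_right (c : ℝ) (X Y : Matrix α β ℝ) : ip X (c • Y) = c * ip X Y := by
  simp [ip, Matrix.trace_smul]

lemma ip_mul_left (X : Matrix α β ℝ) (Y : Matrix β γ ℝ) (Z : Matrix α γ ℝ) :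
    ip (X * Y) Z = ip Y (Xᵀ * Z) := by
  simp [ip, Matrix.transpose_mul, Matrix.mul_assoc]

lemma ip_mul_right (X : Matrix α β ℝ) (Y : Matrix β γ ℝ) (Z : Matrix α γ ℝ) :
    ip (X * Y) Z = ip X (Z * Yᵀ) := by
  rw [ip, ip, Matrix.transpose_mul, Matrix.mul_assoc, Matrix.trace_mul_comm, Matrix.mul_assoc]

lemma ip_transpose (X Y : Matrix α β ℝ) : ip Xᵀ Yᵀ = ip X Y := by
  rw [ip_eq_sum, ip_eq_sum, Finset.sum_comm]; rfl

lemma frob_eq_vnorm (X : Matrix α β ℝ) : frob X = vnorm (fun p : α × β => X p.1 p.2) := by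
  simp [frob, vnorm, Fintype.sum_prod_type]

lemma ip_eq_dotProduct (X Y : Matrix α β ℝ) :
    ip X Y = (fun p : α × β => X p.1 p.2) ⬝ᵥ fun p : α × β => Y p.1 p.2 := by
  simp [ip_eq_sum, dotProduct, Fintype.sum_prod_type]

lemma frob_nonneg (X : Matrix α β ℝ) : 0 ≤ frob X := Real.sqrt_nonneg _

lemma frob_sq (X : Matrix α β ℝ) : frob X ^ 2 = ip X X := by
  rw [frob_eq_vnorm, vnorm_sq, ip_eq_dotProduct]

lemma ip_le (X Y : Matrix α β ℝ) : ip X Y ≤ frob X * frob Y := by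
  rw [ip_eq_dotProduct, frob_eq_vnorm, frob_eq_vnorm]; exact dotProduct_le _ _

lemma frob_add_le (X Y : Matrix α β ℝ) : frob (X + Y) ≤ frob X + frob Y := by
  simp only [frob_eq_vnorm]; exact vnorm_add_le _ _

lemma frob_smul (c : ℝ) (X : Matrix α β ℝ) : frob (c • X) = |c| * frob X := by
  simp only [frob_eq_vnorm]; exact vnorm_smul _ _

lemma frob_neg (X : Matrix α β ℝ) : frob (-X) = frob X := by simp [frob]

lemma frob_sub_comm (X Y : Matrix α β ℝ) : frob (X - Y) = frob (Y - X) := by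
  rw [← frob_neg, neg_sub]

lemma frob_transpose (X : Matrix α β ℝ) : frob Xᵀ = frob X := by
  rw [frob, frob, Finset.sum_comm]; rfl

lemma frob_eq_zero {X : Matrix α β ℝ} : frob X = 0 ↔ X = 0 := by
  rw [frob_eq_vnorm, vnorm_eq_zero]
  exact ⟨fun h => by ext i j; exact congrFun h (i, j), fun h => by subst h; rfl⟩

lemma frob_sq_eq_sum_col (X : Matrix α β ℝ) : frob X ^ 2 = ∑ j, vnorm (X.col j) ^ 2 := by
  rw [frob_sq, ip_eq_sum, Finset.sum_comm]
  simp [vnorm_sq, dotProduct]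

/-- `b` bounds the operator norm of `X`. -/
def OpB (X : Matrix α β ℝ) (b : ℝ) : Prop :=
  0 ≤ b ∧ ∀ v : β → ℝ, vnorm (X *ᵥ v) ≤ b * vnorm v

lemma OpB.frob_mul {X : Matrix α β ℝ} {b : ℝ} (h : OpB X b) (Y : Matrix β γ ℝ) :
    frob (X * Y) ≤ b * frob Y := by
  refine abs_le_of_sq_le_sq' ?_ (mul_nonneg h.1 (frob_nonneg _)) |>.2
  rw [mul_pow, frob_sq_eq_sum_col, frob_sq_eq_sum_col, Finset.mul_sum]
  refine Finset.sum_le_sum fun j _ => ?_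
  rw [← mul_pow]
  exact pow_le_pow_left₀ (vnorm_nonneg _) (h.2 (Y.col j)) 2

lemma OpB.transpose {X : Matrix α β ℝ} {b : ℝ} (h : OpB X b) : OpB Xᵀ b := by
  refine ⟨h.1, fun w => ?_⟩
  by_contra! hc
  have h1 : vnorm (Xᵀ *ᵥ w) ^ 2 ≤ vnorm w * (b * vnorm (Xᵀ *ᵥ w)) := by
    have e : vnorm (Xᵀ *ᵥ w) ^ 2 = w ⬝ᵥ (X *ᵥ (Xᵀ *ᵥ w)) := by
      rw [vnorm_sq, transpose_mulVec_dotProduct]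
    rw [e]
    exact (dotProduct_le _ _).trans (mul_le_mul_of_nonneg_left (h.2 _) (vnorm_nonneg _))
  have h2 : 0 ≤ b * vnorm w := mul_nonneg h.1 (vnorm_nonneg _)
  nlinarith

lemma OpB.frob_mul_right {X : Matrix α β ℝ} {b : ℝ} (h : OpB X b) (Y : Matrix γ α ℝ) :
    frob (Y * X) ≤ b * frob Y := by
  rw [← frob_transpose, ← frob_transpose Y, Matrix.transpose_mul]
  exact h.transpose.frob_mul _

lemma OpB.mul {X : Matrix α β ℝ} {Y : Matrix β γ ℝ} {b c : ℝ} (h : OpB X b) (h' : OpB Y c) :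
    OpB (X * Y) (b * c) := by
  refine ⟨mul_nonneg h.1 h'.1, fun v => ?_⟩
  rw [← Matrix.mulVec_mulVec, mul_assoc]
  exact (h.2 _).trans (mul_le_mul_of_nonneg_left (h'.2 _) h.1)

lemma OpB.add {X Y : Matrix α β ℝ} {b c : ℝ} (h : OpB X b) (h' : OpB Y c) :
    OpB (X + Y) (b + c) := by
  refine ⟨add_nonneg h.1 h'.1, fun v => ?_⟩
  rw [Matrix.add_mulVec, add_mul]
  exact (vnorm_add_le _ _).trans (add_le_add (h.2 _) (h'.2 _))

lemma OpB.smul {X : Matrix α β ℝ} {b : ℝ} (h : OpB X b) (c : ℝ) : OpB (c • X) (|c| * b) := by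
  refine ⟨mul_nonneg (abs_nonneg _) h.1, fun v => ?_⟩
  rw [Matrix.smul_mulVec, vnorm_smul, mul_assoc]
  exact mul_le_mul_of_nonneg_left (h.2 _) (abs_nonneg _)

lemma OpB.mono {X : Matrix α β ℝ} {b c : ℝ} (h : OpB X b) (hbc : b ≤ c) : OpB X c :=
  ⟨h.1.trans hbc, fun v => (h.2 v).trans (mul_le_mul_of_nonneg_right hbc (vnorm_nonneg _))⟩

lemma opB_frob (X : Matrix α β ℝ) : OpB X (frob X) := by
  refine ⟨frob_nonneg _, fun v => ?_⟩
  refine abs_le_of_sq_le_sq' ?_ (mul_nonneg (frob_nonneg _) (vnorm_nonneg _)) |>.2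
  rw [mul_pow, vnorm_sq, frob_sq, ip_eq_sum, Finset.sum_mul, dotProduct]
  refine Finset.sum_le_sum fun i _ => ?_
  have := abs_le_of_sq_le_sq' (a := X i ⬝ᵥ v) (b := vnorm (X i) * vnorm v)
  have h : (X i ⬝ᵥ v) ^ 2 ≤ (vnorm (X i) * vnorm v) ^ 2 := by
    refine sq_le_sq' ?_ (dotProduct_le _ _)
    have := dotProduct_le (-X i) v
    rw [neg_dotProduct, vnorm_neg] at this
    linarith
  rw [mul_pow, vnorm_sq] at h
  simpa [Matrix.mulVec, sq, dotProduct] using h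

lemma OpB.neg {X : Matrix α β ℝ} {b : ℝ} (h : OpB X b) : OpB (-X) b := by
  refine ⟨h.1, fun v => ?_⟩
  rw [Matrix.neg_mulVec, vnorm_neg]; exact h.2 v

lemma vnorm_sq_mulVec_transpose (X : Matrix α β ℝ) (w : α → ℝ) :
    vnorm (Xᵀ *ᵥ w) ^ 2 = w ⬝ᵥ ((X * Xᵀ) *ᵥ w) := by
  rw [vnorm_sq, transpose_mulVec_dotProduct, Matrix.mulVec_mulVec]

lemma OpB.opNorm_le {X : Matrix α β ℝ} {b : ℝ} (h : OpB X b) : opNorm X ≤ b := by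
  refine Real.sSup_le ?_ h.1
  rintro _ ⟨u, hu, rfl⟩
  simpa [hu] using h.2 u

lemma opB_opNorm (X : Matrix α β ℝ) : OpB X (opNorm X) := by
  have hbdd : BddAbove {r : ℝ | ∃ u : β → ℝ, vnorm u = 1 ∧ r = vnorm (X.mulVec u)} := by
    refine ⟨frob X, ?_⟩
    rintro _ ⟨u, hu, rfl⟩
    simpa [hu] using (opB_frob X).2 u
  refine ⟨Real.sSup_nonneg ?_, fun v => ?_⟩
  · rintro _ ⟨u, _, rfl⟩; exact vnorm_nonneg _
  · by_cases hv : vnorm v = 0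
    · rw [vnorm_eq_zero] at hv
      simp [hv, vnorm]
    · have hp : 0 < vnorm v := lt_of_le_of_ne (vnorm_nonneg _) (Ne.symm hv)
      have h1 : vnorm ((vnorm v)⁻¹ • v) = 1 := by
        rw [vnorm_smul, abs_of_pos (inv_pos.2 hp), inv_mul_cancel₀ hv]
      have := le_csSup hbdd ⟨_, h1, rfl⟩
      rw [Matrix.mulVec_smul, vnorm_smul, abs_of_pos (inv_pos.2 hp)] at this
      rw [opNorm]
      calc vnorm (X *ᵥ v) = (vnorm v)⁻¹ * vnorm (X *ᵥ v) * vnorm v := by field_simp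
        _ ≤ _ := mul_le_mul_of_nonneg_right this hp.le

lemma sigmaMin_mul_le (X : Matrix α β ℝ) (u : α → ℝ) :
    sigmaMin X * vnorm u ≤ vnorm (Xᵀ *ᵥ u) := by
  by_cases hv : vnorm u = 0
  · simp [hv, vnorm_nonneg]
  · have hp : 0 < vnorm u := lt_of_le_of_ne (vnorm_nonneg _) (Ne.symm hv)
    have h1 : vnorm ((vnorm u)⁻¹ • u) = 1 := by
      rw [vnorm_smul, abs_of_pos (inv_pos.2 hp), inv_mul_cancel₀ hv]
    have hb : BddBelow {r : ℝ | ∃ u : α → ℝ, vnorm u = 1 ∧ r = vnorm (Matrix.vecMul u X)} := by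
      refine ⟨0, ?_⟩
      rintro _ ⟨u, _, rfl⟩; exact vnorm_nonneg _
    have := csInf_le hb ⟨_, h1, rfl⟩
    rw [← Matrix.mulVec_transpose, Matrix.mulVec_smul, vnorm_smul, abs_of_pos (inv_pos.2 hp)]
      at this
    rw [sigmaMin]
    calc _ ≤ (vnorm u)⁻¹ * vnorm (Xᵀ *ᵥ u) * vnorm u := mul_le_mul_of_nonneg_right this hp.le
      _ = _ := by field_simp

end Norms

section PosSemidef

variable {d : ℕ}

lemma posSemidef_iff_real {κ : Type*} [Fintype κ] {H : Matrix κ κ ℝ} :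
    H.PosSemidef ↔ Hᵀ = H ∧ ∀ v, 0 ≤ v ⬝ᵥ (H *ᵥ v) := by
  rw [Matrix.posSemidef_iff_dotProduct_mulVec]
  simp [Matrix.IsHermitian, Matrix.conjTranspose_eq_transpose_of_trivial]

lemma exists_sum_vecMulVec {κ : Type*} [Fintype κ] {H : Matrix κ κ ℝ} (hH : H.PosSemidef) :
    ∃ (k : ℕ) (v : Fin k → κ → ℝ), H = ∑ i, vecMulVec (v i) (v i) := by
  simpa using Matrix.posSemidef_iff_eq_sum_vecMulVec.1 hH

lemma trace_mul_vecMulVec {κ : Type*} [Fintype κ] (K : Matrix κ κ ℝ) (v w : κ → ℝ) :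
    trace (K * vecMulVec v w) = w ⬝ᵥ (K *ᵥ v) := by
  rw [Matrix.mul_vecMulVec, Matrix.trace_vecMulVec, dotProduct_comm]

lemma trace_mul_sum_vecMulVec {κ : Type*} [Fintype κ] (K : Matrix κ κ ℝ) {k : ℕ}
    (v : Fin k → κ → ℝ) :
    trace (K * ∑ i, vecMulVec (v i) (v i)) = ∑ i, v i ⬝ᵥ (K *ᵥ v i) := by
  rw [Matrix.mul_sum, Matrix.trace_sum]
  simp [trace_mul_vecMulVec]

lemma ip_nonneg_of_posSemidef {κ : Type*} [Fintype κ] {K H : Matrix κ κ ℝ}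
    (hK : ∀ v, 0 ≤ v ⬝ᵥ (K *ᵥ v)) (hH : H.PosSemidef) : 0 ≤ trace (K * H) := by
  obtain ⟨k, v, rfl⟩ := exists_sum_vecMulVec hH
  rw [trace_mul_sum_vecMulVec]
  exact Finset.sum_nonneg fun i _ => hK _

lemma ip_le_trace {H Y : Matrix (Fin d) (Fin d) ℝ} (hH : H.PosSemidef) (hY : OpB Y 1) :
    ip Y H ≤ trace H := by
  have h := ip_nonneg_of_posSemidef (K := 1 - Yᵀ) (H := H) (fun v => by
    have h1 : v ⬝ᵥ (Yᵀ *ᵥ v) ≤ vnorm v * vnorm v := (dotProduct_le _ _).trans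
      (mul_le_mul_of_nonneg_left (by simpa using hY.transpose.2 v) (vnorm_nonneg _))
    rw [Matrix.sub_mulVec, dotProduct_sub, Matrix.one_mulVec, ← vnorm_sq]
    nlinarith) hH
  rw [Matrix.sub_mul, Matrix.trace_sub, Matrix.one_mul] at h
  rw [ip]; linarith

/-- A positive semidefinite matrix whose singular values are at least `t` dominates `t`. -/
lemma posSemidef_sub_smul {H : Matrix (Fin d) (Fin d) ℝ} (hH : H.PosSemidef) {t : ℝ}
    (ht : ∀ v, t * vnorm v ≤ vnorm (H *ᵥ v)) :
    (H - t • (1 : Matrix (Fin d) (Fin d) ℝ)).PosSemidef := by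
  have hs : (H - t • (1 : Matrix (Fin d) (Fin d) ℝ)).IsHermitian :=
    hH.1.sub (by simp [Matrix.IsHermitian])
  rw [hs.posSemidef_iff_eigenvalues_nonneg]
  intro i
  by_contra! hneg
  simp only [Pi.zero_apply] at hneg
  set x : Fin d → ℝ := (hs.eigenvectorBasis i).ofLp with hx
  have hn : vnorm x = 1 := by
    rw [vnorm_eq_norm]; exact hs.eigenvectorBasis.orthonormal.1 i
  have he := hs.mulVec_eigenvectorBasis i
  rw [← hx, Matrix.sub_mulVec, Matrix.smul_mulVec, Matrix.one_mulVec, sub_eq_iff_eq_add,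
    ← add_smul] at he
  have h1 := ht x
  have h2 := (posSemidef_iff_real.1 hH).2 x
  have hxx : x ⬝ᵥ x = 1 := by rw [← vnorm_sq, hn]; norm_num
  rw [he, vnorm_smul, hn] at h1
  rw [he, dotProduct_smul, hxx, smul_eq_mul, mul_one] at h2
  rw [abs_of_nonneg h2] at h1
  linarith

lemma trace_lower {H Y : Matrix (Fin d) (Fin d) ℝ} (hH : H.PosSemidef) {t : ℝ}
    (ht : ∀ v, t * vnorm v ≤ vnorm (H *ᵥ v)) (hY : OpB Y 1) :
    t * (d - ip Y 1) ≤ trace H - ip Y H := by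
  have h := ip_le_trace (posSemidef_sub_smul hH ht) hY
  rw [ip_sub_right, Matrix.trace_sub, ip_smul_right, Matrix.trace_smul, Matrix.trace_one] at h
  simp only [Fintype.card_fin, smul_eq_mul] at h
  linarith

end PosSemidef

section Orthogonal

variable {d : ℕ}

lemma IsOrth.transpose {Q : Matrix (Fin d) (Fin d) ℝ} (h : IsOrth Q) : IsOrth Qᵀ := by
  simpa [IsOrth, and_comm] using h

lemma isOrth_of_transpose_mul {Q : Matrix (Fin d) (Fin d) ℝ} (h : Qᵀ * Q = 1) : IsOrth Q :=
  ⟨h, mul_eq_one_comm.1 h⟩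

lemma IsOrth.mul {Q R : Matrix (Fin d) (Fin d) ℝ} (h : IsOrth Q) (h' : IsOrth R) :
    IsOrth (Q * R) := by
  refine isOrth_of_transpose_mul ?_
  rw [Matrix.transpose_mul, Matrix.mul_assoc, ← Matrix.mul_assoc Qᵀ, h.1, Matrix.one_mul, h'.1]

lemma isOrth_one : IsOrth (1 : Matrix (Fin d) (Fin d) ℝ) := by simp [IsOrth]

lemma vnorm_mulVec_of_transpose_mul {N : Type*} [Fintype N] {U : Matrix N (Fin d) ℝ}
    (h : Uᵀ * U = 1) (v : Fin d → ℝ) : vnorm (U *ᵥ v) = vnorm v := by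
  refine (pow_left_inj₀ (vnorm_nonneg _) (vnorm_nonneg _) two_ne_zero).1 ?_
  have := vnorm_sq_mulVec_transpose Uᵀ v
  rw [Matrix.transpose_transpose, h, Matrix.one_mulVec] at this
  rw [this, vnorm_sq]

lemma IsOrth.opB {Q : Matrix (Fin d) (Fin d) ℝ} (h : IsOrth Q) : OpB Q 1 :=
  ⟨zero_le_one, fun v => by rw [vnorm_mulVec_of_transpose_mul h.1, one_mul]⟩

lemma IsOrth.ip_mul {α : Type*} [Fintype α] {Q : Matrix (Fin d) (Fin d) ℝ} (h : IsOrth Q)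
    (X Y : Matrix α (Fin d) ℝ) : ip (X * Q) (Y * Q) = ip X Y := by
  rw [ip_mul_right, Matrix.mul_assoc, h.2, Matrix.mul_one]

lemma IsOrth.frob_mul {α : Type*} [Fintype α] {Q : Matrix (Fin d) (Fin d) ℝ} (h : IsOrth Q)
    (X : Matrix α (Fin d) ℝ) : frob (X * Q) = frob X := by
  refine (pow_left_inj₀ (frob_nonneg _) (frob_nonneg _) two_ne_zero).1 ?_
  rw [frob_sq, frob_sq, h.ip_mul]

lemma IsOrth.frob_sq_eq {Q : Matrix (Fin d) (Fin d) ℝ} (h : IsOrth Q) : frob Q ^ 2 = d := by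
  rw [frob_sq, ip, h.1]; simp

lemma OpB.frob_sq_le {Y : Matrix (Fin d) (Fin d) ℝ} (h : OpB Y 1) : frob Y ^ 2 ≤ d := by
  have h1 := h.frob_mul (1 : Matrix (Fin d) (Fin d) ℝ)
  rw [Matrix.mul_one, one_mul] at h1
  rw [← isOrth_one.frob_sq_eq (d := d)]
  exact pow_le_pow_left₀ (frob_nonneg _) h1 2

lemma frob_continuous {α β : Type*} [Fintype α] [Fintype β] :
    Continuous (frob : Matrix α β ℝ → ℝ) := by
  unfold frob; fun_prop

lemma ip_continuous {α β : Type*} [Fintype α] [Fintype β] :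
    Continuous fun p : Matrix α β ℝ × Matrix α β ℝ => ip p.1 p.2 := by
  simp only [ip_eq_sum]; fun_prop

lemma isCompact_of_abs_le {α β : Type*} [Fintype α] [Fintype β] {s : Set (Matrix α β ℝ)}
    (hs : IsClosed s) (hb : ∀ X ∈ s, ∀ i j, |X i j| ≤ 1) : IsCompact s := by
  have hK : IsCompact (Set.pi Set.univ fun _ : α =>
      Set.pi Set.univ fun _ : β => Set.Icc (-1 : ℝ) 1) :=
    isCompact_univ_pi fun _ => isCompact_univ_pi fun _ => isCompact_Icc
  exact hK.of_isClosed_subset hs fun X hX i _ j _ => abs_le.1 (hb X hX i j)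

lemma OpB.abs_apply_le {α : Type*} [Fintype α] {Y : Matrix α (Fin d) ℝ} (h : OpB Y 1) (i : α)
    (j : Fin d) : |Y i j| ≤ 1 := by
  have h1 := h.2 (Pi.single j 1)
  have h2 : vnorm (Pi.single j (1 : ℝ)) = 1 := by
    have := vnorm_sq (Pi.single j (1 : ℝ))
    rw [dotProduct_single_one, Pi.single_eq_same] at this
    exact (pow_eq_one_iff_of_nonneg (vnorm_nonneg _) two_ne_zero).1 this
  rw [h2, mul_one, Matrix.mulVec_single_one] at h1
  have h3 : Y i j ^ 2 ≤ vnorm (Y.col j) ^ 2 := by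
    rw [vnorm_sq]
    simp only [dotProduct, Matrix.col_apply, ← sq]
    exact Finset.single_le_sum (f := fun i => Y i j ^ 2) (fun _ _ => sq_nonneg _)
      (Finset.mem_univ i)
  exact abs_le_one_iff_mul_self_le_one.2 (by nlinarith [vnorm_nonneg (Y.col j)])

lemma isClosed_isOrth : IsClosed {Q : Matrix (Fin d) (Fin d) ℝ | IsOrth Q} := by
  have : {Q : Matrix (Fin d) (Fin d) ℝ | IsOrth Q} = {Q | Qᵀ * Q = 1} ∩ {Q | Q * Qᵀ = 1} := rfl
  rw [this]
  exact (isClosed_eq (by fun_prop) (by fun_prop)).inter (isClosed_eq (by fun_prop) (by fun_prop))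

lemma isCompact_isOrth : IsCompact {Q : Matrix (Fin d) (Fin d) ℝ | IsOrth Q} :=
  isCompact_of_abs_le isClosed_isOrth fun _ hX => (IsOrth.opB hX).abs_apply_le

/-- If the identity maximizes `⟨Q, B⟩` over orthogonal `Q`, then `B` is symmetric. -/
lemma transpose_eq_of_ip_le_trace {B : Matrix (Fin d) (Fin d) ℝ}
    (h : ∀ Q, IsOrth Q → ip Q B ≤ trace B) : Bᵀ = B := by
  -- test with the Givens rotation in the `(a, b)` plane
  have key : ∀ a b : Fin d, a ≠ b → ∀ c s : ℝ, c ^ 2 + s ^ 2 = 1 →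
      (c - 1) * (B a a + B b b) + s * (B a b - B b a) ≤ 0 := by
    intro a b hab c s hcs
    let Q : Matrix (Fin d) (Fin d) ℝ := 1 + (c - 1) • (single a a 1 + single b b 1)
      + s • (single a b 1 - single b a 1)
    have hQ : IsOrth Q := by
      refine isOrth_of_transpose_mul ?_
      have hT : Qᵀ = 1 + (c - 1) • (single a a 1 + single b b 1)
          - s • (single a b 1 - single b a 1) := by
        simp only [Q, Matrix.transpose_add, Matrix.transpose_smul, Matrix.transpose_sub,
          Matrix.transpose_single, Matrix.transpose_one]
        module
      rw [hT]
      simp only [Q, add_mul, sub_mul, mul_add, mul_sub, smul_mul_assoc, mul_smul_comm, one_mul,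
        mul_one, single_mul_single_same, single_mul_single_of_ne _ _ _ _ hab,
        single_mul_single_of_ne _ _ _ _ hab.symm, smul_add, smul_sub, smul_zero, add_zero,
        sub_zero, zero_add, zero_sub, mul_one]
      have e : s * s = 1 - c * c := by nlinarith
      simp only [smul_smul, smul_neg, e, mul_sub, sub_mul]
      module
    have hle := h Q hQ
    have hip : ip Q B = trace B + (c - 1) * (B a a + B b b) + s * (B a b - B b a) := by
      simp only [Q, ip_add_left, ip_smul_left, ip_sub_left]
      simp [ip, Matrix.trace_single_mul]
    linarith
  ext a b
  rw [Matrix.transpose_apply]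
  by_cases hab : a = b
  · rw [hab]
  by_contra hne
  set p := B a b - B b a with hp
  set r := B a a + B b b with hr
  have hp0 : p ≠ 0 := fun h0 => hne (by rw [hp] at h0; linarith)
  have hpos : 0 < p ^ 2 + r ^ 2 := by positivity
  have hrt : 0 < Real.sqrt (p ^ 2 + r ^ 2) := Real.sqrt_pos.2 hpos
  have hsq := Real.sq_sqrt hpos.le
  set w := Real.sqrt (p ^ 2 + r ^ 2)
  have h1 := key a b hab (r / w) (p / w) (by field_simp; linarith)
  rw [← hp, ← hr] at h1
  have h2 : (r / w - 1) * r + p / w * p = w - r := by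
    field_simp; nlinarith
  rw [h2] at h1
  have : r < w := by
    by_contra! hc
    have : 0 < p ^ 2 := by positivity
    nlinarith
  linarith

lemma posSemidef_of_ip_le_trace {B : Matrix (Fin d) (Fin d) ℝ}
    (h : ∀ Q, IsOrth Q → ip Q B ≤ trace B) : B.PosSemidef := by
  refine posSemidef_iff_real.2 ⟨transpose_eq_of_ip_le_trace h, fun v => ?_⟩
  by_cases hv : v = 0
  · simp [hv]
  have hvv : 0 < v ⬝ᵥ v := by
    rw [← vnorm_sq]
    have := (vnorm_eq_zero (v := v)).not.2 hv
    positivity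
  have hQ : IsOrth (1 - (2 / (v ⬝ᵥ v)) • vecMulVec v v) := by
    refine isOrth_of_transpose_mul ?_
    have : (vecMulVec v v)ᵀ = vecMulVec v v := by simp
    rw [Matrix.transpose_sub, Matrix.transpose_smul, this, Matrix.transpose_one]
    simp only [sub_mul, mul_sub, one_mul, mul_one, smul_mul_assoc, mul_smul_comm,
      vecMulVec_mul_vecMulVec, smul_smul, vecMulVec_smul]
    have e : 2 / (v ⬝ᵥ v) * (v ⬝ᵥ v) = 2 := by field_simp
    rw [e]
    module
  have := h _ hQ
  rw [ip_sub_left, ip_smul_left, ip_comm 1, ip_comm (vecMulVec v v), ip, ip, Matrix.mul_one,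
    Matrix.trace_transpose, trace_mul_vecMulVec, transpose_eq_of_ip_le_trace h] at this
  have h2 : 0 ≤ 2 / (v ⬝ᵥ v) * (v ⬝ᵥ (B *ᵥ v)) := by linarith
  exact nonneg_of_mul_nonneg_right h2 (by positivity)

lemma posSemidef_of_maximal {X R : Matrix (Fin d) (Fin d) ℝ} (hR : IsOrth R)
    (h : ∀ Q, IsOrth Q → ip X Q ≤ ip X R) : (Rᵀ * X).PosSemidef := by
  refine posSemidef_of_ip_le_trace fun Q hQ => ?_
  have := h (R * Q) (hR.mul hQ)
  rw [ip_comm X, ip_mul_left, ip_comm X R] at this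
  exact this

lemma exists_polar (X : Matrix (Fin d) (Fin d) ℝ) :
    ∃ R, IsOrth R ∧ (Rᵀ * X).PosSemidef := by
  obtain ⟨R, hR, hmax⟩ := (isCompact_isOrth (d := d)).exists_isMaxOn ⟨1, isOrth_one⟩
    (f := fun Q => ip X Q)
    (ip_continuous.comp (by fun_prop : Continuous fun Q => (X, Q))).continuousOn
  exact ⟨R, hR, posSemidef_of_maximal hR fun Q hQ => hmax hQ⟩

lemma IsPolar.ip_le {X R : Matrix (Fin d) (Fin d) ℝ} (h : IsPolar X R)
    {Q : Matrix (Fin d) (Fin d) ℝ} (hQ : IsOrth Q) : ip X Q ≤ ip X R := by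
  have := pow_le_pow_left₀ (frob_nonneg _) (h.2 Q hQ) 2
  have e1 := h.1.frob_sq_eq
  have e2 := hQ.frob_sq_eq
  simp only [frob_sq, ip_sub_left, ip_sub_right] at this e1 e2
  rw [ip_comm R X, ip_comm Q X] at this
  linarith

/-- Strong monotonicity of the polar factor. -/
lemma polar_gap {X R Y : Matrix (Fin d) (Fin d) ℝ} (hR : IsOrth R) (hX : (Rᵀ * X).PosSemidef)
    {t : ℝ} (ht : ∀ v, t * vnorm v ≤ vnorm (X *ᵥ v)) (hY : OpB Y 1) :
    t * (d - ip R Y) ≤ ip X R - ip X Y := by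
  have h1 : ∀ v, t * vnorm v ≤ vnorm ((Rᵀ * X) *ᵥ v) := fun v => by
    rw [← Matrix.mulVec_mulVec, vnorm_mulVec_of_transpose_mul hR.transpose.1]; exact ht v
  have h2 : OpB (Rᵀ * Y) 1 := by simpa using hR.transpose.opB.mul hY
  have h3 := trace_lower hX h1 h2
  rw [ip_mul_left, Matrix.transpose_transpose, Matrix.mul_one, ip_mul_left,
    Matrix.transpose_transpose, ← Matrix.mul_assoc, hR.2, Matrix.one_mul] at h3
  rw [ip_comm R Y, ip_comm X Y, ip_comm X R]
  exact h3

end Orthogonal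

section Blocks

variable {n d k l : ℕ}

lemma ip_blk (S T : Matrix (Fin n × Fin d) (Fin k) ℝ) : ip S T = ∑ i, ip (blk S i) (blk T i) := by
  simp [ip_eq_sum, Fintype.sum_prod_type, blk]

lemma frob_sq_blk (S : Matrix (Fin n × Fin d) (Fin k) ℝ) :
    frob S ^ 2 = ∑ i, frob (blk S i) ^ 2 := by
  simp only [frob_sq]; exact ip_blk S S

lemma blk_add (S T : Matrix (Fin n × Fin d) (Fin k) ℝ) (i : Fin n) :
    blk (S + T) i = blk S i + blk T i := rfl

lemma blk_sub (S T : Matrix (Fin n × Fin d) (Fin k) ℝ) (i : Fin n) :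
    blk (S - T) i = blk S i - blk T i := rfl

lemma blk_smul (c : ℝ) (S : Matrix (Fin n × Fin d) (Fin k) ℝ) (i : Fin n) :
    blk (c • S) i = c • blk S i := rfl

lemma blk_mul' (S : Matrix (Fin n × Fin d) (Fin k) ℝ) (M : Matrix (Fin k) (Fin l) ℝ)
    (i : Fin n) : blk (S * M) i = blk S i * M := rfl

lemma ext_blk {S T : Matrix (Fin n × Fin d) (Fin k) ℝ} (h : ∀ i, blk S i = blk T i) : S = T := by
  ext ⟨i, a⟩ b
  exact congrFun (congrFun (h i) a) b

lemma ZStack_transpose_mul (S : Matrix (Fin n × Fin d) (Fin k) ℝ) :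
    (ZStack n d)ᵀ * S = ∑ i, blk S i := by
  ext a b
  simp [Matrix.mul_apply, Matrix.sum_apply, Fintype.sum_prod_type, ZStack, blk]

lemma blk_ZStack (i : Fin n) : blk (ZStack n d) i = 1 := by
  ext a b
  simp [blk, ZStack, Matrix.one_apply]

lemma blk_ZStack_mul (M : Matrix (Fin d) (Fin k) ℝ) (i : Fin n) : blk (ZStack n d * M) i = M := by
  rw [blk_mul', blk_ZStack, Matrix.one_mul]

lemma ZStack_transpose_mul_self :
    (ZStack n d)ᵀ * ZStack n d = (n : ℝ) • (1 : Matrix (Fin d) (Fin d) ℝ) := by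
  rw [ZStack_transpose_mul]
  simp [blk_ZStack, Nat.cast_smul_eq_nsmul]

lemma vnorm_ZStack_mulVec (v : Fin d → ℝ) :
    vnorm (ZStack n d *ᵥ v) = Real.sqrt n * vnorm v := by
  refine (pow_left_inj₀ (vnorm_nonneg _) (by have := vnorm_nonneg v; positivity) two_ne_zero).1 ?_
  have := vnorm_sq_mulVec_transpose (ZStack n d)ᵀ v
  rw [Matrix.transpose_transpose, ZStack_transpose_mul_self] at this
  rw [this, mul_pow, Real.sq_sqrt (Nat.cast_nonneg n), vnorm_sq]
  simp [Matrix.smul_mulVec]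

lemma opB_ZStack : OpB (ZStack n d) (Real.sqrt n) :=
  ⟨Real.sqrt_nonneg _, fun v => (vnorm_ZStack_mulVec v).le⟩

/-- Every block has operator norm at most one. -/
def BallBlocks (S : Matrix (Fin n × Fin d) (Fin d) ℝ) : Prop := ∀ i, OpB (blk S i) 1

lemma OrthBlocks.ball {S : Matrix (Fin n × Fin d) (Fin d) ℝ} (h : OrthBlocks S) : BallBlocks S :=
  fun i => (h i).opB

lemma orthBlocks_ZStack_mul {Q : Matrix (Fin d) (Fin d) ℝ} (h : IsOrth Q) :
    OrthBlocks (ZStack n d * Q) := fun i => by rwa [blk_ZStack_mul]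

lemma orthBlocks_ZStack : OrthBlocks (ZStack n d) := fun i => by
  rw [blk_ZStack]; exact isOrth_one

lemma OrthBlocks.mul {S : Matrix (Fin n × Fin d) (Fin d) ℝ} (h : OrthBlocks S)
    {Q : Matrix (Fin d) (Fin d) ℝ} (hQ : IsOrth Q) : OrthBlocks (S * Q) := fun i => by
  rw [blk_mul']; exact (h i).mul hQ

lemma BallBlocks.mul {S : Matrix (Fin n × Fin d) (Fin d) ℝ} (h : BallBlocks S)
    {Q : Matrix (Fin d) (Fin d) ℝ} (hQ : IsOrth Q) : BallBlocks (S * Q) := fun i => by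
  rw [blk_mul']; simpa using (h i).mul hQ.opB

lemma BallBlocks.frob_sq_le {S : Matrix (Fin n × Fin d) (Fin d) ℝ} (h : BallBlocks S) :
    frob S ^ 2 ≤ n * d := by
  rw [frob_sq_blk]
  refine (Finset.sum_le_sum fun i _ => (h i).frob_sq_le).trans ?_
  simp

lemma BallBlocks.frob_le {S : Matrix (Fin n × Fin d) (Fin d) ℝ} (h : BallBlocks S) :
    frob S ≤ Real.sqrt n * Real.sqrt d := by
  rw [← Real.sqrt_mul (Nat.cast_nonneg n)]
  exact Real.le_sqrt_of_sq_le h.frob_sq_le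

lemma BallBlocks.opB {S : Matrix (Fin n × Fin d) (Fin d) ℝ} (h : BallBlocks S) :
    OpB S (Real.sqrt n) := by
  refine ⟨Real.sqrt_nonneg _, fun v => ?_⟩
  refine (pow_le_pow_iff_left₀ (vnorm_nonneg _)
    (by have := vnorm_nonneg v; positivity) two_ne_zero).1 ?_
  rw [mul_pow, Real.sq_sqrt (Nat.cast_nonneg n)]
  have e : vnorm (S *ᵥ v) ^ 2 = ∑ i, vnorm (blk S i *ᵥ v) ^ 2 := by
    simp only [vnorm_sq, dotProduct, Fintype.sum_prod_type]
    rfl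
  rw [e]
  have : ∀ i ∈ Finset.univ, vnorm (blk S i *ᵥ v) ^ 2 ≤ vnorm v ^ 2 := fun i _ =>
    pow_le_pow_left₀ (vnorm_nonneg _) (by simpa using (h i).2 v) 2
  refine (Finset.sum_le_sum this).trans ?_
  simp

lemma OrthBlocks.frob_sq_eq {S : Matrix (Fin n × Fin d) (Fin d) ℝ} (h : OrthBlocks S) :
    frob S ^ 2 = n * d := by
  rw [frob_sq_blk, Finset.sum_congr rfl fun i _ => (h i).frob_sq_eq]
  simp

lemma BallBlocks.segment {S T : Matrix (Fin n × Fin d) (Fin d) ℝ} (hS : BallBlocks S)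
    (hT : BallBlocks T) {t : ℝ} (h0 : 0 ≤ t) (h1 : t ≤ 1) : BallBlocks (T + t • (S - T)) := by
  intro i
  have : blk (T + t • (S - T)) i = (1 - t) • blk T i + t • blk S i := by
    rw [blk_add, blk_smul, blk_sub]; module
  rw [this]
  refine (((hT i).smul _).add ((hS i).smul _)).mono ?_
  rw [abs_of_nonneg h0, abs_of_nonneg (by linarith)]; linarith

lemma isCompact_ballBlocks : IsCompact {S : Matrix (Fin n × Fin d) (Fin d) ℝ | BallBlocks S} := by
  refine isCompact_of_abs_le ?_ fun S hS p j => (hS p.1).abs_apply_le p.2 j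
  simp only [BallBlocks, OpB, Set.ofPred_forall, Set.ofPred_and]
  refine isClosed_iInter fun i => (isClosed_const).inter (isClosed_iInter fun v => ?_)
  refine isClosed_le ?_ continuous_const
  have : Continuous fun S : Matrix (Fin n × Fin d) (Fin d) ℝ => blk S i *ᵥ v := by
    unfold blk
    refine Continuous.matrix_mulVec ?_ continuous_const
    fun_prop
  unfold vnorm
  fun_prop

end Blocks

section Parameters

variable {n d m : ℕ}

/-- The bounds on the signal `A` and on the noise `w` used by the deterministic analysis. -/
structure Regime (n : ℕ) {d m : ℕ} (A : Matrix (Fin d) (Fin m) ℝ) (s a β δ : ℝ) : Prop where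
  hn : 1 ≤ n
  hd : 1 ≤ d
  s_pos : 0 < s
  opB_A : OpB A a
  le_A : ∀ u, s * vnorm u ≤ vnorm (Aᵀ *ᵥ u)
  β_nonneg : 0 ≤ β
  δ_pos : 0 < δ
  aδ_le : a * δ ≤ s / 200
  noise_le : a * β * Real.sqrt d ≤ δ * s ^ 2 * Real.sqrt n

variable {A : Matrix (Fin d) (Fin m) ℝ} {s a β δ : ℝ}

lemma le_of_opB_of_le (hd : 1 ≤ d) (hA : OpB A a)
    (hs : ∀ u, s * vnorm u ≤ vnorm (Aᵀ *ᵥ u)) : s ≤ a := by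
  have h1 := hs (Pi.single ⟨0, hd⟩ 1)
  have h2 := hA.transpose.2 (Pi.single ⟨0, hd⟩ 1)
  have h3 : vnorm (Pi.single (⟨0, hd⟩ : Fin d) (1 : ℝ)) = 1 := by
    have := vnorm_sq (Pi.single (⟨0, hd⟩ : Fin d) (1 : ℝ))
    simp only [dotProduct_single, Pi.single_eq_same, mul_one] at this
    have h0 := vnorm_nonneg (Pi.single (⟨0, hd⟩ : Fin d) (1 : ℝ))
    nlinarith
  rw [h3] at h1 h2
  linarith

lemma Regime.s_le_a (h : Regime n A s a β δ) : s ≤ a := le_of_opB_of_le h.hd h.opB_A h.le_A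

lemma Regime.a_pos (h : Regime n A s a β δ) : 0 < a := h.s_pos.trans_le h.s_le_a

lemma Regime.δ_le (h : Regime n A s a β δ) : δ ≤ 1 / 200 := by
  have h1 := h.aδ_le
  have h2 := h.s_le_a
  have h3 := h.δ_pos
  have h4 := h.s_pos
  by_contra! hc
  nlinarith

lemma Regime.sqrt_pos (h : Regime n A s a β δ) : 1 ≤ Real.sqrt n :=
  Real.one_le_sqrt.2 (by exact_mod_cast h.hn)

lemma Regime.one_le_sqrt_d (h : Regime n A s a β δ) : 1 ≤ Real.sqrt d :=
  Real.one_le_sqrt.2 (by exact_mod_cast h.hd)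

lemma Regime.sq_sqrt (h : Regime n A s a β δ) : Real.sqrt n ^ 2 = n := Real.sq_sqrt (by
  exact_mod_cast (zero_le_one.trans h.hn))

lemma Regime.β_sqrt_le (h : Regime n A s a β δ) : β * Real.sqrt d ≤ δ * s * Real.sqrt n := by
  have h1 := h.noise_le
  have h2 := h.s_le_a
  have h3 := h.s_pos
  have h4 := h.sqrt_pos
  have h5 := h.δ_pos
  have h6 : a * (β * Real.sqrt d) ≤ a * (δ * s * Real.sqrt n) := by
    have : δ * s * Real.sqrt n * s ≤ δ * s * Real.sqrt n * a :=
      mul_le_mul_of_nonneg_left h2 (by positivity)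
    nlinarith
  exact le_of_mul_le_mul_left h6 h.a_pos

lemma Regime.β_le (h : Regime n A s a β δ) : β ≤ δ * s * Real.sqrt n := by
  have h1 := h.β_sqrt_le
  have h2 := mul_le_mul_of_nonneg_left h.one_le_sqrt_d h.β_nonneg
  linarith

lemma Regime.β_le_a (h : Regime n A s a β δ) : β ≤ Real.sqrt n * a := by
  have h1 := h.β_le
  have h2 := h.δ_le
  have h3 := h.sqrt_pos
  have h4 := h.s_le_a
  have h5 := h.s_pos
  have h6 : δ * (s * Real.sqrt n) ≤ 1 * (s * Real.sqrt n) :=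
    mul_le_mul_of_nonneg_right (by linarith) (by positivity)
  nlinarith

/-- The deviation of `(Z A + w) (Z A + w)ᵀ` from its noiseless value. -/
def dev (A : Matrix (Fin d) (Fin m) ℝ) (w : Matrix (Fin n × Fin d) (Fin m) ℝ) :
    Matrix (Fin n × Fin d) (Fin n × Fin d) ℝ :=
  ZStack n d * A * wᵀ + w * (ZStack n d * A)ᵀ + w * wᵀ

/-- The data matrix `Z A + w`. -/
def dat (A : Matrix (Fin d) (Fin m) ℝ) (w : Matrix (Fin n × Fin d) (Fin m) ℝ) :
    Matrix (Fin n × Fin d) (Fin m) ℝ := ZStack n d * A + w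

/-- The Gram matrix of the data. -/
def gram (A : Matrix (Fin d) (Fin m) ℝ) (w : Matrix (Fin n × Fin d) (Fin m) ℝ) :
    Matrix (Fin n × Fin d) (Fin n × Fin d) ℝ := dat A w * (dat A w)ᵀ

lemma gram_eq (A : Matrix (Fin d) (Fin m) ℝ) (w : Matrix (Fin n × Fin d) (Fin m) ℝ) :
    gram A w = ZStack n d * (A * Aᵀ) * (ZStack n d)ᵀ + dev A w := by
  simp only [gram, dat, dev, Matrix.transpose_add, Matrix.mul_add, Matrix.add_mul,
    Matrix.transpose_mul, Matrix.mul_assoc]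
  abel

lemma gram_transpose (A : Matrix (Fin d) (Fin m) ℝ) (w : Matrix (Fin n × Fin d) (Fin m) ℝ) :
    (gram A w)ᵀ = gram A w := by simp [gram]

lemma ip_gram_mul (A : Matrix (Fin d) (Fin m) ℝ) (w : Matrix (Fin n × Fin d) (Fin m) ℝ)
    (S T : Matrix (Fin n × Fin d) (Fin d) ℝ) :
    ip (gram A w * S) T = ip S (gram A w * T) := by
  rw [ip_mul_left, gram_transpose]

lemma ip_gram_mul_self (A : Matrix (Fin d) (Fin m) ℝ) (w : Matrix (Fin n × Fin d) (Fin m) ℝ)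
    (S : Matrix (Fin n × Fin d) (Fin d) ℝ) :
    ip (gram A w * S) S = frob ((dat A w)ᵀ * S) ^ 2 := by
  rw [gram, Matrix.mul_assoc, ip_mul_left, ← frob_sq]

variable {w : Matrix (Fin n × Fin d) (Fin m) ℝ}

lemma Regime.opB_dat (h : Regime n A s a β δ) (hw : OpB w β) :
    OpB (dat A w) (Real.sqrt n * a + β) := (opB_ZStack.mul h.opB_A).add hw

lemma Regime.opB_dev (h : Regime n A s a β δ) (hw : OpB w β) :
    OpB (dev A w) (3 * (Real.sqrt n * a * β)) := by
  have hZ : OpB (ZStack n d * A) (Real.sqrt n * a) := opB_ZStack.mul h.opB_A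
  refine (((hZ.mul hw.transpose).add (hw.mul hZ.transpose)).add (hw.mul hw.transpose)).mono ?_
  have := mul_le_mul_of_nonneg_right h.β_le_a h.β_nonneg
  linarith

lemma Regime.frob_dev_mul_le (h : Regime n A s a β δ) (hw : OpB w β)
    {T : Matrix (Fin n × Fin d) (Fin d) ℝ} (hT : BallBlocks T) :
    frob (dev A w * T) ≤ 3 * δ * s ^ 2 * n * Real.sqrt n := by
  have h1 := (h.opB_dev hw).frob_mul T
  have h2 := hT.frob_le
  have h3 := h.a_pos
  have h4 := h.β_nonneg
  have h5 := h.sqrt_pos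
  calc frob (dev A w * T) ≤ 3 * (Real.sqrt n * a * β) * (Real.sqrt n * Real.sqrt d) :=
        h1.trans (mul_le_mul_of_nonneg_left h2 (by positivity))
    _ = 3 * n * (a * β * Real.sqrt d) := by
        linear_combination 3 * a * β * Real.sqrt d * h.sq_sqrt
    _ ≤ 3 * n * (δ * s ^ 2 * Real.sqrt n) :=
        mul_le_mul_of_nonneg_left h.noise_le (by positivity)
    _ = _ := by ring

lemma Regime.vnorm_AAt (h : Regime n A s a β δ) (u : Fin d → ℝ) :
    s ^ 2 * vnorm u ≤ vnorm ((A * Aᵀ) *ᵥ u) := by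
  by_cases hu : vnorm u = 0
  · rw [hu, mul_zero]; exact vnorm_nonneg _
  have hp : 0 < vnorm u := lt_of_le_of_ne (vnorm_nonneg _) (Ne.symm hu)
  have h1 := pow_le_pow_left₀ (by have := h.s_pos; positivity) (h.le_A u) 2
  rw [vnorm_sq_mulVec_transpose] at h1
  have h2 := h1.trans (dotProduct_le _ _)
  refine le_of_mul_le_mul_left ?_ hp
  linarith

lemma Regime.vnorm_signal (h : Regime n A s a β δ) {T : Matrix (Fin n × Fin d) (Fin d) ℝ}
    {Q : Matrix (Fin d) (Fin d) ℝ} (hQ : IsOrth Q)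
    (hT : frob (T - ZStack n d * Q) ≤ Real.sqrt n / 4) (v : Fin d → ℝ) :
    3 / 4 * n * s ^ 2 * vnorm v ≤ vnorm ((A * Aᵀ * ((ZStack n d)ᵀ * T)) *ᵥ v) := by
  rw [← Matrix.mulVec_mulVec]
  refine le_trans ?_ (h.vnorm_AAt _)
  have e : ((ZStack n d)ᵀ * T) *ᵥ v
      + ((ZStack n d)ᵀ * -(T - ZStack n d * Q)) *ᵥ v = (n : ℝ) • (Q *ᵥ v) := by
    rw [← Matrix.add_mulVec, ← Matrix.mul_add, ← sub_eq_add_neg, sub_sub_cancel,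
      ← Matrix.mul_assoc, ZStack_transpose_mul_self, Matrix.smul_mul, Matrix.one_mul,
      Matrix.smul_mulVec]
  have h1 := vnorm_add_le (((ZStack n d)ᵀ * T) *ᵥ v) (((ZStack n d)ᵀ * -(T - ZStack n d * Q)) *ᵥ v)
  rw [e, vnorm_smul, vnorm_mulVec_of_transpose_mul hQ.1, Nat.abs_cast] at h1
  have h2 := (opB_ZStack.transpose.mul (opB_frob (T - ZStack n d * Q)).neg).2 v
  have h3 : Real.sqrt n * frob (T - ZStack n d * Q) * vnorm v
      ≤ Real.sqrt n * (Real.sqrt n / 4) * vnorm v :=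
    mul_le_mul_of_nonneg_right (mul_le_mul_of_nonneg_left hT (Real.sqrt_nonneg _)) (vnorm_nonneg _)
  have h4 : 3 / 4 * n * vnorm v ≤ vnorm (((ZStack n d)ᵀ * T) *ᵥ v) := by
    have : Real.sqrt n * (Real.sqrt n / 4) = n / 4 := by
      linear_combination (1 / 4) * h.sq_sqrt
    rw [this] at h3
    linarith
  have := mul_le_mul_of_nonneg_left h4 (sq_nonneg s)
  linarith

end Parameters

lemma frob_mul_lower {α β γ : Type*} [Fintype α] [Fintype β] [Fintype γ] {X : Matrix α β ℝ} {s : ℝ}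
    (hs : 0 ≤ s) (h : ∀ u, s * vnorm u ≤ vnorm (X *ᵥ u)) (Y : Matrix β γ ℝ) :
    s ^ 2 * frob Y ^ 2 ≤ frob (X * Y) ^ 2 := by
  rw [frob_sq_eq_sum_col, frob_sq_eq_sum_col, Finset.mul_sum]
  refine Finset.sum_le_sum fun j _ => ?_
  rw [← mul_pow]
  exact pow_le_pow_left₀ (mul_nonneg hs (vnorm_nonneg _)) (h _) 2

/-- First-order optimality on a segment. -/
lemma nonpos_of_quadratic {b c t₀ : ℝ} (h0 : 0 < t₀)
    (h : ∀ t, 0 < t → t ≤ t₀ → 2 * t * b + t ^ 2 * c ≤ 0) : b ≤ 0 := by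
  by_contra! hb
  have hp : 0 < b / (|c| + 1) := by positivity
  have ht : 0 < min t₀ (b / (|c| + 1)) := lt_min h0 hp
  have h1 := h _ ht (min_le_left _ _)
  have h2 := min_le_right t₀ (b / (|c| + 1))
  set t := min t₀ (b / (|c| + 1))
  have h3 : t * (|c| + 1) ≤ b := by
    rwa [le_div_iff₀ (by positivity)] at h2
  have h4 := neg_abs_le c
  have h5 : t * (2 * b + t * c) ≤ 0 := by linarith
  have h6 : 0 < 2 * b + t * c := by nlinarith
  nlinarith

lemma exists_transpose_mul_self {κ : Type*} [Fintype κ] {H : Matrix κ κ ℝ} (hH : H.PosSemidef) :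
    ∃ (k : ℕ) (B : Matrix (Fin k) κ ℝ), H = Bᵀ * B := by
  obtain ⟨k, v, hv⟩ := exists_sum_vecMulVec hH
  refine ⟨k, Matrix.of v, ?_⟩
  ext i j
  rw [hv]
  simp [Matrix.sum_apply, Matrix.mul_apply, vecMulVec_apply]

section Localization

variable {n d m : ℕ} {A : Matrix (Fin d) (Fin m) ℝ} {s a β δ : ℝ}
  {w : Matrix (Fin n × Fin d) (Fin m) ℝ}

lemma BallBlocks.gap_posSemidef {T : Matrix (Fin n × Fin d) (Fin d) ℝ} (hT : BallBlocks T)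
    (hsymm : ((ZStack n d)ᵀ * T)ᵀ = (ZStack n d)ᵀ * T) :
    ((ZStack n d)ᵀ * (ZStack n d - T)).PosSemidef := by
  refine posSemidef_iff_real.2 ⟨?_, fun v => ?_⟩
  · rw [Matrix.mul_sub, Matrix.transpose_sub, hsymm, ZStack_transpose_mul_self]; simp
  · rw [ZStack_transpose_mul, Matrix.sum_mulVec, dotProduct_sum]
    refine Finset.sum_nonneg fun i _ => ?_
    rw [blk_sub, blk_ZStack, Matrix.sub_mulVec, dotProduct_sub, Matrix.one_mulVec, ← vnorm_sq]
    have h1 := dotProduct_le v (blk T i *ᵥ v)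
    have h2 := mul_le_mul_of_nonneg_left ((hT i).2 v) (vnorm_nonneg v)
    linarith

lemma Regime.near_bound (h : Regime n A s a β δ) {T : Matrix (Fin n × Fin d) (Fin d) ℝ}
    (hT : BallBlocks T) (hsymm : ((ZStack n d)ᵀ * T)ᵀ = (ZStack n d)ᵀ * T)
    (hnear : frob (T - ZStack n d) ≤ Real.sqrt n / 4)
    (hvi : ip (gram A w * T - (n * s ^ 2 / 2) • T) (ZStack n d - T) ≤ 0) :
    n * s ^ 2 * frob (T - ZStack n d) ≤ 2 * frob (dev A w * T) := by
  set Δ := (ZStack n d)ᵀ * (ZStack n d - T) with hΔ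
  obtain ⟨k, B, hB⟩ := exists_transpose_mul_self (hT.gap_posSemidef hsymm)
  rw [← hΔ] at hB
  have hΔop : OpB Δ (n / 4) := by
    refine (opB_ZStack.transpose.mul (opB_frob _)).mono ?_
    rw [frob_sub_comm]
    have := mul_le_mul_of_nonneg_left hnear (Real.sqrt_nonneg n)
    linarith [h.sq_sqrt]
  have hBop : OpB B (Real.sqrt n / 2) := by
    refine ⟨by positivity, fun v => ?_⟩
    refine (pow_le_pow_iff_left₀ (vnorm_nonneg _)
      (by have := vnorm_nonneg v; positivity) two_ne_zero).1 ?_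
    have e := vnorm_sq_mulVec_transpose Bᵀ v
    rw [Matrix.transpose_transpose, ← hB] at e
    rw [e, mul_pow, div_pow, h.sq_sqrt]
    have h1 := dotProduct_le v (Δ *ᵥ v)
    have h2 := mul_le_mul_of_nonneg_left (hΔop.2 v) (vnorm_nonneg v)
    linarith
  have hPT : (ZStack n d)ᵀ * T = (n : ℝ) • (1 : Matrix (Fin d) (Fin d) ℝ) - Δ := by
    rw [hΔ, Matrix.mul_sub, ZStack_transpose_mul_self, sub_sub_cancel]
  have e0 : ip (A * Aᵀ) Δ = frob (Aᵀ * Bᵀ) ^ 2 := by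
    rw [frob_sq, ip_mul_left, ip_mul_right, Matrix.transpose_transpose, Matrix.mul_assoc, hB]
  have e1 : ip (A * Aᵀ * Δ) Δ ≤ n / 4 * frob (Aᵀ * Bᵀ) ^ 2 := by
    rw [Matrix.mul_assoc, ip_mul_left, ← frob_sq, hB, ← Matrix.mul_assoc]
    have := pow_le_pow_left₀ (frob_nonneg _) (hBop.frob_mul_right (Aᵀ * Bᵀ)) 2
    rw [mul_pow, div_pow, h.sq_sqrt] at this
    linarith
  have e2 : s ^ 2 * trace Δ ≤ frob (Aᵀ * Bᵀ) ^ 2 := by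
    have e : trace Δ = frob Bᵀ ^ 2 := by rw [frob_transpose, frob_sq, ip, hB]
    rw [e]
    exact frob_mul_lower h.s_pos.le h.le_A Bᵀ
  have e3 : ip (gram A w * T) (ZStack n d - T)
      = n * ip (A * Aᵀ) Δ - ip (A * Aᵀ * Δ) Δ + ip (dev A w * T) (ZStack n d - T) := by
    rw [gram_eq, Matrix.add_mul, ip_add_left, Matrix.mul_assoc, Matrix.mul_assoc, ip_mul_left, ← hΔ,
      hPT, Matrix.mul_sub, ip_sub_left, Matrix.mul_smul, ip_smul_left, Matrix.mul_one]
  have e4 : ip T (ZStack n d - T) = trace Δ - frob (T - ZStack n d) ^ 2 := by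
    have : trace Δ = ip (ZStack n d) (ZStack n d - T) := rfl
    rw [this, frob_sq]
    simp only [ip_sub_left, ip_sub_right, ip_comm T (ZStack n d)]
    ring
  rw [ip_sub_left, ip_smul_left, e3, e4, e0] at hvi
  have e5 : 0 ≤ trace Δ := (hT.gap_posSemidef hsymm).trace_nonneg
  have e6 : -ip (dev A w * T) (ZStack n d - T)
      ≤ frob (dev A w * T) * frob (T - ZStack n d) := by
    have := ip_le (dev A w * T) (T - ZStack n d)
    rw [ip_sub_right] at this ⊢
    linarith
  have hn0 : (0 : ℝ) < n := by exact_mod_cast h.hn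
  have hs0 := h.s_pos
  have e7 : 0 ≤ n * s ^ 2 * trace Δ := by positivity
  have e8 := mul_le_mul_of_nonneg_left e2 hn0.le
  have e9 : n * s ^ 2 / 2 * frob (T - ZStack n d) ^ 2
      ≤ frob (dev A w * T) * frob (T - ZStack n d) := by
    nlinarith
  rcases eq_or_lt_of_le (frob_nonneg (T - ZStack n d)) with h0 | h0
  · rw [← h0, mul_zero]; have := frob_nonneg (dev A w * T); positivity
  · refine le_of_mul_le_mul_right ?_ h0
    linarith

/-- A critical point of the penalised problem over the blockwise unit ball which is aligned with
the signal and lies near it. -/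
structure Sol (A : Matrix (Fin d) (Fin m) ℝ) (s : ℝ) (w : Matrix (Fin n × Fin d) (Fin m) ℝ)
    (T : Matrix (Fin n × Fin d) (Fin d) ℝ) : Prop where
  ball : BallBlocks T
  vi : ∀ Y, BallBlocks Y → ip (gram A w * T - (n * s ^ 2 / 2) • T) (Y - T) ≤ 0
  psd : ((ZStack n d)ᵀ * T).PosSemidef
  near : frob (T - ZStack n d) ≤ Real.sqrt n / 4

lemma Sol.symm {T : Matrix (Fin n × Fin d) (Fin d) ℝ} (hT : Sol A s w T) :
    ((ZStack n d)ᵀ * T)ᵀ = (ZStack n d)ᵀ * T := (posSemidef_iff_real.1 hT.psd).1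

lemma Regime.near_of_vi (h : Regime n A s a β δ) (hw : OpB w β)
    {T : Matrix (Fin n × Fin d) (Fin d) ℝ}
    (hT : BallBlocks T) (hsymm : ((ZStack n d)ᵀ * T)ᵀ = (ZStack n d)ᵀ * T)
    (hnear : frob (T - ZStack n d) ≤ Real.sqrt n / 4)
    (hvi : ip (gram A w * T - (n * s ^ 2 / 2) • T) (ZStack n d - T) ≤ 0) :
    frob (T - ZStack n d) ≤ 6 * δ * Real.sqrt n := by
  have h1 := h.near_bound hT hsymm hnear hvi
  have h2 := h.frob_dev_mul_le hw hT
  have hn0 : (0 : ℝ) < n := by exact_mod_cast h.hn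
  have hs0 := h.s_pos
  refine le_of_mul_le_mul_left (a := n * s ^ 2) ?_ (by positivity)
  linarith

lemma Sol.near' {T : Matrix (Fin n × Fin d) (Fin d) ℝ} (hT : Sol A s w T)
    (h : Regime n A s a β δ) (hw : OpB w β) : frob (T - ZStack n d) ≤ 6 * δ * Real.sqrt n :=
  h.near_of_vi hw hT.ball hT.symm hT.near (hT.vi _ orthBlocks_ZStack.ball)

lemma ip_gram_sub_symm (τ : ℝ) (S T : Matrix (Fin n × Fin d) (Fin d) ℝ) :
    ip (gram A w * S - τ • S) T = ip (gram A w * T - τ • T) S := by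
  rw [ip_sub_left, ip_sub_left, ip_gram_mul, ip_comm, ip_smul_left, ip_smul_left, ip_comm S T]

lemma Regime.exists_sol (h : Regime n A s a β δ) (hw : OpB w β) : ∃ T, Sol A s w T := by
  set τ := n * s ^ 2 / 2 with hτ
  set f : Matrix (Fin n × Fin d) (Fin d) ℝ → ℝ := fun S => ip (gram A w * S - τ • S) S with hf
  set K := {S : Matrix (Fin n × Fin d) (Fin d) ℝ | BallBlocks S} ∩
    {S | frob (S - ZStack n d) ≤ Real.sqrt n / 4} with hK
  have hKc : IsCompact K := isCompact_ballBlocks.inter_right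
    (isClosed_le (frob_continuous.comp (by fun_prop)) continuous_const)
  have hZ : ZStack n d ∈ K := ⟨orthBlocks_ZStack.ball, by
    have : frob (ZStack n d - ZStack n d) = 0 := by rw [sub_self]; exact frob_eq_zero.2 rfl
    simp only [Set.mem_ofPred_eq, this]; positivity⟩
  have hfc : Continuous f := ip_continuous.comp (by fun_prop :
    Continuous fun S : Matrix (Fin n × Fin d) (Fin d) ℝ => (gram A w * S - τ • S, S))
  obtain ⟨T₀, hT₀, hmax⟩ := hKc.exists_isMaxOn ⟨_, hZ⟩ hfc.continuousOn
  obtain ⟨R, hR, hRT⟩ := exists_polar (T₀ᵀ * ZStack n d)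
  set T := T₀ * R with hT
  have hpsd : ((ZStack n d)ᵀ * T).PosSemidef := by
    have e : (ZStack n d)ᵀ * T = (Rᵀ * (T₀ᵀ * ZStack n d))ᵀ := by
      simp [hT, Matrix.mul_assoc]
    rw [e, (posSemidef_iff_real.1 hRT).1]; exact hRT
  have hsymm := (posSemidef_iff_real.1 hpsd).1
  have hball : BallBlocks T := hT₀.1.mul hR
  have hfT : f T = f T₀ := by
    simp only [hf, hT]
    rw [← Matrix.mul_assoc, ← Matrix.smul_mul, ← Matrix.sub_mul, hR.ip_mul]
  have hnear : frob (T - ZStack n d) ≤ Real.sqrt n / 4 := by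
    refine le_trans ?_ hT₀.2
    refine (pow_le_pow_iff_left₀ (frob_nonneg _) (frob_nonneg _) two_ne_zero).1 ?_
    have e1 : ip (ZStack n d) T₀ ≤ ip (ZStack n d) T := by
      have := ip_le_trace hRT (Y := Rᵀ) hR.transpose.opB
      rw [← ip_mul_left R, hR.2] at this
      rw [ip_comm _ T₀, ip_comm _ T]
      simpa [ip, hT, Matrix.transpose_mul, Matrix.mul_assoc] using this
    have e2 : ip T T = ip T₀ T₀ := hR.ip_mul T₀ T₀
    rw [frob_sq, frob_sq]
    simp only [ip_sub_left, ip_sub_right, e2, ip_comm T (ZStack n d), ip_comm T₀ (ZStack n d)]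
    linarith
  have hexp : ∀ (E : Matrix (Fin n × Fin d) (Fin d) ℝ) (t : ℝ),
      f (T + t • E) = f T + (2 * t * ip (gram A w * T - τ • T) E + t ^ 2 * f E) := by
    intro E t
    have := ip_gram_sub_symm (A := A) (w := w) τ E T
    have e : gram A w * (T + t • E) - τ • (T + t • E)
        = (gram A w * T - τ • T) + t • (gram A w * E - τ • E) := by
      rw [Matrix.mul_add, Matrix.mul_smul]; module
    simp only [hf, e, ip_add_left, ip_add_right, ip_smul_left, ip_smul_right, this]
    ring
  have hfoc : ∀ (E : Matrix (Fin n × Fin d) (Fin d) ℝ) (t₀ : ℝ), 0 < t₀ →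
      (∀ t, 0 < t → t ≤ t₀ → T + t • E ∈ K) → ip (gram A w * T - τ • T) E ≤ 0 := by
    intro E t₀ h0 hE
    refine nonpos_of_quadratic h0 (c := f E) fun t h1 h2 => ?_
    have h3 : f (T + t • E) ≤ f T₀ := hmax (hE t h1 h2)
    rw [hexp, ← hfT] at h3
    linarith
  have hviZ : ip (gram A w * T - τ • T) (ZStack n d - T) ≤ 0 := by
    refine hfoc _ 1 one_pos fun t h1 h2 =>
      ⟨hZ.1.segment hball h1.le h2, ?_⟩
    have e : T + t • (ZStack n d - T) - ZStack n d = (1 - t) • (T - ZStack n d) := by module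
    simp only [Set.mem_ofPred_eq]
    rw [e, frob_smul, abs_of_nonneg (by linarith)]
    refine le_trans ?_ hnear
    have := frob_nonneg (T - ZStack n d)
    nlinarith
  have hnear' := h.near_of_vi hw hball hsymm hnear hviZ
  have hr := h.sqrt_pos
  refine ⟨T, hball, fun Y hY => ?_, hpsd, hnear⟩
  have hF := frob_nonneg (Y - T)
  have hpos : 0 < Real.sqrt n / 8 / (frob (Y - T) + 1) := by positivity
  refine hfoc _ (min 1 (Real.sqrt n / 8 / (frob (Y - T) + 1))) (lt_min one_pos hpos)
    fun t h1 h2 => ⟨hY.segment hball h1.le (h2.trans (min_le_left _ _)), ?_⟩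
  have h3 := h2.trans (min_le_right _ _)
  rw [le_div_iff₀ (by positivity)] at h3
  have e : T + t • (Y - T) - ZStack n d = (T - ZStack n d) + t • (Y - T) := by abel
  simp only [Set.mem_ofPred_eq]
  rw [e]
  refine (frob_add_le _ _).trans ?_
  rw [frob_smul, abs_of_pos h1]
  have := mul_le_mul_of_nonneg_right h.δ_le (zero_le_one.trans hr)
  nlinarith

end Localization

section Comparison

variable {n d m : ℕ} {A : Matrix (Fin d) (Fin m) ℝ} {s a β δ : ℝ}
  {w w' : Matrix (Fin n × Fin d) (Fin m) ℝ} {T T' : Matrix (Fin n × Fin d) (Fin d) ℝ}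

lemma blk_gram_mul (S : Matrix (Fin n × Fin d) (Fin d) ℝ) (i : Fin n) :
    blk (gram A w * S) i = A * Aᵀ * ((ZStack n d)ᵀ * S) + blk (dev A w * S) i := by
  rw [gram_eq, Matrix.add_mul, blk_add, Matrix.mul_assoc, Matrix.mul_assoc, blk_ZStack_mul,
    Matrix.mul_assoc]

lemma ip_blk_le_of_vi (hT : BallBlocks T) {X : Matrix (Fin n × Fin d) (Fin d) ℝ}
    (hvi : ∀ Y, BallBlocks Y → ip X (Y - T) ≤ 0) (i : Fin n) {R : Matrix (Fin d) (Fin d) ℝ}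
    (hR : OpB R 1) : ip (blk X i) (R - blk T i) ≤ 0 := by
  classical
  let Y : Matrix (Fin n × Fin d) (Fin d) ℝ := stack fun j => if j = i then R else blk T j
  have hY : ∀ j, blk Y j = if j = i then R else blk T j := fun j => rfl
  have h1 := hvi Y fun j => by
    rw [hY]; split_ifs
    exacts [hR, hT j]
  rw [ip_blk, Finset.sum_eq_single i] at h1
  · simpa [blk_sub, hY] using h1
  · intro j _ hj
    rw [blk_sub, hY, if_neg hj, sub_self]
    simp [ip]
  · simp

/-- If the gradient at a block is uniformly invertible beyond the penalty, the block is
orthogonal. -/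
lemma Sol.isOrth_of_lower (hT : Sol A s w T) (h : Regime n A s a β δ) (i : Fin n) {t : ℝ}
    (ht' : n * s ^ 2 / 2 < t)
    (hlow : ∀ v, t * vnorm v ≤ vnorm (blk (gram A w * T) i *ᵥ v)) : IsOrth (blk T i) := by
  obtain ⟨R, hR, hRX⟩ := exists_polar (blk (gram A w * T) i)
  have h1 := polar_gap hR hRX hlow (hT.ball i)
  have h2 := ip_blk_le_of_vi hT.ball hT.vi i hR.opB
  rw [blk_sub, blk_smul, ip_sub_left, ip_smul_left, ip_sub_right, ip_sub_right] at h2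
  have h3 := (hT.ball i).frob_sq_le
  have h4 := hR.frob_sq_eq
  have h5 : frob (R - blk T i) ^ 2 = ip R R - 2 * ip R (blk T i) + ip (blk T i) (blk T i) := by
    rw [frob_sq]
    simp only [ip_sub_left, ip_sub_right, ip_comm (blk T i) R]; ring
  rw [frob_sq] at h3 h4
  rw [ip_comm (blk T i) R] at h2
  have hn0 : (0 : ℝ) < n := by exact_mod_cast h.hn
  have hns : 0 < n * s ^ 2 := mul_pos hn0 (pow_pos h.s_pos 2)
  set τ := n * s ^ 2 / 2
  have hτ : 0 < τ := by positivity
  have h6 : (t + τ) / 2 * frob (R - blk T i) ^ 2 ≤ 0 := by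
    have h7 : 0 ≤ (t - τ) / 2 * (d - ip (blk T i) (blk T i)) :=
      mul_nonneg (by linarith) (by linarith)
    rw [h5, h4]
    nlinarith
  have h8 : frob (R - blk T i) ^ 2 ≤ 0 := nonpos_of_mul_nonpos_right h6 (by linarith)
  have h9 : R - blk T i = 0 := frob_eq_zero.1 (pow_eq_zero_iff two_ne_zero |>.1
    (le_antisymm h8 (sq_nonneg _)))
  rw [← sub_eq_zero.1 h9]
  exact hR

lemma Sol.lower_of_error (hT : Sol A s w T) (h : Regime n A s a β δ) {i : Fin n}
    {X : Matrix (Fin d) (Fin d) ℝ} {ε : ℝ} (hX : OpB X ε)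
    (e : blk (gram A w * T) i = A * Aᵀ * ((ZStack n d)ᵀ * T) + X) (v : Fin d → ℝ) :
    (3 / 4 * n * s ^ 2 - ε) * vnorm v ≤ vnorm (blk (gram A w * T) i *ᵥ v) := by
  have h1 := h.vnorm_signal isOrth_one (by rw [Matrix.mul_one]; exact hT.near) v
  have h2 := hX.2 v
  have h3 := vnorm_add_le ((blk (gram A w * T) i) *ᵥ v) (-(X *ᵥ v))
  rw [vnorm_neg] at h3
  have e : blk (gram A w * T) i *ᵥ v + -(X *ᵥ v)
      = (A * Aᵀ * ((ZStack n d)ᵀ * T)) *ᵥ v := by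
    rw [e, Matrix.add_mulVec]; abel
  rw [e] at h3
  linarith

lemma Sol.isOrth_or (hT : Sol A s w T) (h : Regime n A s a β δ) (i : Fin n) :
    IsOrth (blk T i) ∨ n * s ^ 2 ≤ 4 * frob (blk (dev A w * T) i) := by
  rw [or_iff_not_imp_right, not_le]
  intro hlt
  exact hT.isOrth_of_lower h i (by linarith) (hT.lower_of_error h (opB_frob _) (blk_gram_mul T i))

/-- The skew part of the difference of two orthogonal matrices near the identity dominates. -/
lemma ip_sub_le_of_isOrth {X Q R : Matrix (Fin d) (Fin d) ℝ} (hX : Xᵀ = X) (hQ : IsOrth Q)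
    (hR : IsOrth R) :
    ip X (Q - R) ≤ frob X * ((frob (Q - 1) + frob (R - 1)) * frob (Q - R)) := by
  have e : (Q - R) + (Q - R)ᵀ = -((Q - 1)ᵀ * (Q - R) + (Q - R)ᵀ * (R - 1)) := by
    have h1 := hQ.1
    have h2 := hR.1
    simp only [Matrix.transpose_sub, Matrix.sub_mul, Matrix.mul_sub, Matrix.transpose_one,
      Matrix.one_mul, Matrix.mul_one, h1, h2]
    abel
  have h1 : ip X (Q - R)ᵀ = ip X (Q - R) := by
    rw [← ip_transpose, hX, Matrix.transpose_transpose]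
  have h2 : 2 * ip X (Q - R) = ip X ((Q - R) + (Q - R)ᵀ) := by rw [ip_add_right, h1]; ring
  have h3 := ip_le X ((Q - R) + (Q - R)ᵀ)
  have h4 : frob ((Q - R) + (Q - R)ᵀ) ≤ (frob (Q - 1) + frob (R - 1)) * frob (Q - R) := by
    rw [e, frob_neg]
    refine (frob_add_le _ _).trans ?_
    have a1 := (opB_frob (Q - 1)).transpose.frob_mul (Q - R)
    have a2 := (opB_frob (R - 1)).frob_mul_right (Q - R)ᵀ
    rw [frob_transpose] at a2
    linarith
  have h5 := mul_le_mul_of_nonneg_left h4 (frob_nonneg X)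
  have h6 : 0 ≤ frob X * ((frob (Q - 1) + frob (R - 1)) * frob (Q - R)) :=
    mul_nonneg (frob_nonneg _) (mul_nonneg (add_nonneg (frob_nonneg _) (frob_nonneg _))
      (frob_nonneg _))
  linarith

lemma frob_sq_ZStack_transpose_mul_sub_le
    (hT : ((ZStack n d)ᵀ * T)ᵀ = (ZStack n d)ᵀ * T)
    (hT' : ((ZStack n d)ᵀ * T')ᵀ = (ZStack n d)ᵀ * T') {g : Fin n → ℝ} (hg : ∀ i, 0 ≤ g i)
    (h : ∀ i, (IsOrth (blk T i) ∧ IsOrth (blk T' i)) ∨ 1 ≤ g i) :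
    frob ((ZStack n d)ᵀ * (T - T')) ^ 2 ≤
      (∑ i, (frob (blk (T - ZStack n d) i) + frob (blk (T' - ZStack n d) i) + g i) ^ 2)
        * frob (T - T') ^ 2 := by
  set X := (ZStack n d)ᵀ * (T - T') with hX
  have hXs : Xᵀ = X := by rw [hX, Matrix.mul_sub, Matrix.transpose_sub, hT, hT']
  set f : Fin n → ℝ := fun i => frob (blk (T - ZStack n d) i) + frob (blk (T' - ZStack n d) i) + g i
    with hf
  have hi : ∀ i, ip X (blk (T - T') i) ≤ frob X * (f i * frob (blk (T - T') i)) := by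
    intro i
    have n1 := frob_nonneg (blk (T - ZStack n d) i)
    have n2 := frob_nonneg (blk (T' - ZStack n d) i)
    rcases h i with ⟨h1, h2⟩ | h1
    · refine (ip_sub_le_of_isOrth hXs h1 h2).trans ?_
      refine mul_le_mul_of_nonneg_left ?_ (frob_nonneg _)
      refine mul_le_mul_of_nonneg_right ?_ (frob_nonneg _)
      simp only [hf, blk_sub, blk_ZStack]
      linarith [hg i]
    · refine (ip_le _ _).trans ?_
      refine mul_le_mul_of_nonneg_left ?_ (frob_nonneg _)
      refine le_mul_of_one_le_left (frob_nonneg _) ?_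
      simp only [hf]; linarith
  have h1 : frob X ^ 2 ≤ frob X * ∑ i, f i * frob (blk (T - T') i) := by
    have e : ∀ Y, ip Y X = ∑ i, ip Y (blk (T - T') i) := fun Y => by
      rw [hX, ← ip_mul_left, ip_blk]
      simp only [blk_ZStack_mul]
    rw [frob_sq, e, Finset.mul_sum]
    exact Finset.sum_le_sum fun i _ => hi i
  have h2 : frob X ≤ ∑ i, f i * frob (blk (T - T') i) := by
    rcases eq_or_lt_of_le (frob_nonneg X) with h0 | h0
    · rw [← h0]
      refine Finset.sum_nonneg fun i _ => mul_nonneg ?_ (frob_nonneg _)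
      have n1 := frob_nonneg (blk (T - ZStack n d) i)
      have n2 := frob_nonneg (blk (T' - ZStack n d) i)
      have := hg i
      simp only [hf]; positivity
    · refine le_of_mul_le_mul_left ?_ h0
      linarith
  have h3 := pow_le_pow_left₀ (frob_nonneg _) h2 2
  rw [frob_sq_blk (T - T')]
  exact h3.trans (Finset.sum_mul_sq_le_sq_mul_sq _ _ _)

lemma Regime.frob_dat_transpose_mul_le (h : Regime n A s a β δ) (hw : OpB w β)
    {E : Matrix (Fin n × Fin d) (Fin d) ℝ}
    (hE : frob ((ZStack n d)ᵀ * E) ^ 2 ≤ 1440 * δ ^ 2 * n * frob E ^ 2) :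
    frob ((dat A w)ᵀ * E) ^ 2 ≤ n * s ^ 2 / 8 * frob E ^ 2 := by
  have e : (dat A w)ᵀ * E = Aᵀ * ((ZStack n d)ᵀ * E) + wᵀ * E := by
    rw [dat, Matrix.transpose_add, Matrix.transpose_mul, Matrix.add_mul, Matrix.mul_assoc]
  have h1 := h.opB_A.transpose.frob_mul ((ZStack n d)ᵀ * E)
  have h2 := hw.transpose.frob_mul E
  have h3 := frob_add_le (Aᵀ * ((ZStack n d)ᵀ * E)) (wᵀ * E)
  rw [← e] at h3
  have h4 := pow_le_pow_left₀ (frob_nonneg _) (h3.trans (add_le_add h1 h2)) 2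
  have h5 : a ^ 2 * frob ((ZStack n d)ᵀ * E) ^ 2 ≤ a ^ 2 * (1440 * δ ^ 2 * n * frob E ^ 2) :=
    mul_le_mul_of_nonneg_left hE (sq_nonneg _)
  have h6 : (a * δ) ^ 2 ≤ (s / 200) ^ 2 :=
    pow_le_pow_left₀ (mul_nonneg h.a_pos.le h.δ_pos.le) h.aδ_le 2
  have h7 : β ^ 2 ≤ (δ * s * Real.sqrt n) ^ 2 := pow_le_pow_left₀ h.β_nonneg h.β_le 2
  rw [mul_pow, h.sq_sqrt] at h7
  have h8 : δ ^ 2 ≤ (1 / 200) ^ 2 := pow_le_pow_left₀ h.δ_pos.le h.δ_le 2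
  have hq : 0 ≤ n * frob E ^ 2 := by positivity
  have h9 := mul_le_mul_of_nonneg_right h6 hq
  have h10 := mul_le_mul_of_nonneg_right h7 (sq_nonneg (frob E))
  have hq' : 0 ≤ s ^ 2 * (n * frob E ^ 2) := by positivity
  have h11 := mul_le_mul_of_nonneg_right h8 hq'
  nlinarith [sq_nonneg (a * frob ((ZStack n d)ᵀ * E) - β * frob E)]

/-- Two solutions, possibly for different noise, are compared through the gradient discrepancy. -/
lemma Sol.frob_sub_le (hT : Sol A s w T) (hT' : Sol A s w' T') (h : Regime n A s a β δ)
    (hw : OpB w β) (hw' : OpB w' β) :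
    n * s ^ 2 * frob (T - T') ≤ 4 * frob ((gram A w - gram A w') * T') := by
  have hn0 : (0 : ℝ) < n := by exact_mod_cast h.hn
  have hns : 0 < n * s ^ 2 := mul_pos hn0 (pow_pos h.s_pos 2)
  set g : Fin n → ℝ := fun i => 4 / (n * s ^ 2) * frob (blk (dev A w * T) i)
  set g' : Fin n → ℝ := fun i => 4 / (n * s ^ 2) * frob (blk (dev A w' * T') i)
  have hg : ∀ i, 0 ≤ g i := fun i => mul_nonneg (by positivity) (frob_nonneg _)
  have hg' : ∀ i, 0 ≤ g' i := fun i => mul_nonneg (by positivity) (frob_nonneg _)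
  have key := frob_sq_ZStack_transpose_mul_sub_le hT.symm hT'.symm (g := fun i => g i + g' i)
    (fun i => add_nonneg (hg i) (hg' i)) (fun i => by
      rcases hT.isOrth_or h i with h1 | h1
      · rcases hT'.isOrth_or h i with h2 | h2
        · exact Or.inl ⟨h1, h2⟩
        · have : 1 ≤ g' i := by
            simp only [g']; rw [div_mul_eq_mul_div, le_div_iff₀ hns]; linarith
          exact Or.inr (by linarith [hg i])
      · have : 1 ≤ g i := by
          simp only [g]; rw [div_mul_eq_mul_div, le_div_iff₀ hns]; linarith
        exact Or.inr (by linarith [hg' i]))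
  have hgs : ∀ {w : Matrix (Fin n × Fin d) (Fin m) ℝ} {T : Matrix (Fin n × Fin d) (Fin d) ℝ},
      Sol A s w T → OpB w β →
      ∑ i, (4 / (n * s ^ 2) * frob (blk (dev A w * T) i)) ^ 2 ≤ 144 * δ ^ 2 * n := by
    intro w T hT hw
    simp only [mul_pow]
    rw [← Finset.mul_sum, ← frob_sq_blk]
    have := pow_le_pow_left₀ (frob_nonneg _) (h.frob_dev_mul_le hw hT.ball) 2
    refine (mul_le_mul_of_nonneg_left this (by positivity)).trans (le_of_eq ?_)
    have := h.s_pos.ne'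
    rw [mul_pow _ (Real.sqrt n), h.sq_sqrt]
    field_simp
    ring
  have hFs : ∀ {w : Matrix (Fin n × Fin d) (Fin m) ℝ} {T : Matrix (Fin n × Fin d) (Fin d) ℝ},
      Sol A s w T → OpB w β →
      ∑ i, frob (blk (T - ZStack n d) i) ^ 2 ≤ 36 * δ ^ 2 * n := by
    intro w T hT hw
    rw [← frob_sq_blk]
    have := pow_le_pow_left₀ (frob_nonneg _) (hT.near' h hw) 2
    rw [mul_pow, h.sq_sqrt] at this
    linarith
  have hsum : ∑ i, (frob (blk (T - ZStack n d) i) + frob (blk (T' - ZStack n d) i)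
      + (g i + g' i)) ^ 2 ≤ 1440 * δ ^ 2 * n := by
    have : ∀ i ∈ Finset.univ, (frob (blk (T - ZStack n d) i) + frob (blk (T' - ZStack n d) i)
      + (g i + g' i)) ^ 2 ≤ 4 * (frob (blk (T - ZStack n d) i) ^ 2
        + frob (blk (T' - ZStack n d) i) ^ 2 + g i ^ 2 + g' i ^ 2) := by
      intro i _
      generalize frob (blk (T - ZStack n d) i) = x
      generalize frob (blk (T' - ZStack n d) i) = y
      nlinarith [sq_nonneg (x - y), sq_nonneg (x - g i), sq_nonneg (x - g' i),
        sq_nonneg (y - g i), sq_nonneg (y - g' i), sq_nonneg (g i - g' i)]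
    refine (Finset.sum_le_sum this).trans ?_
    rw [← Finset.mul_sum, Finset.sum_add_distrib, Finset.sum_add_distrib, Finset.sum_add_distrib]
    have a1 := hgs hT hw
    have a2 := hgs hT' hw'
    have a3 := hFs hT hw
    have a4 := hFs hT' hw'
    simp only [g, g']
    linarith
  have hD := h.frob_dat_transpose_mul_le hw
    (key.trans (mul_le_mul_of_nonneg_right hsum (sq_nonneg _)))
  have v1 := hT.vi T' hT'.ball
  have v2 := hT'.vi T hT.ball
  have e1 : ip (gram A w * (T - T')) (T - T') = frob ((dat A w)ᵀ * (T - T')) ^ 2 :=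
    ip_gram_mul_self A w _
  have e2 := frob_sq (T - T')
  have e3 := ip_le ((gram A w - gram A w') * T') (T - T')
  rcases eq_or_lt_of_le (frob_nonneg (T - T')) with h0 | h0
  · rw [← h0, mul_zero]; have := frob_nonneg ((gram A w - gram A w') * T'); positivity
  refine le_of_mul_le_mul_right ?_ h0
  have e4 : ip (gram A w * T - (n * s ^ 2 / 2) • T) (T' - T)
      + ip (gram A w' * T' - (n * s ^ 2 / 2) • T') (T - T')
      = n * s ^ 2 / 2 * ip (T - T') (T - T') - ip (gram A w * (T - T')) (T - T')
        - ip ((gram A w - gram A w') * T') (T - T') := by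
    simp only [Matrix.mul_sub, Matrix.sub_mul, ip_sub_left, ip_sub_right, ip_smul_left]
    ring
  nlinarith

end Comparison

section Decoupling

variable {n d m : ℕ} {A : Matrix (Fin d) (Fin m) ℝ} {s a β δ : ℝ}
  {w : Matrix (Fin n × Fin d) (Fin m) ℝ} {T T' : Matrix (Fin n × Fin d) (Fin d) ℝ}

/-- The inclusion of the i-th block. -/
def blkIncl (n d : ℕ) (i : Fin n) : Matrix (Fin n × Fin d) (Fin d) ℝ :=
  Matrix.of fun p b => if p = (i, b) then 1 else 0

lemma blkIncl_transpose_mul {k : ℕ} (S : Matrix (Fin n × Fin d) (Fin k) ℝ) (i : Fin n) :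
    (blkIncl n d i)ᵀ * S = blk S i := by
  ext x y
  simp [Matrix.mul_apply, blkIncl, blk]

lemma blkIncl_transpose_mul_self (i : Fin n) : (blkIncl n d i)ᵀ * blkIncl n d i = 1 := by
  rw [blkIncl_transpose_mul]
  ext x y
  simp [blk, blkIncl, Matrix.one_apply]

lemma opB_blkIncl (i : Fin n) : OpB (blkIncl n d i) 1 :=
  ⟨zero_le_one, fun v => by
    rw [vnorm_mulVec_of_transpose_mul (blkIncl_transpose_mul_self i), one_mul]⟩

lemma OpB.blk {k : ℕ} {S : Matrix (Fin n × Fin d) (Fin k) ℝ} {b : ℝ} (h : OpB S b) (i : Fin n) :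
    OpB (blk S i) b := by
  rw [← blkIncl_transpose_mul]
  simpa using (opB_blkIncl i).transpose.mul h

lemma eq_mask_add (w : Matrix (Fin n × Fin d) (Fin m) ℝ) (i : Fin n) :
    w = mask w i + blkIncl n d i * blk w i := by
  ext ⟨j, x⟩ y
  by_cases h : j = i
  · subst h
    simp [mask, Matrix.mul_apply, blkIncl, blk]
  · simp [mask, Matrix.mul_apply, blkIncl, blk, h]

lemma OpB.mask (h : OpB w β) (i : Fin n) : OpB (mask w i) β := by
  refine ⟨h.1, fun v => le_trans ?_ (h.2 v)⟩
  refine Real.sqrt_le_sqrt (Finset.sum_le_sum fun p _ => ?_)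
  by_cases hp : p.1 = i
  · have : (GOPP.mask w i *ᵥ v) p = 0 := by simp [Matrix.mulVec, dotProduct, GOPP.mask, hp]
    rw [this, zero_pow two_ne_zero]; exact sq_nonneg _
  · have : (GOPP.mask w i *ᵥ v) p = (w *ᵥ v) p := by
      simp [Matrix.mulVec, dotProduct, GOPP.mask, hp]
    rw [this]

lemma gram_add_sub (w F : Matrix (Fin n × Fin d) (Fin m) ℝ) :
    gram A (w + F) - gram A w = F * (dat A w)ᵀ + dat A w * Fᵀ + F * Fᵀ := by
  have : dat A (w + F) = dat A w + F := by simp only [dat]; abel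
  rw [gram, gram, this, Matrix.transpose_add, Matrix.add_mul, Matrix.mul_add, Matrix.mul_add]
  abel

/-- Leave-one-out: if row block i is nearly uncorrelated with the solution for the masked noise,
the gradient at block i is well conditioned. -/
lemma Sol.lower_of_mask (hT : Sol A s w T) (h : Regime n A s a β δ) (hw : OpB w β) {i : Fin n}
    (hT' : Sol A s (mask w i) T')
    (hc : frob (blk w i * ((dat A (mask w i))ᵀ * T')) ≤ n * s ^ 2 / 100) (v : Fin d → ℝ) :
    5 / 8 * n * s ^ 2 * vnorm v ≤ vnorm (blk (gram A w * T) i *ᵥ v) := by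
  have hw' := hw.mask i
  have hwi := hw.blk i
  obtain ⟨F, hF⟩ : ∃ F, F = blkIncl n d i * blk w i := ⟨_, rfl⟩
  have hn0 : (0 : ℝ) < n := by exact_mod_cast h.hn
  have hns : 0 < n * s ^ 2 := mul_pos hn0 (pow_pos h.s_pos 2)
  have hr1 := h.sqrt_pos
  have hr2 := h.sq_sqrt
  have ha := h.a_pos
  have hβ := h.β_nonneg
  have hba := h.β_le_a
  have hδ := h.δ_pos
  have hδ' := h.δ_le
  have hnoise := h.noise_le
  have hsd := h.one_le_sqrt_d
  set r := Real.sqrt n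
  have hF1 : OpB F β := by rw [hF]; simpa using (opB_blkIncl i).mul hwi
  have hD' : OpB (dat A (mask w i)) (2 * (r * a)) := (h.opB_dat hw').mono (by linarith)
  have hD : OpB (dat A w) (2 * (r * a)) := (h.opB_dat hw).mono (by linarith)
  have hTi : frob (blk T' i) ≤ Real.sqrt d :=
    Real.le_sqrt_of_sq_le (hT'.ball i).frob_sq_le
  have hFT : Fᵀ * T' = (blk w i)ᵀ * blk T' i := by
    rw [hF, Matrix.transpose_mul, Matrix.mul_assoc, blkIncl_transpose_mul]
  have b1 : frob (Fᵀ * T') ≤ β * Real.sqrt d := by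
    rw [hFT]
    exact (hwi.transpose.frob_mul _).trans (mul_le_mul_of_nonneg_left hTi hβ)
  have hraβ : r * (a * β * Real.sqrt d) ≤ δ * (n * s ^ 2) := by
    have := mul_le_mul_of_nonneg_left hnoise (zero_le_one.trans hr1)
    linear_combination this + δ * s ^ 2 * hr2
  have hβ2 : β * (β * Real.sqrt d) ≤ δ * (n * s ^ 2) := by
    refine le_trans ?_ hraβ
    have : β * (β * Real.sqrt d) ≤ r * a * (β * Real.sqrt d) :=
      mul_le_mul_of_nonneg_right hba (mul_nonneg hβ (Real.sqrt_nonneg _))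
    linarith
  have hE : frob (T - T') ≤ 1 / 10 := by
    have h1 := hT.frob_sub_le hT' h hw hw'
    have e : gram A w - gram A (mask w i)
        = F * (dat A (mask w i))ᵀ + dat A (mask w i) * Fᵀ + F * Fᵀ := by
      rw [← gram_add_sub, hF, ← eq_mask_add]
    rw [e] at h1
    simp only [Matrix.add_mul, Matrix.mul_assoc] at h1
    have t1 : frob (F * ((dat A (mask w i))ᵀ * T')) ≤ n * s ^ 2 / 100 := by
      rw [hF, Matrix.mul_assoc]
      refine ((opB_blkIncl i).frob_mul _).trans ?_
      rwa [one_mul]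
    have t2 : frob (dat A (mask w i) * (Fᵀ * T')) ≤ 2 * (δ * (n * s ^ 2)) := by
      refine (hD'.frob_mul _).trans ?_
      have := mul_le_mul_of_nonneg_left b1 hD'.1
      linarith
    have t3 : frob (F * (Fᵀ * T')) ≤ δ * (n * s ^ 2) :=
      (hF1.frob_mul _).trans ((mul_le_mul_of_nonneg_left b1 hβ).trans hβ2)
    have t4 := frob_add_le (F * ((dat A (mask w i))ᵀ * T') + dat A (mask w i) * (Fᵀ * T'))
      (F * (Fᵀ * T'))
    have t5 := frob_add_le (F * ((dat A (mask w i))ᵀ * T')) (dat A (mask w i) * (Fᵀ * T'))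
    refine le_of_mul_le_mul_left ?_ hns
    have := mul_le_mul_of_nonneg_right hδ' hns.le
    linarith
  have e : blk (gram A w * T) i = A * Aᵀ * ((ZStack n d)ᵀ * T)
      + (A * (wᵀ * T) + blk w i * ((dat A w)ᵀ * T)) := by
    have hb : blk (dat A w) i = A + blk w i := by rw [dat, blk_add, blk_ZStack_mul]
    rw [gram, Matrix.mul_assoc, blk_mul', hb, Matrix.add_mul]
    have : (dat A w)ᵀ * T = Aᵀ * ((ZStack n d)ᵀ * T) + wᵀ * T := by
      rw [dat, Matrix.transpose_add, Matrix.transpose_mul, Matrix.add_mul, Matrix.mul_assoc]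
    rw [Matrix.mul_assoc A Aᵀ]
    nth_rw 1 [this]
    rw [Matrix.mul_add]
    abel
  have x1 : OpB (A * (wᵀ * T)) (a * (β * r)) := h.opB_A.mul (hw.transpose.mul hT.ball.opB)
  have e2 : blk w i * ((dat A w)ᵀ * T) = blk w i * ((dat A (mask w i))ᵀ * T')
      + blk w i * (Fᵀ * T') + blk w i * ((dat A w)ᵀ * (T - T')) := by
    have : dat A w = dat A (mask w i) + F := by
      conv_lhs => rw [eq_mask_add w i, ← hF]
      simp only [dat]; abel
    rw [← Matrix.mul_add, ← Matrix.add_mul, ← Matrix.transpose_add, ← this, ← Matrix.mul_add,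
      ← Matrix.mul_add, add_sub_cancel]
  have y2 : frob (blk w i * (Fᵀ * T')) ≤ δ * (n * s ^ 2) :=
    (hwi.frob_mul _).trans ((mul_le_mul_of_nonneg_left b1 hβ).trans hβ2)
  have hraβ' : r * (a * β) ≤ δ * (n * s ^ 2) := by
    refine le_trans ?_ hraβ
    refine mul_le_mul_of_nonneg_left ?_ (zero_le_one.trans hr1)
    exact le_mul_of_one_le_right (mul_nonneg ha.le hβ) hsd
  have y3 : frob (blk w i * ((dat A w)ᵀ * (T - T'))) ≤ δ * (n * s ^ 2) := by
    refine (hwi.frob_mul _).trans ?_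
    have h1 := (hD.transpose.frob_mul (T - T')).trans (mul_le_mul_of_nonneg_left hE hD.1)
    have h2 := mul_le_mul_of_nonneg_left h1 hβ
    nlinarith
  have y : frob (blk w i * ((dat A w)ᵀ * T)) ≤ n * s ^ 2 / 100 + 2 * (δ * (n * s ^ 2)) := by
    rw [e2]
    refine (frob_add_le _ _).trans ?_
    have := frob_add_le (blk w i * ((dat A (mask w i))ᵀ * T')) (blk w i * (Fᵀ * T'))
    linarith
  have hle : a * (β * r) + (n * s ^ 2 / 100 + 2 * (δ * (n * s ^ 2))) ≤ n * s ^ 2 / 8 := by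
    have := mul_le_mul_of_nonneg_right hδ' hns.le
    linarith
  have hX := (x1.add ((opB_frob (blk w i * ((dat A w)ᵀ * T))).mono y)).mono hle
  have := hT.lower_of_error h hX e v
  linarith

end Decoupling

section Certificate

variable {n d : ℕ}

/-- The block diagonal matrix with diagonal blocks `Λ i`. -/
def bdiag (Λ : Fin n → Matrix (Fin d) (Fin d) ℝ) : Matrix (Fin n × Fin d) (Fin n × Fin d) ℝ :=
  Matrix.of fun p q => if p.1 = q.1 then Λ p.1 p.2 q.2 else 0

variable (Λ : Fin n → Matrix (Fin d) (Fin d) ℝ)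

lemma bdiag_mulVec (u : Fin n × Fin d → ℝ) (i : Fin n) (x : Fin d) :
    (bdiag Λ *ᵥ u) (i, x) = (Λ i *ᵥ fun b => u (i, b)) x := by
  simp only [Matrix.mulVec, dotProduct, bdiag, Matrix.of_apply, Fintype.sum_prod_type, ite_mul,
    zero_mul]
  rw [Finset.sum_eq_single i]
  · simp
  · intro j _ hj
    simp [hj.symm]
  · simp

lemma dotProduct_bdiag_mulVec (u : Fin n × Fin d → ℝ) :
    u ⬝ᵥ (bdiag Λ *ᵥ u) = ∑ i, (fun b => u (i, b)) ⬝ᵥ (Λ i *ᵥ fun b => u (i, b)) := by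
  simp only [dotProduct, Fintype.sum_prod_type, bdiag_mulVec]

lemma blk_bdiag_mul {k : ℕ} (S : Matrix (Fin n × Fin d) (Fin k) ℝ) (i : Fin n) :
    blk (bdiag Λ * S) i = Λ i * blk S i := by
  ext x y
  exact bdiag_mulVec Λ (fun p => S p y) i x

lemma trace_bdiag_mul (G : Matrix (Fin n × Fin d) (Fin n × Fin d) ℝ) :
    trace (bdiag Λ * G) = ∑ i, trace (Λ i * dblk G i) := by
  simp only [trace, Fintype.sum_prod_type, Matrix.diag]
  refine Finset.sum_congr rfl fun i _ => Finset.sum_congr rfl fun x _ => ?_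
  exact bdiag_mulVec Λ (fun p => G p (i, x)) i x

lemma bdiag_transpose (h : ∀ i, (Λ i)ᵀ = Λ i) : (bdiag Λ)ᵀ = bdiag Λ := by
  ext ⟨i, x⟩ ⟨j, y⟩
  by_cases hij : i = j
  · subst hij
    simpa [bdiag] using congrFun (congrFun (h i) x) y
  · simp [bdiag, hij, Ne.symm hij]

lemma vnorm_sq_prod (u : Fin n × Fin d → ℝ) :
    vnorm u ^ 2 = ∑ i, vnorm (fun b => u (i, b)) ^ 2 := by
  simp only [vnorm_sq, dotProduct, Fintype.sum_prod_type]

lemma OrthBlocks.transpose_mul_self {S : Matrix (Fin n × Fin d) (Fin d) ℝ} (h : OrthBlocks S) :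
    Sᵀ * S = (n : ℝ) • (1 : Matrix (Fin d) (Fin d) ℝ) := by
  have e : Sᵀ * S = ∑ i, (blk S i)ᵀ * blk S i := by
    ext x y
    simp [Matrix.mul_apply, Matrix.sum_apply, blk, Fintype.sum_prod_type]
  rw [e, Finset.sum_congr rfl fun i _ => (h i).1]
  simp [← Nat.cast_smul_eq_nsmul ℝ]

lemma dblk_mul_transpose (S : Matrix (Fin n × Fin d) (Fin d) ℝ) (Y : Matrix (Fin d) (Fin d) ℝ)
    (i : Fin n) : dblk (S * Y * Sᵀ) i = blk S i * Y * (blk S i)ᵀ := rfl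

lemma OrthBlocks.dblk_eq {S : Matrix (Fin n × Fin d) (Fin d) ℝ} (h : OrthBlocks S) (i : Fin n) :
    dblk (S * Sᵀ) i = 1 := by
  have := dblk_mul_transpose S 1 i
  rwa [Matrix.mul_one, Matrix.mul_one, (h i).2] at this

/-- Dual certificate: an orthogonal block matrix satisfying the first-order condition with
a spectral gap is the unique solution of the semidefinite relaxation. -/
theorem sdp_certificate (hn : 1 ≤ n) {C : Matrix (Fin n × Fin d) (Fin n × Fin d) ℝ} (hC : Cᵀ = C)
    {T : Matrix (Fin n × Fin d) (Fin d) ℝ} (hT : OrthBlocks T)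
    (hH : ∀ i, ((blk T i)ᵀ * blk (C * T) i).PosSemidef) {t t' : ℝ} (htt : t' < t)
    (hlow : ∀ i v, t * vnorm v ≤ vnorm (blk (C * T) i *ᵥ v))
    (hup : ∀ u, Tᵀ *ᵥ u = 0 → u ⬝ᵥ (C *ᵥ u) ≤ t' * vnorm u ^ 2)
    {G : Matrix (Fin n × Fin d) (Fin n × Fin d) ℝ} (hG : G.PosSemidef) (hGd : ∀ i, dblk G i = 1) :
    trace (C * G) ≤ trace (C * (T * Tᵀ)) ∧
      (trace (C * G) = trace (C * (T * Tᵀ)) → G = T * Tᵀ) := by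
  have hn0 : (0 : ℝ) < n := by exact_mod_cast hn
  let Λ : Fin n → Matrix (Fin d) (Fin d) ℝ := fun i => blk (C * T) i * (blk T i)ᵀ
  have hΛ : ∀ i, (Λ i).PosSemidef := fun i => by
    have h1 := (hH i).mul_mul_conjTranspose_same (blk T i)
    rwa [← Matrix.mul_assoc, (hT i).2, Matrix.one_mul,
      Matrix.conjTranspose_eq_transpose_of_trivial] at h1
  have hΛs : ∀ i, (Λ i)ᵀ = Λ i := fun i => (posSemidef_iff_real.1 (hΛ i)).1
  have hΛt : ∀ i v, t * vnorm v ^ 2 ≤ v ⬝ᵥ (Λ i *ᵥ v) := fun i v => by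
    have h1 := posSemidef_sub_smul (hΛ i) (t := t) fun v => by
      have := hlow i ((blk T i)ᵀ *ᵥ v)
      rwa [vnorm_mulVec_of_transpose_mul (hT i).transpose.1, Matrix.mulVec_mulVec] at this
    have h2 := (posSemidef_iff_real.1 h1).2 v
    rw [Matrix.sub_mulVec, dotProduct_sub, Matrix.smul_mulVec, Matrix.one_mulVec,
      dotProduct_smul, smul_eq_mul, ← vnorm_sq] at h2
    linarith
  set K := bdiag Λ - C with hK
  have hKs : Kᵀ = K := by rw [hK, Matrix.transpose_sub, bdiag_transpose Λ hΛs, hC]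
  have hKT : K * T = 0 := by
    rw [hK, Matrix.sub_mul, sub_eq_zero]
    refine ext_blk fun i => ?_
    rw [blk_bdiag_mul, Matrix.mul_assoc, (hT i).1, Matrix.mul_one]
  have hKy : ∀ y, K *ᵥ (T *ᵥ y) = 0 := fun y => by
    rw [Matrix.mulVec_mulVec, hKT, Matrix.zero_mulVec]
  have hquad : ∀ x : Fin n × Fin d → ℝ, (t - t') *
      vnorm (x - T *ᵥ ((n : ℝ)⁻¹ • (Tᵀ *ᵥ x))) ^ 2 ≤ x ⬝ᵥ (K *ᵥ x) := fun x => by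
    set y := (n : ℝ)⁻¹ • (Tᵀ *ᵥ x) with hy
    obtain ⟨u, hu⟩ : ∃ u, u = x - T *ᵥ y := ⟨_, rfl⟩
    have hTu : Tᵀ *ᵥ u = 0 := by
      rw [hu, Matrix.mulVec_sub, Matrix.mulVec_mulVec, hT.transpose_mul_self, Matrix.smul_mulVec,
        Matrix.one_mulVec, hy, smul_smul, mul_inv_cancel₀ hn0.ne', one_smul, sub_self]
    have hx : x = T *ᵥ y + u := by rw [hu]; abel
    have e : x ⬝ᵥ (K *ᵥ x) = u ⬝ᵥ (K *ᵥ u) := by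
      rw [hx, Matrix.mulVec_add, hKy, zero_add, add_dotProduct]
      have : (T *ᵥ y) ⬝ᵥ (K *ᵥ u) = 0 := by
        rw [← transpose_mulVec_dotProduct, hKs, hKy, zero_dotProduct]
      rw [this, zero_add]
    rw [e, ← hu, hK, Matrix.sub_mulVec, dotProduct_sub, dotProduct_bdiag_mulVec]
    have h1 := hup u hTu
    have h2 : t * vnorm u ^ 2 ≤ ∑ i, (fun b => u (i, b)) ⬝ᵥ (Λ i *ᵥ fun b => u (i, b)) := by
      rw [vnorm_sq_prod, Finset.mul_sum]
      exact Finset.sum_le_sum fun i _ => hΛt i _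
    linarith
  have hq0 : ∀ x : Fin n × Fin d → ℝ, 0 ≤ x ⬝ᵥ (K *ᵥ x) := fun x =>
    le_trans (mul_nonneg (by linarith) (sq_nonneg _)) (hquad x)
  have hKTT : trace (K * (T * Tᵀ)) = 0 := by
    rw [← Matrix.mul_assoc, hKT, Matrix.zero_mul, trace_zero]
  have hdiff : trace (K * G) = trace (C * (T * Tᵀ)) - trace (C * G) := by
    have h1 : trace (bdiag Λ * G) = trace (bdiag Λ * (T * Tᵀ)) := by
      rw [trace_bdiag_mul, trace_bdiag_mul]
      simp only [hGd, hT.dblk_eq]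
    have h2 : K * G = bdiag Λ * G - C * G := Matrix.sub_mul _ _ _
    have h3 : K * (T * Tᵀ) = bdiag Λ * (T * Tᵀ) - C * (T * Tᵀ) := Matrix.sub_mul _ _ _
    rw [h3, trace_sub] at hKTT
    rw [h2, trace_sub]
    linarith
  refine ⟨by linarith [ip_nonneg_of_posSemidef hq0 hG], fun heq => ?_⟩
  obtain ⟨k, v, hv⟩ := exists_sum_vecMulVec hG
  have h0 : ∑ i, v i ⬝ᵥ (K *ᵥ v i) = 0 := by
    rw [← trace_mul_sum_vecMulVec, ← hv, hdiff]; linarith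
  have hvi : ∀ i, v i = T *ᵥ ((n : ℝ)⁻¹ • (Tᵀ *ᵥ v i)) := fun i => by
    have h1 := (Finset.sum_eq_zero_iff_of_nonneg fun i _ => hq0 (v i)).1 h0 i (Finset.mem_univ i)
    have h2 := hquad (v i)
    rw [h1] at h2
    have h3 := nonpos_of_mul_nonpos_right h2 (by linarith)
    have h4 := pow_eq_zero_iff two_ne_zero |>.1 (le_antisymm h3 (sq_nonneg _))
    exact sub_eq_zero.1 (vnorm_eq_zero.1 h4)
  set y : Fin k → Fin d → ℝ := fun i => (n : ℝ)⁻¹ • (Tᵀ *ᵥ v i)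
  have hGY : G = T * (∑ i, vecMulVec (y i) (y i)) * Tᵀ := by
    rw [hv, Matrix.mul_sum, Matrix.sum_mul]
    refine Finset.sum_congr rfl fun i _ => ?_
    rw [Matrix.mul_vecMulVec, Matrix.vecMulVec_mul, Matrix.vecMul_transpose, ← hvi]
  have hY : (∑ i, vecMulVec (y i) (y i)) = 1 := by
    let i0 : Fin n := ⟨0, hn⟩
    have h1 := hGd i0
    rw [hGY, dblk_mul_transpose] at h1
    have h2 : (blk T i0)ᵀ * (blk T i0 * (∑ i, vecMulVec (y i) (y i)) * (blk T i0)ᵀ) * blk T i0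
        = ∑ i, vecMulVec (y i) (y i) := by
      rw [Matrix.mul_assoc, Matrix.mul_assoc, (hT i0).1, Matrix.mul_one, ← Matrix.mul_assoc,
        (hT i0).1, Matrix.one_mul]
    rw [← h2, h1, Matrix.mul_one, (hT i0).1]
  rw [hGY, hY, Matrix.mul_one]

lemma posSemidef_mul_transpose (S : Matrix (Fin n × Fin d) (Fin d) ℝ) :
    (S * Sᵀ).PosSemidef := by
  simpa [Matrix.conjTranspose_eq_transpose_of_trivial] using
    Matrix.posSemidef_self_mul_conjTranspose S

lemma OrthBlocks.exists_eq_mul (hn : 1 ≤ n) {S O : Matrix (Fin n × Fin d) (Fin d) ℝ}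
    (hS : OrthBlocks S) (hO : OrthBlocks O) (h : O * Oᵀ = S * Sᵀ) :
    ∃ Q : Matrix (Fin d) (Fin d) ℝ, IsOrth Q ∧ O = S * Q := by
  have hn0 : (n : ℝ) ≠ 0 := by positivity
  have e : O = S * ((n : ℝ)⁻¹ • (Sᵀ * O)) := by
    rw [Matrix.mul_smul, ← Matrix.mul_assoc, ← h, Matrix.mul_assoc, hO.transpose_mul_self,
      Matrix.mul_smul, Matrix.mul_one, smul_smul, inv_mul_cancel₀ hn0, one_smul]
  refine ⟨_, ?_, e⟩
  let i0 : Fin n := ⟨0, hn⟩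
  have h1 : blk O i0 = blk S i0 * ((n : ℝ)⁻¹ • (Sᵀ * O)) := by
    conv_lhs => rw [e]
    rfl
  have h2 : (n : ℝ)⁻¹ • (Sᵀ * O) = (blk S i0)ᵀ * blk O i0 := by
    rw [h1, ← Matrix.mul_assoc, (hS i0).1, Matrix.one_mul]
  rw [h2]
  exact (hS i0).transpose.mul (hO i0)

end Certificate

section Optimality

variable {n d m : ℕ} {A : Matrix (Fin d) (Fin m) ℝ} {s a β δ : ℝ}
  {w : Matrix (Fin n × Fin d) (Fin m) ℝ} {T : Matrix (Fin n × Fin d) (Fin d) ℝ}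

lemma Sol.posSemidef_blk (hT : Sol A s w T) (hO : OrthBlocks T) (i : Fin n) :
    ((blk T i)ᵀ * blk (gram A w * T) i).PosSemidef := by
  refine posSemidef_of_maximal (hO i) fun Q hQ => ?_
  have h2 := ip_blk_le_of_vi hT.ball hT.vi i hQ.opB
  rw [blk_sub, blk_smul, ip_sub_left, ip_smul_left, ip_sub_right, ip_sub_right] at h2
  have h3 := frob_sq (Q - blk T i)
  have h4 := hQ.frob_sq_eq
  have h5 := (hO i).frob_sq_eq
  rw [frob_sq] at h4 h5
  simp only [ip_sub_left, ip_sub_right, ip_comm Q (blk T i)] at h3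
  have h6 : 0 ≤ n * s ^ 2 / 2 := by positivity
  have h7 : ip (blk T i) Q - ip (blk T i) (blk T i) ≤ 0 := by
    nlinarith [sq_nonneg (frob (Q - blk T i))]
  nlinarith

lemma Sol.dotProduct_gram_le (hT : Sol A s w T) (h : Regime n A s a β δ) (hw : OpB w β)
    {u : Fin n × Fin d → ℝ} (hu : Tᵀ *ᵥ u = 0) :
    u ⬝ᵥ (gram A w *ᵥ u) ≤ n * s ^ 2 / 8 * vnorm u ^ 2 := by
  have e : (dat A w)ᵀ *ᵥ u = Aᵀ *ᵥ ((ZStack n d - T)ᵀ *ᵥ u) + wᵀ *ᵥ u := by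
    rw [dat, Matrix.transpose_add, Matrix.add_mulVec, Matrix.transpose_mul, ← Matrix.mulVec_mulVec,
      Matrix.transpose_sub, Matrix.sub_mulVec, hu, sub_zero]
  have h1 := h.opB_A.transpose.2 ((ZStack n d - T)ᵀ *ᵥ u)
  have h2 := (opB_frob (ZStack n d - T)).transpose.2 u
  have h3 := hw.transpose.2 u
  have h4 := vnorm_add_le (Aᵀ *ᵥ ((ZStack n d - T)ᵀ *ᵥ u)) (wᵀ *ᵥ u)
  rw [← e] at h4
  have h5 := hT.near' h hw
  rw [frob_sub_comm] at h5
  have hu0 := vnorm_nonneg u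
  have h6 := mul_le_mul_of_nonneg_left (h2.trans (mul_le_mul_of_nonneg_right h5 hu0)) h.a_pos.le
  have h7 := mul_le_mul_of_nonneg_right h.β_le hu0
  have h8 : vnorm ((dat A w)ᵀ *ᵥ u) ≤ 7 / 200 * (s * Real.sqrt n * vnorm u) := by
    have hq : 0 ≤ Real.sqrt n * vnorm u := mul_nonneg (Real.sqrt_nonneg _) hu0
    have h9 := mul_le_mul_of_nonneg_right h.aδ_le hq
    have h10 := mul_le_mul_of_nonneg_right h.δ_le (mul_nonneg h.s_pos.le hq)
    nlinarith
  have h9 := pow_le_pow_left₀ (vnorm_nonneg _) h8 2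
  rw [vnorm_sq_mulVec_transpose, ← gram] at h9
  have h11 : 0 ≤ n * s ^ 2 * vnorm u ^ 2 := by positivity
  have h12 : (s * Real.sqrt n * vnorm u) ^ 2 = n * s ^ 2 * vnorm u ^ 2 := by
    linear_combination s ^ 2 * vnorm u ^ 2 * h.sq_sqrt
  rw [mul_pow, h12] at h9
  linarith

/-- Any `S` with the same Gram matrix as a well-conditioned solution solves both programs. -/
theorem Sol.optimal (hT : Sol A s w T) (h : Regime n A s a β δ) (hw : OpB w β)
    (hlow : ∀ i v, 5 / 8 * n * s ^ 2 * vnorm v ≤ vnorm (blk (gram A w * T) i *ᵥ v))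
    {S : Matrix (Fin n × Fin d) (Fin d) ℝ} (hS : OrthBlocks S) (hST : S * Sᵀ = T * Tᵀ) :
    (∀ O', OrthBlocks O' →
      trace ((gram A w)ᵀ * (O' * O'ᵀ)) ≤ trace ((gram A w)ᵀ * (S * Sᵀ))) ∧
    (∀ O', OrthBlocks O' →
      trace ((gram A w)ᵀ * (O' * O'ᵀ)) = trace ((gram A w)ᵀ * (S * Sᵀ)) →
      ∃ Q : Matrix (Fin d) (Fin d) ℝ, IsOrth Q ∧ O' = S * Q) ∧
    (∀ G : Matrix (Fin n × Fin d) (Fin n × Fin d) ℝ,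
      G.PosSemidef → (∀ i, dblk G i = 1) →
      trace ((gram A w)ᵀ * G) ≤ trace ((gram A w)ᵀ * (S * Sᵀ))) ∧
    (∀ G : Matrix (Fin n × Fin d) (Fin n × Fin d) ℝ,
      G.PosSemidef → (∀ i, dblk G i = 1) →
      trace ((gram A w)ᵀ * G) = trace ((gram A w)ᵀ * (S * Sᵀ)) →
      G = S * Sᵀ) := by
  have hn0 : (0 : ℝ) < n := by exact_mod_cast h.hn
  have hns : 0 < n * s ^ 2 := mul_pos hn0 (pow_pos h.s_pos 2)
  have hO : OrthBlocks T := fun i => hT.isOrth_of_lower h i (by linarith) (hlow i)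
  have key := fun G hG hGd => sdp_certificate h.hn (gram_transpose A w) hO (hT.posSemidef_blk hO)
    (by linarith : n * s ^ 2 / 8 < 5 / 8 * n * s ^ 2) hlow (fun u => hT.dotProduct_gram_le h hw)
    (G := G) hG hGd
  rw [gram_transpose, hST]
  refine ⟨fun O' h' => (key _ (posSemidef_mul_transpose O') h'.dblk_eq).1, fun O' h' he => ?_,
    fun G h1 h2 => (key G h1 h2).1, fun G h1 h2 => (key G h1 h2).2⟩
  have := (key _ (posSemidef_mul_transpose O') h'.dblk_eq).2 he
  exact OrthBlocks.exists_eq_mul h.hn hS h' (this.trans hST.symm)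

end Optimality

section FixedPoint

variable {n d m : ℕ} {A : Matrix (Fin d) (Fin m) ℝ} {s a β δ : ℝ}
  {w : Matrix (Fin n × Fin d) (Fin m) ℝ} {T S : Matrix (Fin n × Fin d) (Fin d) ℝ}

lemma frob_sub_ZStack_le_of_posSemidef {X : Matrix (Fin n × Fin d) (Fin d) ℝ}
    {Q : Matrix (Fin d) (Fin d) ℝ} (hX : ((ZStack n d)ᵀ * X).PosSemidef) (hQ : IsOrth Q) :
    frob (X - ZStack n d) ≤ frob (X - ZStack n d * Q) := by
  refine (pow_le_pow_iff_left₀ (frob_nonneg _) (frob_nonneg _) two_ne_zero).1 ?_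
  have h1 := ip_le_trace hX hQ.opB
  have h2 : ip (ZStack n d) X = trace ((ZStack n d)ᵀ * X) := rfl
  have h3 : ip (ZStack n d * Q) X = ip Q ((ZStack n d)ᵀ * X) := ip_mul_left _ _ _
  have h4 := hQ.ip_mul (ZStack n d) (ZStack n d)
  rw [frob_sq, frob_sq]
  simp only [ip_sub_left, ip_sub_right, ip_comm X]
  rw [h2, h3, h4]
  linarith

/-- A blockwise critical point near the signal orbit is the solution up to rotation. -/
lemma Sol.eq_mul_of_fixed (hT : Sol A s w T) (h : Regime n A s a β δ) (hw : OpB w β)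
    (hO : OrthBlocks T) (hS : OrthBlocks S)
    (hfix : ∀ Y, OrthBlocks Y → ip (gram A w * S) Y ≤ ip (gram A w * S) S)
    (hnear : ∃ Q : Matrix (Fin d) (Fin d) ℝ,
      IsOrth Q ∧ frob (S - ZStack n d * Q) ≤ 9 * δ * Real.sqrt n) :
    S * Sᵀ = T * Tᵀ := by
  have hn0 : (0 : ℝ) < n := by exact_mod_cast h.hn
  have hns : 0 < n * s ^ 2 := mul_pos hn0 (pow_pos h.s_pos 2)
  obtain ⟨Q, hQ, hSQ⟩ := hnear
  obtain ⟨R, hR, hRp⟩ := exists_polar ((ZStack n d)ᵀ * S)ᵀ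
  set S' := S * R with hS'
  have hp : ((ZStack n d)ᵀ * S').PosSemidef := by
    have := (posSemidef_iff_real.1 hRp).1
    rw [Matrix.transpose_mul, Matrix.transpose_transpose, Matrix.transpose_transpose] at this
    rw [hS', ← Matrix.mul_assoc, this]
    exact hRp
  have hS'o : OrthBlocks S' := hS.mul hR
  have hS'n : frob (S' - ZStack n d) ≤ 9 * δ * Real.sqrt n := by
    refine (frob_sub_ZStack_le_of_posSemidef hp (hQ.mul hR)).trans ?_
    rw [hS', ← Matrix.mul_assoc, ← Matrix.sub_mul, hR.frob_mul]
    exact hSQ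
  have hSS : S * Sᵀ = S' * S'ᵀ := by
    rw [hS', Matrix.transpose_mul, Matrix.mul_assoc, ← Matrix.mul_assoc R, hR.2, Matrix.one_mul]
  have v1 := hT.vi S' hS'o.ball
  have v2 : ip (gram A w * S') (T - S') ≤ 0 := by
    have h1 := hfix (T * Rᵀ) (hO.mul hR.transpose)
    have h2 := hR.ip_mul (gram A w * S) (T * Rᵀ)
    have h3 := hR.ip_mul (gram A w * S) S
    rw [Matrix.mul_assoc T, hR.1, Matrix.mul_one] at h2
    rw [ip_sub_right, hS', ← Matrix.mul_assoc, h2, h3]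
    linarith
  have key := frob_sq_ZStack_transpose_mul_sub_le hT.symm (posSemidef_iff_real.1 hp).1
    (g := fun _ => 0) (fun _ => le_rfl) fun i => Or.inl ⟨hO i, hS'o i⟩
  have hsum : ∑ i, (frob (blk (T - ZStack n d) i) + frob (blk (S' - ZStack n d) i) + 0) ^ 2
      ≤ 1440 * δ ^ 2 * n := by
    have : ∀ i ∈ Finset.univ, (frob (blk (T - ZStack n d) i) + frob (blk (S' - ZStack n d) i)
        + 0) ^ 2 ≤ 2 * (frob (blk (T - ZStack n d) i) ^ 2
          + frob (blk (S' - ZStack n d) i) ^ 2) := by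
      intro i _
      nlinarith [sq_nonneg (frob (blk (T - ZStack n d) i) - frob (blk (S' - ZStack n d) i))]
    refine (Finset.sum_le_sum this).trans ?_
    rw [← Finset.mul_sum, Finset.sum_add_distrib, ← frob_sq_blk, ← frob_sq_blk]
    have h1 := pow_le_pow_left₀ (frob_nonneg _) (hT.near' h hw) 2
    have h2 := pow_le_pow_left₀ (frob_nonneg _) hS'n 2
    rw [mul_pow, h.sq_sqrt] at h1 h2
    have : 0 ≤ δ ^ 2 * n := by positivity
    linarith
  have hD := h.frob_dat_transpose_mul_le hw
    (key.trans (mul_le_mul_of_nonneg_right hsum (sq_nonneg _)))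
  have e1 : ip (gram A w * (T - S')) (T - S') = frob ((dat A w)ᵀ * (T - S')) ^ 2 :=
    ip_gram_mul_self A w _
  have e2 := frob_sq (T - S')
  have e3 : ip T T = ip S' S' := by
    rw [← frob_sq, ← frob_sq, hO.frob_sq_eq, hS'o.frob_sq_eq]
  have e4 : ip (gram A w * T - (n * s ^ 2 / 2) • T) (S' - T) + ip (gram A w * S') (T - S')
      = n * s ^ 2 / 4 * ip (T - S') (T - S') - ip (gram A w * (T - S')) (T - S') := by
    simp only [Matrix.mul_sub, ip_sub_left, ip_sub_right, ip_smul_left, ip_comm S' T]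
    linear_combination (n * s ^ 2 / 4) * e3
  have h0 : n * s ^ 2 / 8 * frob (T - S') ^ 2 ≤ 0 := by nlinarith
  have h1 := nonpos_of_mul_nonpos_right h0 (by linarith)
  have h2 := sub_eq_zero.1 (frob_eq_zero.1 (pow_eq_zero_iff two_ne_zero |>.1
    (le_antisymm h1 (sq_nonneg _))))
  rw [hSS, ← h2]

end FixedPoint

section PowerIteration

variable {n d m : ℕ} {A : Matrix (Fin d) (Fin m) ℝ} {s a β δ : ℝ}
  {w : Matrix (Fin n × Fin d) (Fin m) ℝ} {S S' : Matrix (Fin n × Fin d) (Fin d) ℝ}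

lemma IsPolarBlocks.orthBlocks {X : Matrix (Fin n × Fin d) (Fin d) ℝ} (h : IsPolarBlocks X S) :
    OrthBlocks S := fun i => (h i).1

lemma IsPolarBlocks.ip_le {X Y : Matrix (Fin n × Fin d) (Fin d) ℝ} (h : IsPolarBlocks X S)
    (hY : OrthBlocks Y) : ip X Y ≤ ip X S := by
  rw [ip_blk, ip_blk X]
  exact Finset.sum_le_sum fun i _ => (h i).ip_le (hY i)

/-- One power step contracts a neighbourhood of the signal orbit. -/
lemma Regime.near_of_step (h : Regime n A s a β δ) (hw : OpB w β) (hS : OrthBlocks S)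
    (hS' : IsPolarBlocks (gram A w * S) S')
    (hnear : ∃ Q : Matrix (Fin d) (Fin d) ℝ,
      IsOrth Q ∧ frob (S - ZStack n d * Q) ≤ Real.sqrt n / 4) :
    ∃ Q : Matrix (Fin d) (Fin d) ℝ,
      IsOrth Q ∧ frob (S' - ZStack n d * Q) ≤ 8 * δ * Real.sqrt n := by
  have hn0 : (0 : ℝ) < n := by exact_mod_cast h.hn
  have hns : 0 < n * s ^ 2 := mul_pos hn0 (pow_pos h.s_pos 2)
  obtain ⟨Q, hQ, hSQ⟩ := hnear
  set M := A * Aᵀ * ((ZStack n d)ᵀ * S) with hM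
  obtain ⟨R, hR, hRM⟩ := exists_polar M
  refine ⟨R, hR, ?_⟩
  have hS'o := hS'.orthBlocks
  have hlow : ∀ v, 3 / 4 * n * s ^ 2 * vnorm v ≤ vnorm (M *ᵥ v) := h.vnorm_signal hQ hSQ
  have hi : ∀ i, 3 / 8 * n * s ^ 2 * frob (blk (S' - ZStack n d * R) i) ^ 2
      ≤ ip (blk (dev A w * S) i) (blk (S' - ZStack n d * R) i) := fun i => by
    have h1 := polar_gap hR hRM hlow (hS'o i).opB
    have h2 := (hS' i).ip_le hR
    rw [blk_gram_mul, ← hM, ip_add_left, ip_add_left] at h2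
    have h3 := frob_sq (blk S' i - R)
    have h4 := hR.frob_sq_eq
    have h5 := (hS'o i).frob_sq_eq
    rw [frob_sq] at h4 h5
    simp only [ip_sub_left, ip_sub_right, ip_comm (blk S' i) R] at h3
    rw [blk_sub, blk_ZStack_mul, ip_sub_right]
    rw [h3, h4, h5]
    linarith
  have hsum := Finset.sum_le_sum fun i (_ : i ∈ Finset.univ) => hi i
  rw [← Finset.mul_sum, ← frob_sq_blk, ← ip_blk] at hsum
  have h1 := ip_le (dev A w * S) (S' - ZStack n d * R)
  have h2 := h.frob_dev_mul_le hw hS.ball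
  rcases eq_or_lt_of_le (frob_nonneg (S' - ZStack n d * R)) with h0 | h0
  · rw [← h0]; have := h.δ_pos; positivity
  refine le_of_mul_le_mul_left ?_ (mul_pos hns h0)
  have h3 := mul_le_mul_of_nonneg_right h2 h0.le
  linarith

lemma exists_frob_lt_of_dF_lt {ε : ℝ} (h : dF S S' < ε) :
    ∃ Q : Matrix (Fin d) (Fin d) ℝ, IsOrth Q ∧ frob (S - S' * Q) < ε := by
  have hne : {r : ℝ | ∃ Q : Matrix (Fin d) (Fin d) ℝ, IsOrth Q ∧ r = frob (S - S' * Q)}.Nonempty :=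
    ⟨_, 1, isOrth_one, rfl⟩
  obtain ⟨r, ⟨Q, hQ, rfl⟩, hr⟩ := exists_lt_of_csInf_lt hne h
  exact ⟨Q, hQ, hr⟩

lemma gram_posSemidef_conj (S : Matrix (Fin n × Fin d) (Fin d) ℝ) :
    (Sᵀ * (gram A w * S)).PosSemidef := by
  have h := Matrix.posSemidef_conjTranspose_mul_self ((dat A w)ᵀ * S)
  rw [Matrix.conjTranspose_eq_transpose_of_trivial, Matrix.transpose_mul,
    Matrix.transpose_transpose] at h
  rwa [gram, Matrix.mul_assoc (dat A w), ← Matrix.mul_assoc Sᵀ]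

/-- A limit of the power iteration, modulo rotations, is a blockwise fixed point. -/
lemma ip_le_of_tendsto {S : ℕ → Matrix (Fin n × Fin d) (Fin d) ℝ}
    {L Y : Matrix (Fin n × Fin d) (Fin d) ℝ} (hL : OrthBlocks L)
    (hstep : ∀ t, IsPolarBlocks (gram A w * S t) (S (t + 1)))
    (hlim : Tendsto (fun t => dF (S t) L) atTop (nhds 0)) (hY : OrthBlocks Y) :
    ip (gram A w * L) Y ≤ ip (gram A w * L) L := by
  set B := frob (gram A w) * (Real.sqrt n * Real.sqrt d) with hB
  have hB0 : 0 ≤ B := mul_nonneg (frob_nonneg _) (by positivity)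
  have hC := opB_frob (gram A w)
  refine le_of_forall_pos_le_add fun ε hε => ?_
  set η := ε / (3 * (B + 1)) with hη
  have hη0 : 0 < η := by positivity
  have hηB : 3 * (B * η) ≤ ε := by
    rw [hη]
    have : 3 * (B * (ε / (3 * (B + 1)))) = ε * (B / (B + 1)) := by field_simp
    rw [this]
    exact mul_le_of_le_one_right hε.le ((div_le_one (by positivity)).2 (by linarith))
  obtain ⟨t, ht⟩ := (eventually_atTop.1 (hlim.eventually (gt_mem_nhds hη0)))
  obtain ⟨Q, hQ, hE⟩ := exists_frob_lt_of_dF_lt (ht t le_rfl)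
  obtain ⟨Q', hQ', hE'⟩ := exists_frob_lt_of_dF_lt (ht (t + 1) (Nat.le_succ t))
  have h1 := (hstep t).ip_le (hY.mul hQ)
  have hbound : ∀ {E X : Matrix (Fin n × Fin d) (Fin d) ℝ}, frob E < η → BallBlocks X →
      |ip (gram A w * E) X| ≤ B * η := by
    intro E X hE hX
    have a1 : frob (gram A w * E) * frob X ≤ B * η := by
      calc frob (gram A w * E) * frob X
          ≤ (frob (gram A w) * η) * (Real.sqrt n * Real.sqrt d) := by
            refine mul_le_mul ((hC.frob_mul E).trans ?_) hX.frob_le (frob_nonneg _) ?_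
            · exact mul_le_mul_of_nonneg_left hE.le (frob_nonneg _)
            · exact mul_nonneg (frob_nonneg _) hη0.le
        _ = B * η := by rw [hB]; ring
    rw [abs_le]
    refine ⟨?_, (ip_le _ _).trans a1⟩
    have a2 := ip_le (gram A w * E) (-X)
    rw [frob_neg] at a2
    have a3 : ip (gram A w * E) (-X) = - ip (gram A w * E) X := by
      have := ip_smul_right (-1) (gram A w * E) X
      simpa using this
    linarith
  have d1 : ip (gram A w * S t) (Y * Q)
      = ip (gram A w * L) Y + ip (gram A w * (S t - L * Q)) (Y * Q) := by
    rw [Matrix.mul_sub, ip_sub_left, ← Matrix.mul_assoc, hQ.ip_mul]; ring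
  have d2 : ip (gram A w * S t) (S (t + 1)) = ip (gram A w * L) (L * (Q' * Qᵀ))
      + ip (gram A w * (S (t + 1) - L * Q')) (L * Q)
      + ip (gram A w * (S t - L * Q)) (S (t + 1)) := by
    have e1 : ip (gram A w * (S (t + 1) - L * Q')) (L * Q)
        = ip (gram A w * (L * Q)) (S (t + 1) - L * Q') := by
      rw [ip_gram_mul, ip_comm]
    have e2 : ip (gram A w * L) (L * (Q' * Qᵀ)) = ip (gram A w * (L * Q)) (L * Q') := by
      have := hQ.ip_mul (gram A w * L) (L * (Q' * Qᵀ))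
      rw [← this, Matrix.mul_assoc L, Matrix.mul_assoc Q', hQ.1, Matrix.mul_one, Matrix.mul_assoc]
    rw [e1, e2, ip_sub_right, Matrix.mul_sub, ip_sub_left]; ring
  have h2 : ip (gram A w * L) (L * (Q' * Qᵀ)) ≤ ip (gram A w * L) L := by
    have a1 := ip_le_trace (gram_posSemidef_conj (A := A) (w := w) L) (hQ'.mul hQ.transpose).opB
    rw [ip_comm _ (L * _), ip_mul_left, ip_comm _ L]
    rwa [← ip_mul_left, ip_comm (L * _), ip_comm, ip_mul_left] at a1 ⊢
  have b1 := abs_le.1 (hbound hE (hY.mul hQ).ball)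
  have b2 := abs_le.1 (hbound hE' (hL.mul hQ).ball)
  have b3 := abs_le.1 (hbound hE (hstep t).orthBlocks.ball)
  linarith [b1.1, b2.2, b3.2]

lemma Regime.near_of_tendsto (h : Regime n A s a β δ) (hw : OpB w β)
    {S : ℕ → Matrix (Fin n × Fin d) (Fin d) ℝ} {L : Matrix (Fin n × Fin d) (Fin d) ℝ}
    (hS0 : OrthBlocks (S 0))
    (hinit : ∃ Q : Matrix (Fin d) (Fin d) ℝ,
      IsOrth Q ∧ frob (S 0 - ZStack n d * Q) ≤ Real.sqrt n / 4)
    (hstep : ∀ t, IsPolarBlocks (gram A w * S t) (S (t + 1)))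
    (hlim : Tendsto (fun t => dF (S t) L) atTop (nhds 0)) :
    ∃ Q : Matrix (Fin d) (Fin d) ℝ, IsOrth Q ∧ frob (L - ZStack n d * Q) ≤ 9 * δ * Real.sqrt n := by
  have hδ := h.δ_le
  have hr := h.sqrt_pos
  have hor : ∀ t, OrthBlocks (S t) := fun t => by
    cases t with
    | zero => exact hS0
    | succ t => exact (hstep t).orthBlocks
  have hnear : ∀ t, ∃ Q : Matrix (Fin d) (Fin d) ℝ,
      IsOrth Q ∧ frob (S t - ZStack n d * Q) ≤ Real.sqrt n / 4 := fun t => by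
    induction t with
    | zero => exact hinit
    | succ t ih =>
      obtain ⟨Q, hQ, hle⟩ := h.near_of_step hw (hor t) (hstep t) ih
      exact ⟨Q, hQ, hle.trans (by nlinarith)⟩
  obtain ⟨t, ht⟩ := eventually_atTop.1 (hlim.eventually (gt_mem_nhds
    (mul_pos h.δ_pos (zero_lt_one.trans_le hr))))
  obtain ⟨Q, hQ, hE⟩ := exists_frob_lt_of_dF_lt (ht (t + 1) (Nat.le_succ t))
  obtain ⟨R, hR, hle⟩ := h.near_of_step hw (hor t) (hstep t) (hnear t)
  refine ⟨R * Qᵀ, hR.mul hQ.transpose, ?_⟩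
  rw [← hQ.frob_mul, Matrix.sub_mul, Matrix.mul_assoc, Matrix.mul_assoc, hQ.1, Matrix.mul_one]
  have h1 := frob_add_le (L * Q - S (t + 1)) (S (t + 1) - ZStack n d * R)
  rw [sub_add_sub_cancel, frob_sub_comm (L * Q) (S (t + 1))] at h1
  linarith

end PowerIteration

section TopSingVecs

variable {N : Type*} [Fintype N] {d m : ℕ} {D : Matrix N (Fin m) ℝ} {U : Matrix N (Fin d) ℝ}

/-- Replacing one direction of a top singular subspace does not increase the energy. -/
lemma IsTopSingVecs.exchange_unit (h : IsTopSingVecs D U) {x : Fin d → ℝ} (hx : x ⬝ᵥ x = 1)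
    {y : N → ℝ} {α : ℝ} (hy : Uᵀ *ᵥ y = α • x) (hy1 : y ⬝ᵥ y = 1) :
    y ⬝ᵥ ((D * Dᵀ) *ᵥ y) ≤ (U *ᵥ x) ⬝ᵥ ((D * Dᵀ) *ᵥ (U *ᵥ x)) := by
  set C := D * Dᵀ with hC
  set P : Matrix (Fin d) (Fin d) ℝ := 1 - vecMulVec x x with hP
  have hPT : Pᵀ = P := by simp [hP, Matrix.transpose_vecMulVec]
  have hPx : P *ᵥ x = 0 := by
    simp [hP, Matrix.sub_mulVec, Matrix.vecMulVec_mulVec, hx]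
  have hPP : P * P = P := by
    have : P * vecMulVec x x = 0 := by rw [Matrix.mul_vecMulVec, hPx]; simp
    conv_lhs => rw [hP, ← hP, Matrix.mul_sub, this, Matrix.mul_one, sub_zero]
  have hUyP : P * Uᵀ * vecMulVec y x = 0 := by
    rw [Matrix.mul_vecMulVec, ← Matrix.mulVec_mulVec, hy, Matrix.mulVec_smul, hPx]
    simp
  set Q := U * P + vecMulVec y x with hQ
  have hQT : Qᵀ = P * Uᵀ + vecMulVec x y := by
    rw [hQ, Matrix.transpose_add, Matrix.transpose_mul, hPT, Matrix.transpose_vecMulVec]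
  have hQQ : Qᵀ * Q = 1 := by
    have e1 : P * Uᵀ * (U * P) = P := by
      rw [Matrix.mul_assoc, ← Matrix.mul_assoc Uᵀ, h.1, Matrix.one_mul, hPP]
    have e2 : vecMulVec x y * (U * P) = 0 := by
      have := congrArg Matrix.transpose hUyP
      simpa [Matrix.transpose_mul, hPT, Matrix.mul_assoc, Matrix.transpose_vecMulVec] using this
    have e3 : vecMulVec x y * vecMulVec y x = vecMulVec x x := by
      rw [Matrix.vecMulVec_mul_vecMulVec, hy1, one_smul]
    rw [hQT, hQ, Matrix.add_mul, Matrix.mul_add, Matrix.mul_add, e1, e2, e3, hUyP, hP]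
    abel
  have key := h.2 Q hQQ
  have e0 : trace (Qᵀ * C * Q) = trace (Uᵀ * C * U) - x ⬝ᵥ ((Uᵀ * C * U) *ᵥ x)
      + y ⬝ᵥ (C *ᵥ y) := by
    have t1 : trace (P * Uᵀ * C * (U * P)) = trace (Uᵀ * C * U) - x ⬝ᵥ ((Uᵀ * C * U) *ᵥ x) := by
      have : P * Uᵀ * C * (U * P) = P * (Uᵀ * C * U * P) := by simp only [Matrix.mul_assoc]
      rw [this, Matrix.trace_mul_comm, Matrix.mul_assoc, hPP, hP, Matrix.mul_sub, Matrix.mul_one,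
        Matrix.trace_sub, trace_mul_vecMulVec]
    have t2 : trace (P * Uᵀ * C * vecMulVec y x) = 0 := by
      rw [Matrix.mul_vecMulVec, Matrix.trace_vecMulVec, ← Matrix.mulVec_mulVec,
        ← Matrix.mulVec_mulVec, dotProduct_comm, ← transpose_mulVec_dotProduct, hPT, hPx,
        zero_dotProduct]
    have t3 : trace (vecMulVec x y * C * (U * P)) = 0 := by
      rw [Matrix.vecMulVec_mul, Matrix.vecMulVec_mul, Matrix.trace_vecMulVec,
        ← Matrix.vecMul_vecMul, dotProduct_comm, ← Matrix.dotProduct_mulVec, hPx, dotProduct_zero]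
    have t4 : trace (vecMulVec x y * C * vecMulVec y x) = y ⬝ᵥ (C *ᵥ y) := by
      rw [Matrix.mul_vecMulVec, Matrix.trace_vecMulVec, ← Matrix.mulVec_mulVec,
        Matrix.vecMulVec_mulVec]
      simp [dotProduct_comm, hx]
    rw [hQT, hQ, Matrix.mul_add, Matrix.add_mul, Matrix.add_mul, Matrix.add_mul, Matrix.trace_add,
      Matrix.trace_add, Matrix.trace_add, t1, t2, t3, t4]
    ring
  have e1 : x ⬝ᵥ ((Uᵀ * C * U) *ᵥ x) = (U *ᵥ x) ⬝ᵥ (C *ᵥ (U *ᵥ x)) := by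
    rw [← Matrix.mulVec_mulVec, ← Matrix.mulVec_mulVec, ← transpose_mulVec_dotProduct,
      Matrix.transpose_transpose]
  rw [e0, e1] at key
  linarith

lemma IsTopSingVecs.exchange (h : IsTopSingVecs D U) {x : Fin d → ℝ} (hx : x ⬝ᵥ x = 1)
    {y : N → ℝ} {α : ℝ} (hy : Uᵀ *ᵥ y = α • x) :
    y ⬝ᵥ ((D * Dᵀ) *ᵥ y) ≤ (y ⬝ᵥ y) * ((U *ᵥ x) ⬝ᵥ ((D * Dᵀ) *ᵥ (U *ᵥ x))) := by
  by_cases hy0 : y = 0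
  · simp [hy0]
  have hpos : 0 < vnorm y := lt_of_le_of_ne (vnorm_nonneg _) fun h => hy0 (vnorm_eq_zero.1 h.symm)
  have h1 := h.exchange_unit hx (y := (vnorm y)⁻¹ • y) (α := (vnorm y)⁻¹ * α)
    (by rw [Matrix.mulVec_smul, hy, smul_smul])
    (by rw [smul_dotProduct, dotProduct_smul, ← vnorm_sq, smul_eq_mul, smul_eq_mul]; field_simp)
  rw [Matrix.mulVec_smul, smul_dotProduct, dotProduct_smul, smul_eq_mul, smul_eq_mul] at h1
  rw [← vnorm_sq]
  have h2 := mul_le_mul_of_nonneg_left h1 (sq_nonneg (vnorm y))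
  refine le_trans (le_of_eq ?_) h2
  field_simp

lemma IsTopSingVecs.dotProduct_eq_zero (h : IsTopSingVecs D U) {v : N → ℝ} (hv : Uᵀ *ᵥ v = 0)
    (x : Fin d → ℝ) : v ⬝ᵥ ((D * Dᵀ) *ᵥ (U *ᵥ x)) = 0 := by
  set C := D * Dᵀ with hC
  have hCT : Cᵀ = C := by rw [hC, Matrix.transpose_mul, Matrix.transpose_transpose]
  have hunit : ∀ x : Fin d → ℝ, x ⬝ᵥ x = 1 → v ⬝ᵥ (C *ᵥ (U *ᵥ x)) = 0 := fun x hx => by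
    have hux : Uᵀ *ᵥ (U *ᵥ x) = x := by rw [Matrix.mulVec_mulVec, h.1, Matrix.one_mulVec]
    have hvu : v ⬝ᵥ (U *ᵥ x) = 0 := by
      rw [← transpose_mulVec_dotProduct, hv, zero_dotProduct]
    have huu : (U *ᵥ x) ⬝ᵥ (U *ᵥ x) = 1 := by rw [← transpose_mulVec_dotProduct, hux, hx]
    have hs : (U *ᵥ x) ⬝ᵥ (C *ᵥ v) = v ⬝ᵥ (C *ᵥ (U *ᵥ x)) := by
      rw [← transpose_mulVec_dotProduct, hCT, dotProduct_comm]
    have key : ∀ t : ℝ, 2 * t * (v ⬝ᵥ (C *ᵥ (U *ᵥ x))) + t ^ 2 * (v ⬝ᵥ (C *ᵥ v))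
        ≤ t ^ 2 * ((v ⬝ᵥ v) * ((U *ᵥ x) ⬝ᵥ (C *ᵥ (U *ᵥ x)))) := fun t => by
      have h1 := h.exchange hx (y := U *ᵥ x + t • v) (α := 1) (by
        rw [Matrix.mulVec_add, hux, Matrix.mulVec_smul, hv]; simp)
      simp only [Matrix.mulVec_add, Matrix.mulVec_smul, add_dotProduct, dotProduct_add,
        smul_dotProduct, dotProduct_smul, smul_eq_mul, huu, hvu, dotProduct_comm (U *ᵥ x) v,
        ← hC, hs] at h1
      linarith
    set p := v ⬝ᵥ (C *ᵥ (U *ᵥ x))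
    set q := (v ⬝ᵥ v) * ((U *ᵥ x) ⬝ᵥ (C *ᵥ (U *ᵥ x))) - v ⬝ᵥ (C *ᵥ v)
    have key' : ∀ t : ℝ, 2 * t * p ≤ t ^ 2 * q := fun t => by
      have := key t
      simp only [q]; linarith
    have hq : 0 ≤ q := by
      have a1 := key' 1
      have a2 := key' (-1)
      linarith
    have h1 := key' (p / (q + 1))
    have h2 : p ^ 2 ≤ 0 := by
      have hq1 : 0 < q + 1 := by linarith
      have e1 : 2 * (p / (q + 1)) * p = 2 * p ^ 2 / (q + 1) := by ring
      have e2 : (p / (q + 1)) ^ 2 * q = p ^ 2 * q / (q + 1) / (q + 1) := by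
        field_simp
      rw [e1, e2, div_le_div_iff_of_pos_right hq1, le_div_iff₀ hq1] at h1
      nlinarith [sq_nonneg p]
    exact pow_eq_zero_iff two_ne_zero |>.1 (le_antisymm h2 (sq_nonneg _))
  by_cases hx0 : x = 0
  · simp [hx0]
  have hpos : 0 < vnorm x := lt_of_le_of_ne (vnorm_nonneg _) fun h => hx0 (vnorm_eq_zero.1 h.symm)
  have h1 := hunit ((vnorm x)⁻¹ • x)
    (by rw [smul_dotProduct, dotProduct_smul, ← vnorm_sq, smul_eq_mul, smul_eq_mul]; field_simp)
  rw [Matrix.mulVec_smul, Matrix.mulVec_smul, dotProduct_smul, smul_eq_mul] at h1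
  exact (mul_eq_zero.1 h1).resolve_left (inv_ne_zero hpos.ne')

lemma IsTopSingVecs.gram_mul (h : IsTopSingVecs D U) :
    D * Dᵀ * U = U * (Uᵀ * (D * Dᵀ) * U) := by
  have key : ∀ x, (D * Dᵀ * U) *ᵥ x = (U * (Uᵀ * (D * Dᵀ) * U)) *ᵥ x := fun x => by
    obtain ⟨z, hz⟩ : ∃ z, z = (D * Dᵀ) *ᵥ (U *ᵥ x) := ⟨_, rfl⟩
    obtain ⟨v, hv⟩ : ∃ v, v = z - U *ᵥ (Uᵀ *ᵥ z) := ⟨_, rfl⟩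
    have hUv : Uᵀ *ᵥ v = 0 := by
      rw [hv, Matrix.mulVec_sub, Matrix.mulVec_mulVec _ Uᵀ U, h.1, Matrix.one_mulVec, sub_self]
    have h1 := h.dotProduct_eq_zero hUv x
    rw [← hz] at h1
    have h2 : v ⬝ᵥ v = 0 := by
      nth_rw 2 [hv]
      rw [dotProduct_sub, h1, ← transpose_mulVec_dotProduct, hUv, zero_dotProduct, sub_zero]
    have h3 : z = U *ᵥ (Uᵀ *ᵥ z) := sub_eq_zero.1 (hv.symm.trans (dotProduct_self_eq_zero.1 h2))
    rw [← Matrix.mulVec_mulVec, ← hz, h3, hz]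
    simp only [Matrix.mulVec_mulVec, Matrix.mul_assoc]
  exact Matrix.ext_of_mulVec_single fun i => key _

end TopSingVecs

section SpectralInit

variable {n d m : ℕ} {A : Matrix (Fin d) (Fin m) ℝ} {s a β δ : ℝ}
  {w : Matrix (Fin n × Fin d) (Fin m) ℝ} {U S : Matrix (Fin n × Fin d) (Fin d) ℝ}

lemma Regime.le_dat_transpose_ZStack (h : Regime n A s a β δ) (hw : OpB w β) (y : Fin d → ℝ) :
    (Real.sqrt n * s - β) * vnorm (ZStack n d *ᵥ y) ≤ vnorm ((dat A w)ᵀ *ᵥ (ZStack n d *ᵥ y)) := by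
  have e : (n : ℝ) • (Aᵀ *ᵥ y)
      = (dat A w)ᵀ *ᵥ (ZStack n d *ᵥ y) + -(wᵀ *ᵥ (ZStack n d *ᵥ y)) := by
    rw [dat, Matrix.transpose_add, Matrix.add_mulVec, add_neg_cancel_right, Matrix.mulVec_mulVec,
      Matrix.transpose_mul, Matrix.mul_assoc, ZStack_transpose_mul_self, Matrix.mul_smul,
      Matrix.mul_one, Matrix.smul_mulVec]
  have h1 := congrArg vnorm e
  have h2 := vnorm_add_le ((dat A w)ᵀ *ᵥ (ZStack n d *ᵥ y)) (-(wᵀ *ᵥ (ZStack n d *ᵥ y)))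
  rw [← h1, vnorm_smul, vnorm_neg, abs_of_nonneg (Nat.cast_nonneg n)] at h2
  have h3 := hw.transpose.2 (ZStack n d *ᵥ y)
  have h4 := mul_le_mul_of_nonneg_left (h.le_A y) (Nat.cast_nonneg (α := ℝ) n)
  have h5 := vnorm_ZStack_mulVec (n := n) y
  have h6 := h.sq_sqrt
  have h7 : Real.sqrt n * s * vnorm (ZStack n d *ᵥ y) = n * (s * vnorm y) := by
    rw [h5]; linear_combination s * vnorm y * h6
  linarith

lemma Regime.half_le (h : Regime n A s a β δ) : Real.sqrt n * s / 2 ≤ Real.sqrt n * s - β := by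
  have h1 := h.β_le
  have h2 := h.δ_le
  have h3 := h.sqrt_pos
  have h4 := h.s_pos
  nlinarith [mul_pos h4 (zero_lt_one.trans_le h3)]

lemma Regime.energy_lower (h : Regime n A s a β δ) (hw : OpB w β)
    (hU : IsTopSingVecs (dat A w) U) (x : Fin d → ℝ) :
    ((Real.sqrt n * s - β) * vnorm x) ^ 2 ≤ vnorm ((dat A w)ᵀ *ᵥ (U *ᵥ x)) ^ 2 := by
  set ρ := Real.sqrt n * s - β with hρ
  have hρ0 : 0 ≤ ρ := le_trans
    (by have := h.s_pos; have := h.sqrt_pos; positivity) h.half_le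
  have hunit : ∀ x : Fin d → ℝ, x ⬝ᵥ x = 1 → ρ ^ 2 ≤ vnorm ((dat A w)ᵀ *ᵥ (U *ᵥ x)) ^ 2 :=
    fun x hx => by
    have hx0 : x ≠ 0 := fun h0 => by simp [h0] at hx
    set P : Matrix (Fin d) (Fin d) ℝ := 1 - vecMulVec x x with hP
    have hPv : ∀ v, P *ᵥ v = v - (x ⬝ᵥ v) • x := fun v => by
      simp [hP, Matrix.sub_mulVec, Matrix.vecMulVec_mulVec]
    have hdet : P.det = 0 := Matrix.exists_mulVec_eq_zero_iff.1 ⟨x, hx0, by rw [hPv, hx]; simp⟩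
    obtain ⟨y, hy0, hy⟩ := Matrix.exists_mulVec_eq_zero_iff.2
      (show (P * (Uᵀ * ZStack n d)).det = 0 by rw [Matrix.det_mul, hdet, zero_mul])
    rw [← Matrix.mulVec_mulVec, ← Matrix.mulVec_mulVec, hPv, sub_eq_zero] at hy
    have h1 := hU.exchange hx hy
    rw [← vnorm_sq_mulVec_transpose, ← vnorm_sq_mulVec_transpose, ← vnorm_sq] at h1
    have h2 := h.le_dat_transpose_ZStack hw y
    have h3 : 0 < vnorm (ZStack n d *ᵥ y) := by
      rw [vnorm_ZStack_mulVec]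
      exact mul_pos (zero_lt_one.trans_le h.sqrt_pos)
        (lt_of_le_of_ne (vnorm_nonneg _) fun h => hy0 (vnorm_eq_zero.1 h.symm))
    have h4 := pow_le_pow_left₀ (mul_nonneg hρ0 h3.le) h2 2
    rw [mul_pow] at h4
    refine le_of_mul_le_mul_left ?_ (pow_pos h3 2)
    linarith
  by_cases hx0 : x = 0
  · simp [hx0, vnorm]
  have hpos : 0 < vnorm x := lt_of_le_of_ne (vnorm_nonneg _) fun h => hx0 (vnorm_eq_zero.1 h.symm)
  have h1 := hunit ((vnorm x)⁻¹ • x)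
    (by rw [smul_dotProduct, dotProduct_smul, ← vnorm_sq, smul_eq_mul, smul_eq_mul]; field_simp)
  rw [Matrix.mulVec_smul, Matrix.mulVec_smul, vnorm_smul, mul_pow, sq_abs] at h1
  have h2 := mul_le_mul_of_nonneg_right h1 (sq_nonneg (vnorm x))
  rw [mul_pow]
  refine h2.trans (le_of_eq ?_)
  field_simp

/-- Part of `X` orthogonal to the signal subspace. -/
noncomputable def offSignal {K : Type*} (X : Matrix (Fin n × Fin d) K ℝ) :
    Matrix (Fin n × Fin d) K ℝ :=
  X - (n : ℝ)⁻¹ • (ZStack n d * ((ZStack n d)ᵀ * X))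

lemma offSignal_mul {K L : Type*} [Fintype K] (X : Matrix (Fin n × Fin d) K ℝ) (Y : Matrix K L ℝ) :
    offSignal (X * Y) = offSignal X * Y := by
  simp only [offSignal, Matrix.sub_mul, Matrix.smul_mul, Matrix.mul_assoc]

lemma offSignal_dat (hn : 1 ≤ n) : offSignal (dat A w) = offSignal w := by
  have hn0 : (n : ℝ) ≠ 0 := by positivity
  rw [offSignal, offSignal, dat, Matrix.mul_add, ← Matrix.mul_assoc _ (ZStack n d) A,
    ZStack_transpose_mul_self, Matrix.smul_mul, Matrix.one_mul, Matrix.mul_add, Matrix.mul_smul,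
    smul_add, smul_smul, inv_mul_cancel₀ hn0, one_smul]
  abel

lemma OpB.offSignal {k : ℕ} {X : Matrix (Fin n × Fin d) (Fin k) ℝ} {b : ℝ} (hX : OpB X b)
    (hn : 1 ≤ n) : OpB (offSignal X) b := by
  have hn0 : (0 : ℝ) < n := by positivity
  refine ⟨hX.1, fun v => le_trans ?_ (hX.2 v)⟩
  refine (pow_le_pow_iff_left₀ (vnorm_nonneg _) (vnorm_nonneg _) two_ne_zero).1 ?_
  set u := X *ᵥ v with hu
  set z := (ZStack n d)ᵀ *ᵥ u with hz
  have e : GOPP.offSignal X *ᵥ v = u - (n : ℝ)⁻¹ • (ZStack n d *ᵥ z) := by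
    rw [GOPP.offSignal, Matrix.sub_mulVec, Matrix.smul_mulVec, ← Matrix.mulVec_mulVec,
      ← Matrix.mulVec_mulVec]
  have h1 : u ⬝ᵥ (ZStack n d *ᵥ z) = z ⬝ᵥ z := by
    rw [← transpose_mulVec_dotProduct]
  have h2 : (ZStack n d *ᵥ z) ⬝ᵥ (ZStack n d *ᵥ z) = n * (z ⬝ᵥ z) := by
    rw [← transpose_mulVec_dotProduct, Matrix.mulVec_mulVec, ZStack_transpose_mul_self,
      Matrix.smul_mulVec, Matrix.one_mulVec, smul_dotProduct, smul_eq_mul]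
  rw [e, vnorm_sq, vnorm_sq, sub_dotProduct, dotProduct_sub, dotProduct_sub, smul_dotProduct,
    smul_dotProduct, dotProduct_smul, dotProduct_smul, h2,
    dotProduct_comm (ZStack n d *ᵥ z) u, h1]
  simp only [smul_eq_mul]
  have h3 : 0 ≤ z ⬝ᵥ z := by rw [← vnorm_sq]; positivity
  have h4 : (n : ℝ)⁻¹ * ((n : ℝ)⁻¹ * (n * (z ⬝ᵥ z))) = (n : ℝ)⁻¹ * (z ⬝ᵥ z) := by field_simp
  have h5 : 0 ≤ (n : ℝ)⁻¹ * (z ⬝ᵥ z) := by positivity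
  linarith

lemma Regime.opB_offSignal (h : Regime n A s a β δ) (hw : OpB w β)
    (hU : IsTopSingVecs (dat A w) U) :
    OpB (offSignal U) (β / (Real.sqrt n * s - β)) := by
  have hρ := h.half_le
  have hE := h.energy_lower hw hU
  set ρ := Real.sqrt n * s - β
  have hρ0 : 0 < ρ := lt_of_lt_of_le
    (half_pos (mul_pos (zero_lt_one.trans_le h.sqrt_pos) h.s_pos)) hρ
  set H := Uᵀ * (dat A w * (dat A w)ᵀ) * U with hH
  have hxH : ∀ x, x ⬝ᵥ (H *ᵥ x) = vnorm ((dat A w)ᵀ *ᵥ (U *ᵥ x)) ^ 2 := fun x => by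
    rw [vnorm_sq_mulVec_transpose, hH, ← Matrix.mulVec_mulVec, ← Matrix.mulVec_mulVec,
      ← transpose_mulVec_dotProduct, Matrix.transpose_transpose]
  have hlow : ∀ x, ρ ^ 2 * vnorm x ≤ vnorm (H *ᵥ x) := fun x => by
    have h1 := hE x
    rw [← hxH] at h1
    have h2 := dotProduct_le x (H *ᵥ x)
    rcases eq_or_lt_of_le (vnorm_nonneg x) with h0 | h0
    · rw [← h0, mul_zero]; exact vnorm_nonneg _
    · refine le_of_mul_le_mul_left ?_ h0
      nlinarith
  have hinj : Function.Injective H.mulVec := fun x y hxy => by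
    have h1 := hlow (x - y)
    rw [Matrix.mulVec_sub, hxy, sub_self] at h1
    have h2 : vnorm (0 : Fin d → ℝ) = 0 := vnorm_eq_zero.2 rfl
    rw [h2] at h1
    have h3 : vnorm (x - y) ≤ 0 := nonpos_of_mul_nonpos_right h1 (pow_pos hρ0 2)
    exact sub_eq_zero.1 (vnorm_eq_zero.1 (le_antisymm h3 (vnorm_nonneg _)))
  have hsurj : Function.Surjective H.mulVec :=
    Matrix.mulVec_surjective_iff_isUnit.2 (Matrix.mulVec_injective_iff_isUnit.1 hinj)
  refine ⟨div_nonneg h.β_nonneg hρ0.le, fun v => ?_⟩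
  obtain ⟨x, rfl⟩ := hsurj v
  have e : offSignal U *ᵥ (H *ᵥ x) = offSignal w *ᵥ ((dat A w)ᵀ *ᵥ (U *ᵥ x)) := by
    rw [Matrix.mulVec_mulVec, ← offSignal_mul, hH, ← hU.gram_mul, offSignal_mul, offSignal_mul,
      offSignal_dat h.hn, Matrix.mulVec_mulVec, Matrix.mulVec_mulVec, Matrix.mul_assoc]
  show vnorm (offSignal U *ᵥ (H *ᵥ x)) ≤ β / ρ * vnorm (H *ᵥ x)
  rw [e]
  have h1 := (hw.offSignal h.hn).2 ((dat A w)ᵀ *ᵥ (U *ᵥ x))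
  refine h1.trans ?_
  rw [div_mul_eq_mul_div, mul_div_assoc]
  refine mul_le_mul_of_nonneg_left ?_ h.β_nonneg
  rw [le_div_iff₀ hρ0]
  have h2 := hlow x
  have h3 := dotProduct_le x (H *ᵥ x)
  rw [hxH] at h3
  have h4 := vnorm_nonneg (H *ᵥ x)
  refine (pow_le_pow_iff_left₀ (mul_nonneg (vnorm_nonneg _) hρ0.le) h4 two_ne_zero).1 ?_
  rw [mul_pow]
  have h5 := mul_le_mul_of_nonneg_right h2 h4
  have h6 := mul_le_mul_of_nonneg_right h3 (sq_nonneg ρ)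
  nlinarith

/-- Spectral initialization starts in the basin of attraction. -/
lemma Regime.spectral_init (h : Regime n A s a β δ) (hw : OpB w β)
    (hU : IsTopSingVecs (dat A w) U) (hS : IsPolarBlocks U S) :
    ∃ Q : Matrix (Fin d) (Fin d) ℝ, IsOrth Q ∧ frob (S - ZStack n d * Q) ≤ Real.sqrt n / 4 := by
  have hr := h.sqrt_pos
  have hr0 := zero_lt_one.trans_le hr
  have hn0 : (0 : ℝ) < n := by have := h.hn; positivity
  have hsq := h.sq_sqrt
  set r := Real.sqrt n
  set B := (ZStack n d)ᵀ * U with hB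
  set f := frob (offSignal U) with hf
  have hf0 : 0 ≤ f := frob_nonneg _
  have hfδ : f ≤ 1 / 100 := by
    have h1 := (h.opB_offSignal hw hU).frob_mul (1 : Matrix (Fin d) (Fin d) ℝ)
    have h2 : frob (1 : Matrix (Fin d) (Fin d) ℝ) = Real.sqrt d := by
      rw [← isOrth_one.frob_sq_eq (d := d), Real.sqrt_sq (frob_nonneg _)]
    rw [Matrix.mul_one, h2] at h1
    refine h1.trans ?_
    have h3 := h.half_le
    have h4 := h.s_pos
    rw [div_mul_eq_mul_div, div_le_iff₀ (lt_of_lt_of_le (by positivity) h3)]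
    have h5 := h.β_sqrt_le
    have h6 := h.δ_le
    have h7 : δ * s * r ≤ 1 / 200 * s * r := by gcongr
    linarith
  have hUd : ip U U = d := by
    have : ip U U = frob (1 : Matrix (Fin d) (Fin d) ℝ) ^ 2 := by
      rw [frob_sq, ip, ip, hU.1, Matrix.transpose_one, Matrix.one_mul]
    rw [this, isOrth_one.frob_sq_eq]
  have hfB : n * f ^ 2 = n * d - frob B ^ 2 := by
    have e1 : ip (ZStack n d * B) U = frob B ^ 2 := by rw [ip_mul_left, frob_sq]
    have e2 : ip (ZStack n d * B) (ZStack n d * B) = n * frob B ^ 2 := by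
      rw [ip_mul_left, ← Matrix.mul_assoc, ZStack_transpose_mul_self, Matrix.smul_mul,
        Matrix.one_mul, ip_smul_right, frob_sq]
    rw [hf, frob_sq, offSignal, ← hB]
    simp only [ip_sub_left, ip_sub_right, ip_smul_left, ip_smul_right, ip_comm U (ZStack n d * B),
      e1, e2, hUd]
    field_simp
    ring
  obtain ⟨Q, hQ, hQB⟩ := exists_polar B
  have hQB1 : frob B ^ 2 ≤ r * ip B Q := by
    have hU1 : OpB U 1 := ⟨zero_le_one, fun v => by
      rw [vnorm_mulVec_of_transpose_mul hU.1, one_mul]⟩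
    have h1 : OpB (r⁻¹ • (Qᵀ * B)) 1 := by
      have := (hQ.transpose.opB.mul (opB_ZStack.transpose.mul hU1)).smul r⁻¹
      rw [abs_of_pos (inv_pos.2 hr0)] at this
      refine this.mono (le_of_eq ?_)
      show r⁻¹ * (1 * (r * 1)) = 1
      field_simp
    have h2 := ip_le_trace hQB h1
    have h3 : ip (Qᵀ * B) (Qᵀ * B) = frob B ^ 2 := by
      rw [ip_mul_left, Matrix.transpose_transpose, ← Matrix.mul_assoc, hQ.2,
        Matrix.one_mul, frob_sq]
    rw [ip_smul_left, h3, ← ip, inv_mul_le_iff₀ hr0, ip_comm] at h2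
    exact h2
  have hZQ : ip U (ZStack n d * Q) = ip B Q := by
    rw [ip_comm, ip_mul_left, ip_comm]
  have hexp : ∀ Y : Matrix (Fin n × Fin d) (Fin d) ℝ, OrthBlocks Y →
      frob (r • U - Y) ^ 2 = 2 * n * d - 2 * r * ip U Y := fun Y hY => by
    have h1 := hY.frob_sq_eq
    rw [frob_sq] at h1 ⊢
    simp only [ip_sub_left, ip_sub_right, ip_smul_left, ip_smul_right, ip_comm Y U, h1, hUd]
    linear_combination (d : ℝ) * hsq
  have hZ := orthBlocks_ZStack_mul (n := n) hQ
  have h1 : frob (r • U - ZStack n d * Q) ^ 2 ≤ 2 * n * f ^ 2 := by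
    rw [hexp _ hZ, hZQ]
    linarith
  have h2 : frob (r • U - S) ^ 2 ≤ 2 * n * f ^ 2 := by
    refine le_trans ?_ h1
    rw [hexp _ hZ, hexp _ hS.orthBlocks]
    have := mul_le_mul_of_nonneg_left (hS.ip_le hZ) hr0.le
    linarith
  have hb : ∀ {t : ℝ}, t ^ 2 ≤ 2 * n * f ^ 2 → t ≤ 2 * r * f := fun {t} ht => by
    refine (abs_le_of_sq_le_sq' (ht.trans ?_) (by positivity)).2
    have : (2 * r * f) ^ 2 = 4 * n * f ^ 2 := by rw [mul_pow, mul_pow, hsq]; ring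
    rw [this]
    have : 0 ≤ n * f ^ 2 := by positivity
    linarith
  refine ⟨Q, hQ, ?_⟩
  have h3 := frob_add_le (S - r • U) (r • U - ZStack n d * Q)
  rw [sub_add_sub_cancel, frob_sub_comm S (r • U)] at h3
  have h4 := hb h1
  have h5 := hb h2
  nlinarith

end SpectralInit

section Deterministic

variable {n d m : ℕ} {A : Matrix (Fin d) (Fin m) ℝ} {s a β δ : ℝ}
  {w : Matrix (Fin n × Fin d) (Fin m) ℝ} {T : Matrix (Fin n × Fin d) (Fin d) ℝ}

/-- The deterministic part of the theorem: the limit is optimal on the good event. -/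
theorem Regime.optimal (h : Regime n A s a β δ) (hw : OpB w β)
    (T' : Fin n → Matrix (Fin n × Fin d) (Fin d) ℝ)
    (hT' : ∀ i, Sol A s (mask w i) (T' i))
    (hc : ∀ i, frob (blk w i * ((dat A (mask w i))ᵀ * T' i)) ≤ n * s ^ 2 / 100)
    {S : ℕ → Matrix (Fin n × Fin d) (Fin d) ℝ} (hS : IsGPM (dat A w) S)
    {L : Matrix (Fin n × Fin d) (Fin d) ℝ} (hL : OrthBlocks L)
    (hlim : Tendsto (fun t => dF (S t) L) atTop (nhds 0)) :
    (∀ O', OrthBlocks O' →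
      trace ((gram A w)ᵀ * (O' * O'ᵀ)) ≤ trace ((gram A w)ᵀ * (L * Lᵀ))) ∧
    (∀ O', OrthBlocks O' →
      trace ((gram A w)ᵀ * (O' * O'ᵀ)) = trace ((gram A w)ᵀ * (L * Lᵀ)) →
      ∃ Q : Matrix (Fin d) (Fin d) ℝ, IsOrth Q ∧ O' = L * Q) ∧
    (∀ G : Matrix (Fin n × Fin d) (Fin n × Fin d) ℝ,
      G.PosSemidef → (∀ i, dblk G i = 1) →
      trace ((gram A w)ᵀ * G) ≤ trace ((gram A w)ᵀ * (L * Lᵀ))) ∧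
    (∀ G : Matrix (Fin n × Fin d) (Fin n × Fin d) ℝ,
      G.PosSemidef → (∀ i, dblk G i = 1) →
      trace ((gram A w)ᵀ * G) = trace ((gram A w)ᵀ * (L * Lᵀ)) →
      G = L * Lᵀ) := by
  obtain ⟨T, hT⟩ := h.exists_sol hw
  obtain ⟨⟨U, hU, hUS⟩, hstep⟩ := hS
  have hlow := fun i v => hT.lower_of_mask h hw (hT' i) (hc i) v
  have hns : 0 < n * s ^ 2 := mul_pos (by have := h.hn; positivity) (pow_pos h.s_pos 2)
  have hO : OrthBlocks T := fun i => hT.isOrth_of_lower h i (by linarith) (hlow i)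
  refine hT.optimal h hw hlow hL (hT.eq_mul_of_fixed h hw hO hL
    (fun Y hY => ip_le_of_tendsto hL hstep hlim hY)
    (h.near_of_tendsto hw hUS.orthBlocks (h.spectral_init hw hU hUS) hstep hlim))

end Deterministic

section GaussianTail

open ProbabilityTheory

lemma lintegral_pi_prod {ι : Type*} [Fintype ι] {X : Type*} [MeasurableSpace X]
    (μ : Measure X) [IsProbabilityMeasure μ] {f : ι → X → ENNReal} (hf : ∀ i, Measurable (f i)) :
    ∫⁻ x, ∏ i, f i (x i) ∂(Measure.pi fun _ : ι => μ) = ∏ i, ∫⁻ y, f i y ∂μ := by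
  have h := iIndepFun_pi (μ := fun _ : ι => μ) (X := fun i => f i) fun i => (hf i).aemeasurable
  rw [lintegral_prod_eq_prod_lintegral_of_indepFun Finset.univ (fun i (x : ι → X) => f i (x i)) h
    fun i => (hf i).comp (measurable_pi_apply i)]
  refine Finset.prod_congr rfl fun i _ => ?_
  exact (measurePreserving_eval (fun _ : ι => μ) i).lintegral_comp (hf i)

lemma lintegral_exp_mul_gaussian (t : ℝ) :
    ∫⁻ x, ENNReal.ofReal (Real.exp (t * x)) ∂(gaussianReal 0 1)
      = ENNReal.ofReal (Real.exp (t ^ 2 / 2)) := by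
  rw [← ofReal_integral_eq_lintegral_ofReal (integrable_exp_mul_gaussianReal t)
    (ae_of_all _ fun _ => (Real.exp_pos _).le)]
  have := congrFun (mgf_id_gaussianReal (μ := 0) (v := 1)) t
  simp only [mgf, id] at this
  rw [this]
  simp

lemma lintegral_exp_sq_gaussian :
    ∫⁻ x, ENNReal.ofReal (Real.exp (x ^ 2 / 4)) ∂(gaussianReal 0 1)
      = ENNReal.ofReal (Real.sqrt 2) := by
  have e : ∀ x : ℝ, gaussianPDF 0 1 x * ENNReal.ofReal (Real.exp (x ^ 2 / 4))
      = ENNReal.ofReal ((Real.sqrt (2 * Real.pi))⁻¹ * Real.exp (-(1 / 4) * x ^ 2)) := fun x => by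
    rw [gaussianPDF, gaussianPDFReal, ← ENNReal.ofReal_mul (by positivity), mul_assoc,
      ← Real.exp_add]
    congr 2
    · simp
    · congr 1
      simp
      ring
  rw [gaussianReal_of_var_ne_zero _ one_ne_zero,
    lintegral_withDensity_eq_lintegral_mul _ (measurable_gaussianPDF 0 1) (by fun_prop)]
  simp only [Pi.mul_apply, e]
  rw [← ofReal_integral_eq_lintegral_ofReal
    ((integrable_exp_neg_mul_sq (by norm_num)).const_mul _) (ae_of_all _ fun _ => by positivity),
    integral_const_mul, integral_gaussian]
  congr 1
  rw [← Real.sqrt_inv, ← Real.sqrt_mul (by positivity)]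
  congr 1
  field_simp
  norm_num

lemma lintegral_exp_dotProduct {K : Type*} [Fintype K] (z : K → ℝ) :
    ∫⁻ y, ENNReal.ofReal (Real.exp (z ⬝ᵥ y)) ∂(Measure.pi fun _ : K => gaussianReal 0 1)
      = ENNReal.ofReal (Real.exp (vnorm z ^ 2 / 2)) := by
  have e : ∀ y : K → ℝ, ENNReal.ofReal (Real.exp (z ⬝ᵥ y))
      = ∏ i, ENNReal.ofReal (Real.exp (z i * y i)) := fun y => by
    rw [← ENNReal.ofReal_prod_of_nonneg fun _ _ => (Real.exp_pos _).le, ← Real.exp_sum, dotProduct]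
  simp only [e]
  rw [lintegral_pi_prod (f := fun i y => ENNReal.ofReal (Real.exp (z i * y))) _ (by fun_prop)]
  simp only [lintegral_exp_mul_gaussian]
  rw [← ENNReal.ofReal_prod_of_nonneg fun _ _ => (Real.exp_pos _).le, ← Real.exp_sum, vnorm_sq,
    dotProduct, Finset.sum_div]
  simp only [sq]

/-- Exponential moment of the squared norm of a Gaussian vector after a linear map. -/
lemma lintegral_exp_sq_vecMul {M K : Type*} [Fintype M] [Fintype K] {V : Matrix M K ℝ} {v : ℝ}
    (hV : OpB V v) (hv : 0 < v) :
    ∫⁻ g, ENNReal.ofReal (Real.exp (vnorm (Vᵀ *ᵥ g) ^ 2 / (4 * v ^ 2)))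
        ∂(Measure.pi fun _ : M => gaussianReal 0 1)
      ≤ ENNReal.ofReal (Real.sqrt 2) ^ Fintype.card K := by
  set l : ℝ := (Real.sqrt 2 * v)⁻¹ with hl
  have hl2 : l ^ 2 = 1 / (2 * v ^ 2) := by
    rw [hl, inv_pow, mul_pow, Real.sq_sqrt zero_le_two, one_div]
  have e1 : ∀ g : M → ℝ, ENNReal.ofReal (Real.exp (vnorm (Vᵀ *ᵥ g) ^ 2 / (4 * v ^ 2)))
      = ∫⁻ y, ENNReal.ofReal (Real.exp ((l • (Vᵀ *ᵥ g)) ⬝ᵥ y))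
          ∂(Measure.pi fun _ : K => gaussianReal 0 1) := fun g => by
    rw [lintegral_exp_dotProduct, vnorm_smul, mul_pow, sq_abs, hl2]
    congr 2
    field_simp
    ring
  have e2 : ∀ (g : M → ℝ) (y : K → ℝ), (l • (Vᵀ *ᵥ g)) ⬝ᵥ y = (l • (V *ᵥ y)) ⬝ᵥ g := fun g y => by
    rw [smul_dotProduct, smul_dotProduct, transpose_mulVec_dotProduct, dotProduct_comm g]
  have hmeas : Measurable fun p : (M → ℝ) × (K → ℝ) =>
      ENNReal.ofReal (Real.exp ((l • (V *ᵥ p.2)) ⬝ᵥ p.1)) := by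
    simp only [dotProduct, mulVec, Pi.smul_apply]
    fun_prop
  simp only [e1, e2]
  rw [lintegral_lintegral_swap hmeas.aemeasurable]
  simp only [lintegral_exp_dotProduct]
  calc ∫⁻ y, ENNReal.ofReal (Real.exp (vnorm (l • (V *ᵥ y)) ^ 2 / 2))
        ∂(Measure.pi fun _ : K => gaussianReal 0 1)
      ≤ ∫⁻ y, ∏ i, ENNReal.ofReal (Real.exp (y i ^ 2 / 4))
        ∂(Measure.pi fun _ : K => gaussianReal 0 1) := by
        refine lintegral_mono fun y => ?_
        rw [← ENNReal.ofReal_prod_of_nonneg fun _ _ => (Real.exp_pos _).le, ← Real.exp_sum]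
        refine ENNReal.ofReal_le_ofReal (Real.exp_le_exp.2 ?_)
        have h1 := pow_le_pow_left₀ (vnorm_nonneg _) (hV.2 y) 2
        have h2 : vnorm y ^ 2 = ∑ i, y i ^ 2 := by rw [vnorm_sq, dotProduct]; simp only [sq]
        rw [vnorm_smul, mul_pow, sq_abs, hl2, ← Finset.sum_div, ← h2]
        rw [mul_pow] at h1
        have h3 : vnorm y ^ 2 / 4 = 1 / (2 * v ^ 2) * (v ^ 2 * vnorm y ^ 2) / 2 := by
          field_simp; norm_num
        rw [h3]
        gcongr
    _ = ENNReal.ofReal (Real.sqrt 2) ^ Fintype.card K := by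
        rw [lintegral_pi_prod (f := fun _ y => ENNReal.ofReal (Real.exp (y ^ 2 / 4))) _
          (by fun_prop)]
        simp only [lintegral_exp_sq_gaussian, Finset.prod_const, Finset.card_univ]

/-- Exponential moment of the squared Frobenius norm of a Gaussian matrix after a linear map. -/
lemma lintegral_exp_sq_mul {P M K : Type*} [Fintype P] [Fintype M] [Fintype K] {V : Matrix M K ℝ}
    {v : ℝ} (hV : OpB V v) (hv : 0 < v) :
    ∫⁻ W, ENNReal.ofReal (Real.exp (frob (Matrix.of W * V) ^ 2 / (4 * v ^ 2)))
        ∂(stdGaussian P M)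
      ≤ ENNReal.ofReal (Real.sqrt 2) ^ (Fintype.card P * Fintype.card K) := by
  have e : ∀ W : P → M → ℝ, ENNReal.ofReal (Real.exp (frob (Matrix.of W * V) ^ 2 / (4 * v ^ 2)))
      = ∏ p, ENNReal.ofReal (Real.exp (vnorm (Vᵀ *ᵥ W p) ^ 2 / (4 * v ^ 2))) := fun W => by
    rw [← ENNReal.ofReal_prod_of_nonneg fun _ _ => (Real.exp_pos _).le, ← Real.exp_sum,
      ← Finset.sum_div, frob, Real.sq_sqrt (by positivity)]
    congr 3
    refine Finset.sum_congr rfl fun p _ => ?_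
    rw [vnorm, Real.sq_sqrt (by positivity)]
    refine Finset.sum_congr rfl fun k _ => ?_
    congr 1
    simp only [Matrix.mul_apply, mulVec, dotProduct, Matrix.transpose_apply, Matrix.of_apply]
    exact Finset.sum_congr rfl fun _ _ => mul_comm _ _
  simp only [e]
  rw [stdGaussian, lintegral_pi_prod
    (f := fun _ g => ENNReal.ofReal (Real.exp (vnorm (Vᵀ *ᵥ g) ^ 2 / (4 * v ^ 2)))) _ (fun _ => by
      simp only [vnorm, mulVec, dotProduct]; fun_prop)]
  rw [mul_comm (Fintype.card P), pow_mul, Finset.prod_const, Finset.card_univ]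
  exact pow_le_pow_left' (lintegral_exp_sq_vecMul hV hv) _

end GaussianTail

section RowTail

instance (P M : Type*) [Fintype P] [Fintype M] : IsProbabilityMeasure (stdGaussian P M) := by
  unfold stdGaussian; infer_instance

/-- The exponential moment bound when the linear map depends on the complementary rows only. -/
lemma lintegral_exp_sq_mul_of_rows {P M K : Type*} [Fintype P] [Fintype M] [Fintype K]
    (p : P → Prop) [DecidablePred p] {V : (P → M → ℝ) → Matrix M K ℝ} {v : ℝ}
    (hmeas : ∀ i k, Measurable fun W => V W i k)
    (hdep : ∀ W W' : P → M → ℝ, (∀ q, ¬ p q → W q = W' q) → V W = V W')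
    (hV : ∀ W, OpB (V W) v) (hv : 0 < v) :
    ∫⁻ W, ENNReal.ofReal (Real.exp
        (frob ((Matrix.of fun q : {q // p q} => W q) * V W) ^ 2 / (4 * v ^ 2))) ∂(stdGaussian P M)
      ≤ ENNReal.ofReal (Real.sqrt 2) ^ (Fintype.card {q // p q} * Fintype.card K) := by
  have hpres := measurePreserving_piEquivPiSubtypeProd
    (fun _ : P => Measure.pi fun _ : M => ProbabilityTheory.gaussianReal 0 1) p
  set e := MeasurableEquiv.piEquivPiSubtypeProd (fun _ : P => M → ℝ) p with he
  set F : (P → M → ℝ) → ENNReal := fun W => ENNReal.ofReal (Real.exp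
    (frob ((Matrix.of fun q : {q // p q} => W q) * V W) ^ 2 / (4 * v ^ 2))) with hF
  have hFm : Measurable F := by
    simp only [hF, frob, Matrix.mul_apply, Matrix.of_apply]
    fun_prop
  have h1 : ∫⁻ W, F W ∂(stdGaussian P M) = ∫⁻ z, F (e.symm z)
      ∂((stdGaussian {q // p q} M).prod (stdGaussian {q // ¬ p q} M)) :=
    ((hpres.symm e).lintegral_comp hFm).symm
  rw [h1, lintegral_prod_symm (fun z => F (e.symm z)) (hFm.comp e.symm.measurable).aemeasurable]
  have h2 : ∀ y, ∫⁻ x, F (e.symm (x, y)) ∂(stdGaussian {q // p q} M)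
      ≤ ENNReal.ofReal (Real.sqrt 2) ^ (Fintype.card {q // p q} * Fintype.card K) := fun y => by
    have e1 : ∀ x, F (e.symm (x, y)) = ENNReal.ofReal (Real.exp
        (frob (Matrix.of x * V (e.symm (0, y))) ^ 2 / (4 * v ^ 2))) := fun x => by
      have a1 : V (e.symm (x, y)) = V (e.symm (0, y)) := hdep _ _ fun q hq => by
        simp [he, MeasurableEquiv.piEquivPiSubtypeProd, Equiv.piEquivPiSubtypeProd, hq]
      have a2 : (Matrix.of fun q : {q // p q} => e.symm (x, y) q) = Matrix.of x := by
        ext q j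
        simp [he, MeasurableEquiv.piEquivPiSubtypeProd, Equiv.piEquivPiSubtypeProd, q.2]
      simp only [hF, a1, a2]
    simp only [e1]
    exact lintegral_exp_sq_mul (hV _) hv
  refine (lintegral_mono h2).trans ?_
  rw [lintegral_const, measure_univ, mul_one]

lemma measure_le_of_lintegral_exp {Ω : Type*} [MeasurableSpace Ω] {μ : Measure Ω} {F : Ω → ℝ}
    (hF : Measurable F) {b : ℝ} (hb : 0 < b) {k : ℕ}
    (h : ∫⁻ x, ENNReal.ofReal (Real.exp (F x / b)) ∂μ ≤ ENNReal.ofReal (Real.sqrt 2) ^ k) (r : ℝ) :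
    μ {x | r ≤ F x} ≤ ENNReal.ofReal (Real.exp (k - r / b)) := by
  have h1 := meas_ge_le_lintegral_div (μ := μ)
    (f := fun x => ENNReal.ofReal (Real.exp (F x / b))) (by fun_prop)
    (ε := ENNReal.ofReal (Real.exp (r / b)))
    (by simpa using Real.exp_pos _) ENNReal.ofReal_ne_top
  have h2 : {x | r ≤ F x} = {x | ENNReal.ofReal (Real.exp (r / b)) ≤
      ENNReal.ofReal (Real.exp (F x / b))} := by
    ext x
    simp only [Set.mem_ofPred_eq]
    rw [ENNReal.ofReal_le_ofReal_iff (Real.exp_pos _).le, Real.exp_le_exp,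
      div_le_div_iff_of_pos_right hb]
  rw [h2]
  refine h1.trans ((ENNReal.div_le_div_right h _).trans ?_)
  rw [← ENNReal.ofReal_pow (Real.sqrt_nonneg _), ← ENNReal.ofReal_div_of_pos (Real.exp_pos _)]
  refine ENNReal.ofReal_le_ofReal ?_
  rw [Real.exp_sub]
  refine div_le_div_of_nonneg_right ?_ (Real.exp_pos _).le
  rw [← mul_one (k : ℝ), Real.exp_nat_mul]
  refine pow_le_pow_left₀ (Real.sqrt_nonneg _) ?_ _
  have := Real.add_one_le_exp (1 : ℝ)
  have h3 : Real.sqrt 2 ≤ 2 := Real.sqrt_le_iff.2 ⟨by norm_num, by norm_num⟩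
  linarith

end RowTail

section Net

/-- A finite `1`-net of the ball of radius `2`. -/
lemma exists_net (m : ℕ) : ∃ s : Finset (Fin m → ℝ), s.card ≤ 5 ^ m ∧ (∀ c ∈ s, vnorm c ≤ 2) ∧
    ∀ x, vnorm x ≤ 2 → ∃ c ∈ s, vnorm (x - c) ≤ 1 := by
  classical
  set p : Finset (EuclideanSpace ℝ (Fin m)) → Prop := fun s =>
    (∀ c ∈ s, ‖c‖ ≤ 2) ∧ ∀ c ∈ s, ∀ d ∈ s, c ≠ d → 1 ≤ ‖c - d‖ with hp
  have hcard : ∀ s, p s → s.card ≤ 5 ^ m := fun s hs => by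
    simpa using Besicovitch.card_le_of_separated s hs.1 hs.2
  obtain ⟨k, ⟨s, hs, hsk⟩, hmax⟩ : ∃ k, (∃ s, p s ∧ s.card = k) ∧
      ∀ s, p s → s.card ≤ k := by
    have hne : ∃ k, k ≤ 5 ^ m ∧ ∃ s, p s ∧ s.card = k := ⟨0, Nat.zero_le _, ∅, by simp [hp], rfl⟩
    obtain ⟨k0, hk0, hk0'⟩ := hne
    refine ⟨Nat.findGreatest (fun k => ∃ s, p s ∧ s.card = k) (5 ^ m),
      Nat.findGreatest_spec (P := fun k => ∃ s, p s ∧ s.card = k) hk0 hk0', fun s hs => ?_⟩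
    exact Nat.le_findGreatest (hcard s hs) ⟨s, hs, rfl⟩
  have hnorm : ∀ v : EuclideanSpace ℝ (Fin m), ‖v‖ = vnorm (fun i => v i) := fun v => by
    rw [EuclideanSpace.norm_eq, vnorm]; simp
  refine ⟨s.image fun v i => v i, Finset.card_image_le.trans (hcard s hs), ?_, fun x hx => ?_⟩
  · intro c hc
    obtain ⟨v, hv, rfl⟩ := Finset.mem_image.1 hc
    rw [← hnorm]; exact hs.1 v hv
  · by_contra hcon
    push Not at hcon
    set y : EuclideanSpace ℝ (Fin m) := WithLp.toLp 2 x with hy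
    have hyx : ∀ v ∈ s, 1 < ‖y - v‖ := fun v hv => by
      rw [hnorm]
      exact hcon _ (Finset.mem_image_of_mem _ hv)
    have hys : y ∉ s := fun h => by
      have := hyx y h
      simp at this
      linarith
    have h1 := hmax (insert y s) ⟨fun c hc => ?_, fun c hc d hd hcd => ?_⟩
    · rw [Finset.card_insert_of_notMem hys] at h1
      omega
    · rcases Finset.mem_insert.1 hc with rfl | hc
      · rw [hnorm]; exact hx
      · exact hs.1 c hc
    · rcases Finset.mem_insert.1 hc with rfl | hc <;> rcases Finset.mem_insert.1 hd with rfl | hd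
      · exact absurd rfl hcd
      · exact (hyx d hd).le
      · rw [norm_sub_rev]; exact (hyx c hc).le
      · exact hs.2 c hc d hd hcd

lemma opB_of_net {N : Type*} [Fintype N] {m : ℕ} {s : Finset (Fin m → ℝ)}
    (hs : ∀ x, vnorm x ≤ 2 → ∃ c ∈ s, vnorm (x - c) ≤ 1) {X : Matrix N (Fin m) ℝ} {t : ℝ}
    (ht : 0 ≤ t) (hX : ∀ c ∈ s, vnorm (X *ᵥ c) ≤ t) : OpB X t := by
  have key : ∀ b, OpB X b → OpB X ((t + b) / 2) := fun b hb => by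
    refine ⟨by have := hb.1; positivity, fun v => ?_⟩
    rcases eq_or_lt_of_le (vnorm_nonneg v) with h0 | h0
    · rw [vnorm_eq_zero.1 h0.symm]; simp [vnorm]
    · obtain ⟨c, hc, hxc⟩ := hs ((2 / vnorm v) • v) (by
        rw [vnorm_smul, abs_of_pos (by positivity), div_mul_cancel₀ _ h0.ne'])
      have h1 := vnorm_add_le (X *ᵥ ((2 / vnorm v) • v - c)) (X *ᵥ c)
      rw [← Matrix.mulVec_add, sub_add_cancel, Matrix.mulVec_smul, vnorm_smul,
        abs_of_pos (by positivity)] at h1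
      have h2 := (hb.2 ((2 / vnorm v) • v - c)).trans (mul_le_mul_of_nonneg_left hxc hb.1)
      have h3 := hX c hc
      have h4 : 2 / vnorm v * vnorm (X *ᵥ v) ≤ t + b := by linarith
      rw [div_mul_eq_mul_div, div_le_iff₀ h0] at h4
      linarith
  have h1 := (key _ (opB_opNorm X)).opNorm_le
  exact (opB_opNorm X).mono (by linarith)

end Net

section OpNormTail

/-- High-probability bound on the operator norm of a Gaussian matrix. -/
lemma measure_not_opB_le (P : Type*) [Fintype P] (m : ℕ) {t : ℝ} (ht : 0 ≤ t) :
    stdGaussian P (Fin m) {W | ¬ OpB (Matrix.of W) t}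
      ≤ ENNReal.ofReal (Real.exp (2 * m + Fintype.card P - t ^ 2 / 16)) := by
  obtain ⟨s, hcard, hs2, hs⟩ := exists_net m
  have hsub : {W : P → Fin m → ℝ | ¬ OpB (Matrix.of W) t}
      ⊆ ⋃ c ∈ s, {W | t ^ 2 ≤ vnorm (Matrix.of W *ᵥ c) ^ 2} := fun W hW => by
    by_contra hcon
    refine hW (opB_of_net hs ht fun c hc => ?_)
    by_contra hlt
    refine hcon (Set.mem_biUnion hc ?_)
    exact pow_le_pow_left₀ ht (not_le.1 hlt).le 2
  have hone : ∀ c ∈ s, stdGaussian P (Fin m) {W | t ^ 2 ≤ vnorm (Matrix.of W *ᵥ c) ^ 2}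
      ≤ ENNReal.ofReal (Real.exp (Fintype.card P - t ^ 2 / 16)) := fun c hc => by
    set V : Matrix (Fin m) Unit ℝ := Matrix.of fun i _ => c i with hV
    have hVb : OpB V 2 := ⟨zero_le_two, fun y => by
      have e1 : V *ᵥ y = y () • c := by
        ext i; simp [hV, mulVec, dotProduct, mul_comm]
      have e2 : vnorm y = |y ()| := by simp [vnorm, Real.sqrt_sq_eq_abs]
      rw [e1, vnorm_smul, e2, mul_comm]
      exact mul_le_mul_of_nonneg_right (hs2 c hc) (abs_nonneg _)⟩
    have e : ∀ W : P → Fin m → ℝ, vnorm (Matrix.of W *ᵥ c) ^ 2 = frob (Matrix.of W * V) ^ 2 :=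
      fun W => by
      rw [frob, vnorm]
      simp [hV, mulVec, dotProduct, Matrix.mul_apply]
    have h1 := lintegral_exp_sq_mul (P := P) hVb two_pos
    simp only [← e, Fintype.card_unit, mul_one] at h1
    have h2 := measure_le_of_lintegral_exp (by simp only [vnorm, mulVec, dotProduct]; fun_prop)
      (by norm_num) h1 (t ^ 2)
    norm_num at h2
    exact h2
  refine (measure_mono hsub).trans ((measure_biUnion_finset_le s _).trans
    ((Finset.sum_le_card_nsmul _ _ _ hone).trans ?_))
  rw [nsmul_eq_mul, ← ENNReal.ofReal_natCast, ← ENNReal.ofReal_mul (Nat.cast_nonneg _)]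
  refine ENNReal.ofReal_le_ofReal ?_
  rw [add_sub_assoc, Real.exp_add]
  refine mul_le_mul_of_nonneg_right ?_ (Real.exp_pos _).le
  have h5 : (5 : ℝ) ≤ Real.exp 2 := by
    have h := Real.add_one_le_exp (1 : ℝ)
    have h1 := Real.exp_one_gt_d9
    have h2 : Real.exp 2 = Real.exp 1 * Real.exp 1 := by rw [← Real.exp_add]; norm_num
    nlinarith
  calc (s.card : ℝ) ≤ 5 ^ m := by exact_mod_cast hcard
    _ ≤ Real.exp 2 ^ m := pow_le_pow_left₀ (by norm_num) h5 m
    _ = Real.exp (2 * m) := by rw [← Real.exp_nat_mul, mul_comm]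

end OpNormTail

section LeaveOneOut

variable {n d m : ℕ} {A : Matrix (Fin d) (Fin m) ℝ} {s a β δ : ℝ}

lemma isClosed_opB {α β : Type*} [Fintype α] [Fintype β] (b : ℝ) :
    IsClosed {X : Matrix α β ℝ | OpB X b} := by
  have : {X : Matrix α β ℝ | OpB X b} = {_X | 0 ≤ b} ∩ ⋂ v, {X | vnorm (X *ᵥ v) ≤ b * vnorm v} := by
    ext X; simp [OpB]
  rw [this]
  refine isClosed_const.inter (isClosed_iInter fun v => isClosed_le ?_ continuous_const)
  simp only [vnorm, mulVec, dotProduct]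
  fun_prop

lemma Regime.continuousOn_sol (h : Regime n A s a β δ)
    {T : Matrix (Fin n × Fin d) (Fin m) ℝ → Matrix (Fin n × Fin d) (Fin d) ℝ}
    (hT : ∀ w, OpB w β → Sol A s w (T w)) (p : Fin n × Fin d) (j : Fin d) :
    ContinuousOn (fun w => T w p j) {w | OpB w β} := by
  intro w' hw'
  have hns : 0 < n * s ^ 2 := mul_pos (by have := h.hn; positivity) (pow_pos h.s_pos 2)
  rw [ContinuousWithinAt, tendsto_iff_dist_tendsto_zero]
  have hb : ∀ w ∈ {w | OpB w β}, dist (T w p j) (T w' p j)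
      ≤ (n * s ^ 2)⁻¹ * (4 * (Real.sqrt n * frob (gram A w - gram A w'))) := fun w hw => by
    have h1 := (hT w hw).frob_sub_le (hT w' hw') h hw hw'
    have h2 := (hT w' hw').ball.opB.frob_mul_right (gram A w - gram A w')
    have h3 : |(T w - T w') p j| ≤ frob (T w - T w') := by
      rw [frob]
      refine Real.abs_le_sqrt ?_
      refine le_trans ?_ (Finset.single_le_sum (f := fun p => ∑ j, (T w - T w') p j ^ 2)
        (fun _ _ => Finset.sum_nonneg fun _ _ => sq_nonneg _) (Finset.mem_univ p))
      exact Finset.single_le_sum (f := fun j => (T w - T w') p j ^ 2) (fun _ _ => sq_nonneg _)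
        (Finset.mem_univ j)
    rw [Real.dist_eq]
    refine h3.trans ?_
    rw [← div_eq_inv_mul, le_div_iff₀ hns]
    linarith
  refine squeeze_zero' (Eventually.of_forall fun _ => dist_nonneg)
    (eventually_nhdsWithin_of_forall hb) ?_
  have hc : Continuous fun w : Matrix (Fin n × Fin d) (Fin m) ℝ =>
      (n * s ^ 2)⁻¹ * (4 * (Real.sqrt n * frob (gram A w - gram A w'))) := by
    refine continuous_const.mul (continuous_const.mul (continuous_const.mul
      (frob_continuous.comp ?_)))
    simp only [gram, dat]
    fun_prop
  have := hc.tendsto w'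
  simp only [sub_self, frob, Matrix.zero_apply] at this
  simp at this
  exact (by simpa [frob] using this : Tendsto _ _ _).mono_left nhdsWithin_le_nhds

/-- Row blocks are nearly orthogonal to the leave-one-out solution. -/
lemma Regime.exists_sol_tail (h : Regime n A s a β δ) (σ : ℝ) :
    ∃ T : Matrix (Fin n × Fin d) (Fin m) ℝ → Matrix (Fin n × Fin d) (Fin d) ℝ,
      (∀ w, OpB w β → Sol A s w (T w)) ∧ ∀ (i : Fin n) (r : ℝ),
        stdGaussian (Fin n × Fin d) (Fin m) {W | OpB (σ • Matrix.of W) β ∧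
          r ≤ frob (blk (Matrix.of W) i * ((dat A (mask (σ • Matrix.of W) i))ᵀ *
            T (mask (σ • Matrix.of W) i))) ^ 2}
        ≤ ENNReal.ofReal (Real.exp ((d * d : ℕ) - r / (4 * (2 * n * a) ^ 2))) := by
  classical
  obtain ⟨T, hT⟩ : ∃ T : Matrix (Fin n × Fin d) (Fin m) ℝ → Matrix (Fin n × Fin d) (Fin d) ℝ,
      ∀ w, OpB w β → Sol A s w (T w) := by
    choose! T hT using fun w (hw : OpB w β) => h.exists_sol hw
    exact ⟨T, hT⟩
  refine ⟨T, hT, fun i r => ?_⟩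
  have hn0 : (0 : ℝ) < n := by have := h.hn; positivity
  have hv : 0 < 2 * n * a := mul_pos (by positivity) h.a_pos
  set x : ((Fin n × Fin d) → Fin m → ℝ) → Matrix (Fin n × Fin d) (Fin m) ℝ :=
    fun W => mask (σ • Matrix.of W) i with hx
  have hxc : Continuous x := by
    refine continuous_pi fun p => continuous_pi fun j => ?_
    simp only [hx, mask, Matrix.of_apply]
    split_ifs
    · exact continuous_const
    · simp only [Matrix.smul_apply, Matrix.of_apply]; fun_prop
  set K := x ⁻¹' {w | OpB w β} with hK
  have hKc : IsClosed K := (isClosed_opB β).preimage hxc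
  set V : ((Fin n × Fin d) → Fin m → ℝ) → Matrix (Fin m) (Fin d) ℝ := fun W =>
    if W ∈ K then (dat A (x W))ᵀ * T (x W) else 0 with hV
  have hVdep : ∀ W W' : (Fin n × Fin d) → Fin m → ℝ, (∀ q, ¬ q.1 = i → W q = W' q) → V W = V W' :=
    fun W W' hWW' => by
    have : x W = x W' := by
      ext p j
      simp only [hx, mask, Matrix.of_apply, Matrix.smul_apply]
      split_ifs with hp
      · rfl
      · rw [hWW' p hp]
    simp only [hV, hK, Set.mem_preimage, this]
  have hVb : ∀ W, OpB (V W) (2 * n * a) := fun W => by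
    simp only [hV]
    split_ifs with hW
    · refine ((h.opB_dat hW).transpose.mul (hT _ hW).ball.opB).mono ?_
      have h1 := h.β_le_a
      have h2 := h.sq_sqrt
      have h4 := mul_le_mul_of_nonneg_right h1 (Real.sqrt_nonneg (n : ℝ))
      have h5 : Real.sqrt n * a * Real.sqrt n = n * a := by linear_combination a * h2
      linarith
    · exact ⟨hv.le, fun v => by
        rw [Matrix.zero_mulVec, vnorm_eq_zero.2 rfl]; exact mul_nonneg hv.le (vnorm_nonneg _)⟩
  have hVm : ∀ k j, Measurable fun W => V W k j := fun k j => by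
    have e : (fun W => V W k j) = K.piecewise (fun W => ((dat A (x W))ᵀ * T (x W)) k j) 0 := by
      ext W
      by_cases hW : W ∈ K <;> simp [hV, hW]
    rw [e]
    refine ContinuousOn.measurable_piecewise ?_ continuousOn_const hKc.measurableSet
    simp only [Matrix.mul_apply, Matrix.transpose_apply]
    refine continuousOn_finsetSum _ fun p _ => ContinuousOn.mul ?_ ?_
    · refine Continuous.continuousOn ?_
      have : Continuous fun w : Matrix (Fin n × Fin d) (Fin m) ℝ => dat A w p k := by
        simp only [dat, Matrix.add_apply]; fun_prop
      exact this.comp hxc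
    · exact (h.continuousOn_sol hT p j).comp hxc.continuousOn fun _ hW => hW
  have h1 := lintegral_exp_sq_mul_of_rows (fun q : Fin n × Fin d => q.1 = i) hVm hVdep hVb hv
  let e : Fin d ≃ {q : Fin n × Fin d // q.1 = i} :=
    { toFun := fun b => ⟨(i, b), rfl⟩
      invFun := fun q => q.1.2
      left_inv := fun _ => rfl
      right_inv := by rintro ⟨⟨_, _⟩, rfl⟩; rfl }
  have hfe : ∀ W : (Fin n × Fin d) → Fin m → ℝ,
      frob ((Matrix.of fun q : {q : Fin n × Fin d // q.1 = i} => W q) * V W)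
        = frob (blk (Matrix.of W) i * V W) := fun W => by
    rw [frob, frob, ← Equiv.sum_comp e]
    rfl
  have hcard : Fintype.card {q : Fin n × Fin d // q.1 = i} = d := by
    rw [← Fintype.card_congr e, Fintype.card_fin]
  simp only [hfe, hcard, Fintype.card_fin] at h1
  have h2 := measure_le_of_lintegral_exp (F := fun W => frob (blk (Matrix.of W) i * V W) ^ 2)
    (by simp only [frob, Matrix.mul_apply, blk, Matrix.of_apply]; fun_prop) (by positivity) h1 r
  refine (measure_mono fun W hW => ?_).trans h2
  have hWK : W ∈ K := OpB.mask hW.1 i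
  simp only [Set.mem_ofPred_eq, hV, hWK, if_true]
  exact hW.2

end LeaveOneOut

section Parameters

variable {n d m : ℕ} {γ : ℝ}

lemma bnd1_sq_ge (hγ : 0 ≤ γ) :
    (n : ℝ) * d + m + 2 * γ * n * Real.log n ≤ bnd1 n d m γ ^ 2 := by
  have hl := Real.log_natCast_nonneg n
  have h1 := Real.sq_sqrt (show (0 : ℝ) ≤ n * d by positivity)
  have h2 := Real.sq_sqrt (show (0 : ℝ) ≤ m by positivity)
  have h3 := Real.sq_sqrt (show 0 ≤ 2 * γ * n * Real.log n by positivity)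
  have e1 := Real.sqrt_nonneg ((n : ℝ) * d)
  have e2 := Real.sqrt_nonneg (m : ℝ)
  have e3 := Real.sqrt_nonneg (2 * γ * n * Real.log n)
  rw [bnd1]
  linarith [mul_nonneg e1 e2, mul_nonneg e1 e3, mul_nonneg e2 e3]

lemma bnd1_pos (hn : 1 ≤ n) (hd : 1 ≤ d) : 0 < bnd1 n d m γ := by
  have : 0 < Real.sqrt ((n : ℝ) * d) := Real.sqrt_pos.2 (by positivity)
  rw [bnd1]
  positivity

lemma exp_neg_mul_log (hn : 1 ≤ n) : Real.exp (-(γ * Real.log n)) = (n : ℝ) ^ (-γ) := by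
  rw [Real.rpow_def_of_pos (by positivity)]
  congr 1
  ring

lemma exp_net_le (hn : 1 ≤ n) (hγ : 0 ≤ γ) :
    Real.exp (2 * m + (n * d : ℕ) - (6 * bnd1 n d m γ) ^ 2 / 16) ≤ (n : ℝ) ^ (-γ) := by
  rw [← exp_neg_mul_log hn]
  refine Real.exp_le_exp.2 ?_
  have h1 := bnd1_sq_ge (n := n) (d := d) (m := m) hγ
  have h2 : γ * Real.log n ≤ γ * n * Real.log n := by
    have h3 : (1 : ℝ) ≤ n := by exact_mod_cast hn
    have := mul_nonneg hγ (Real.log_natCast_nonneg n)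
    nlinarith
  have h4 : (0 : ℝ) ≤ n * d := by positivity
  have h5 : (0 : ℝ) ≤ m := by positivity
  have := mul_nonneg hγ (Real.log_natCast_nonneg n)
  push_cast
  linarith

lemma sqrt_mul_sqrt_le_bnd1 (hn : 1 ≤ n) (hd : 1 ≤ d) (hγ : 0 ≤ γ) :
    Real.sqrt n * Real.sqrt ((d : ℝ) * d + γ * Real.log n)
      ≤ Real.sqrt d * bnd1 n d m γ := by
  have hl := Real.log_natCast_nonneg n
  have hb : 0 < bnd1 n d m γ := bnd1_pos hn hd
  refine (pow_le_pow_iff_left₀ (by positivity) (by positivity) two_ne_zero).1 ?_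
  rw [mul_pow, mul_pow, Real.sq_sqrt (by positivity), Real.sq_sqrt (by positivity),
    Real.sq_sqrt (by positivity)]
  have h1 := bnd1_sq_ge (n := n) (d := d) (m := m) hγ
  have h2 : (1 : ℝ) ≤ d := by exact_mod_cast hd
  have h3 : 0 ≤ n * (γ * Real.log n) := by positivity
  have h4 := mul_le_mul_of_nonneg_left h1 (by positivity : (0 : ℝ) ≤ d)
  have h5 : (0 : ℝ) ≤ d * m := by positivity
  nlinarith

/-- The hypothesis on the noise level places the model in the deterministic regime, and makes the
row noise negligible. -/
lemma regime_of_noise (hn : 1 ≤ n) (hd : 1 ≤ d) {A : Matrix (Fin d) (Fin m) ℝ}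
    (hA : 0 < sigmaMin A) {σ : ℝ} (hσ : 0 < σ) (hγ : 0 ≤ γ)
    (h : σ ≤ 1 / 1200 * (sigmaMin A / kappa A ^ 4) * Real.sqrt (n : ℝ) /
        (Real.sqrt (d : ℝ) * bnd1 n d m γ)) :
    Regime n A (sigmaMin A) (opNorm A) (6 * σ * bnd1 n d m γ)
        (6 * (1 / 1200) * sigmaMin A ^ 3 / opNorm A ^ 3) ∧
      σ * (4 * n * opNorm A * Real.sqrt ((d : ℝ) * d + γ * Real.log n))
        ≤ n * sigmaMin A ^ 2 / 100 := by
  have hsa : sigmaMin A ≤ opNorm A :=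
    le_of_opB_of_le hd (opB_opNorm A) (sigmaMin_mul_le A)
  rw [kappa] at h
  have hρ := sqrt_mul_sqrt_le_bnd1 (m := m) hn hd hγ
  have hb : 0 < bnd1 n d m γ := bnd1_pos hn hd
  have hAo := opB_opNorm A
  have hAs := sigmaMin_mul_le A
  obtain ⟨s, hs⟩ : ∃ s, s = sigmaMin A := ⟨_, rfl⟩
  obtain ⟨a, ha⟩ : ∃ a, a = opNorm A := ⟨_, rfl⟩
  obtain ⟨b, hb'⟩ : ∃ b, b = bnd1 n d m γ := ⟨_, rfl⟩
  obtain ⟨ρ, hρ'⟩ : ∃ ρ, ρ = Real.sqrt ((d : ℝ) * d + γ * Real.log n) := ⟨_, rfl⟩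
  simp only [← hs, ← ha, ← hb', ← hρ'] at *
  have ha0 : 0 < a := hA.trans_le hsa
  have hn0 : (0 : ℝ) < n := by positivity
  have hd0 : (0 : ℝ) < d := by positivity
  have hsn := Real.sqrt_pos.2 hn0
  have hsd := Real.sqrt_pos.2 hd0
  rw [le_div_iff₀ (by positivity)] at h
  have e : s / (a / s) ^ 4 = s ^ 5 / a ^ 4 := by field_simp
  rw [e] at h
  have hr : s / a ≤ 1 := (div_le_one ha0).2 hsa
  have hr0 : 0 < s / a := by positivity
  refine ⟨⟨hn, hd, hA, hAo, hAs, by positivity, by positivity, ?_, ?_⟩, ?_⟩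
  · have e1 : a * (6 * (1 / 1200) * s ^ 3 / a ^ 3) = s / 200 * (s / a) ^ 2 := by field_simp; ring
    rw [e1]
    exact mul_le_of_le_one_right (by positivity) (pow_le_one₀ hr0.le hr)
  · have e1 : 6 * (1 / 1200) * s ^ 3 / a ^ 3 * s ^ 2 * Real.sqrt n
        = 6 * a * (1 / 1200 * (s ^ 5 / a ^ 4) * Real.sqrt n) := by field_simp
    rw [e1]
    calc a * (6 * σ * b) * Real.sqrt d = 6 * a * (σ * (Real.sqrt d * b)) := by ring
      _ ≤ _ := mul_le_mul_of_nonneg_left h (by positivity)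
  · have h1 : σ * ρ ≤ 1 / 1200 * (s ^ 5 / a ^ 4) := by
      refine le_of_mul_le_mul_right ?_ hsn
      calc σ * ρ * Real.sqrt n = σ * (Real.sqrt n * ρ) := by ring
        _ ≤ σ * (Real.sqrt d * b) := mul_le_mul_of_nonneg_left hρ hσ.le
        _ ≤ _ := h
    calc σ * (4 * n * a * ρ) = 4 * n * a * (σ * ρ) := by ring
      _ ≤ 4 * n * a * (1 / 1200 * (s ^ 5 / a ^ 4)) :=
        mul_le_mul_of_nonneg_left h1 (by positivity)
      _ = n * s ^ 2 / 300 * (s / a) ^ 3 := by field_simp; ring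
      _ ≤ n * s ^ 2 / 300 := mul_le_of_le_one_right (by positivity) (pow_le_one₀ hr0.le hr)
      _ ≤ n * s ^ 2 / 100 := by gcongr; norm_num

end Parameters

/-- Theorem 3.2, optimality part: with high probability the GPM limit S^∞ is the
unique global maximizer (modulo a global right orthogonal transform) of the nonconvex program
max ⟨C, OOᵀ⟩ over O(d)^{⊗n}, and S^∞(S^∞)ᵀ is the unique global maximizer of the SDP relaxation. -/
theorem gpm_limit_is_unique_optimum :
    ∃ c C : ℝ, 0 < c ∧ 0 < C ∧
      ∀ (n d m : ℕ), 1 ≤ n → 1 ≤ d → d ≤ m →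
      ∀ A : Matrix (Fin d) (Fin m) ℝ, 0 < sigmaMin A →
      ∀ σ γ : ℝ, 0 < σ → 2 ≤ γ →
      σ ≤ c * (sigmaMin A / kappa A ^ 4) * Real.sqrt (n : ℝ) /
        (Real.sqrt (d : ℝ) * bnd1 n d m γ) →
      ENNReal.ofReal (1 - C * (n : ℝ) ^ (-γ + 2)) ≤
        stdGaussian (Fin n × Fin d) (Fin m) {W |
          ∀ Dm, Dm = ZStack n d * A + σ • Matrix.of W →
          ∀ Cm, Cm = Dm * Dmᵀ →
          ∀ S : ℕ → Matrix (Fin n × Fin d) (Fin d) ℝ, IsGPM Dm S →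
          ∀ Sinf, OrthBlocks Sinf →
            Tendsto (fun t => dF (S t) Sinf) atTop (nhds 0) →
            (∀ O', OrthBlocks O' →
              Matrix.trace (Cmᵀ * (O' * O'ᵀ)) ≤ Matrix.trace (Cmᵀ * (Sinf * Sinfᵀ))) ∧
            (∀ O', OrthBlocks O' →
              Matrix.trace (Cmᵀ * (O' * O'ᵀ)) = Matrix.trace (Cmᵀ * (Sinf * Sinfᵀ)) →
              ∃ Q, IsOrth Q ∧ O' = Sinf * Q) ∧
            (∀ G : Matrix (Fin n × Fin d) (Fin n × Fin d) ℝ,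
              G.PosSemidef → (∀ i, dblk G i = 1) →
              Matrix.trace (Cmᵀ * G) ≤ Matrix.trace (Cmᵀ * (Sinf * Sinfᵀ))) ∧
            (∀ G : Matrix (Fin n × Fin d) (Fin n × Fin d) ℝ,
              G.PosSemidef → (∀ i, dblk G i = 1) →
              Matrix.trace (Cmᵀ * G) = Matrix.trace (Cmᵀ * (Sinf * Sinfᵀ)) →
              G = Sinf * Sinfᵀ)} := by
  refine ⟨1 / 1200, 2, by norm_num, by norm_num, ?_⟩
  intro n d m hn hd _ A hA σ γ hσ hγ hσle
  have hγ0 : 0 ≤ γ := by linarith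
  obtain ⟨h, hrow⟩ := regime_of_noise hn hd hA hσ hγ0 hσle
  obtain ⟨T, hT, htail⟩ := h.exists_sol_tail σ
  have hn0 : (0 : ℝ) < n := by positivity
  have ha := h.a_pos
  obtain ⟨ρ, hρ⟩ : ∃ ρ, ρ = Real.sqrt ((d : ℝ) * d + γ * Real.log n) := ⟨_, rfl⟩
  rw [← hρ] at hrow
  have hρ2 : ρ ^ 2 = d * d + γ * Real.log n := by
    rw [hρ, Real.sq_sqrt]
    have := Real.log_natCast_nonneg n
    positivity
  have hρ0 : 0 ≤ ρ := hρ ▸ Real.sqrt_nonneg _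
  have hb : 0 < bnd1 n d m γ := bnd1_pos hn hd
  set μ := stdGaussian (Fin n × Fin d) (Fin m)
  set B₀ : Set ((Fin n × Fin d) → Fin m → ℝ) := {W | ¬ OpB (Matrix.of W) (6 * bnd1 n d m γ)}
  set B : Fin n → Set ((Fin n × Fin d) → Fin m → ℝ) := fun i =>
    {W | OpB (σ • Matrix.of W) (6 * σ * bnd1 n d m γ) ∧
      (4 * n * opNorm A * ρ) ^ 2 ≤ frob (blk (Matrix.of W) i *
        ((dat A (mask (σ • Matrix.of W) i))ᵀ * T (mask (σ • Matrix.of W) i))) ^ 2}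
  have hB₀ : μ B₀ ≤ ENNReal.ofReal ((n : ℝ) ^ (-γ)) := by
    refine (measure_not_opB_le (Fin n × Fin d) m (by positivity)).trans
      (ENNReal.ofReal_le_ofReal ?_)
    have := exp_net_le (m := m) (d := d) hn hγ0
    rwa [Fintype.card_prod, Fintype.card_fin, Fintype.card_fin]
  have hB : ∀ i, μ (B i) ≤ ENNReal.ofReal ((n : ℝ) ^ (-γ)) := fun i => by
    refine (htail i _).trans (ENNReal.ofReal_le_ofReal ?_)
    rw [← exp_neg_mul_log hn]
    refine Real.exp_le_exp.2 (le_of_eq ?_)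
    have : (4 * n * opNorm A * ρ) ^ 2 / (4 * (2 * n * opNorm A) ^ 2) = ρ ^ 2 := by
      field_simp; ring
    rw [this, hρ2]
    push_cast
    ring
  have hbad : μ (B₀ ∪ ⋃ i, B i) ≤ ENNReal.ofReal (2 * (n : ℝ) ^ (-γ + 2)) := by
    have hp : 0 ≤ (n : ℝ) ^ (-γ) := by positivity
    have h1n : (1 : ℝ) ≤ n := by exact_mod_cast hn
    calc μ (B₀ ∪ ⋃ i, B i) ≤ μ B₀ + ∑ i, μ (B i) :=
          (measure_union_le _ _).trans (add_le_add_right (measure_iUnion_fintype_le _ _) _)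
      _ ≤ ENNReal.ofReal ((n : ℝ) ^ (-γ)) + ∑ _i : Fin n, ENNReal.ofReal ((n : ℝ) ^ (-γ)) :=
          add_le_add hB₀ (Finset.sum_le_sum fun i _ => hB i)
      _ = ENNReal.ofReal ((n : ℝ) ^ (-γ) + n * (n : ℝ) ^ (-γ)) := by
          rw [← ENNReal.ofReal_sum_of_nonneg fun _ _ => hp, ← ENNReal.ofReal_add hp]
          · simp
          · exact Finset.sum_nonneg fun _ _ => hp
      _ ≤ _ := by
          refine ENNReal.ofReal_le_ofReal ?_
          rw [Real.rpow_add hn0, Real.rpow_two]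
          have : (n : ℝ) + 1 ≤ 2 * n ^ 2 := by nlinarith
          nlinarith [mul_le_mul_of_nonneg_left this hp]
  have hcover : (1 : ENNReal) ≤ μ ((B₀ ∪ ⋃ i, B i)ᶜ) + μ (B₀ ∪ ⋃ i, B i) := by
    rw [← measure_univ (μ := μ), ← Set.compl_union_self (B₀ ∪ ⋃ i, B i)]
    exact measure_union_le _ _
  have hgood : ENNReal.ofReal (1 - 2 * (n : ℝ) ^ (-γ + 2)) ≤ μ ((B₀ ∪ ⋃ i, B i)ᶜ) := by
    rw [ENNReal.ofReal_sub _ (by positivity), ENNReal.ofReal_one]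
    exact tsub_le_iff_right.2 (hcover.trans (add_le_add_right hbad _))
  refine hgood.trans (measure_mono fun W hW => ?_)
  simp only [Set.mem_compl_iff, Set.mem_union, Set.mem_iUnion, not_or, not_exists] at hW
  obtain ⟨hW₀, hWi⟩ := hW
  have hW₀' : OpB (Matrix.of W) (6 * bnd1 n d m γ) := not_not.1 hW₀
  have hw : OpB (σ • Matrix.of W) (6 * σ * bnd1 n d m γ) :=
    (hW₀'.smul σ).mono (by rw [abs_of_pos hσ]; linarith)
  rintro Dm rfl Cm rfl S hS L hL hlim
  refine h.optimal hw (fun i => T (mask (σ • Matrix.of W) i))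
    (fun i => hT _ (OpB.mask hw i)) (fun i => ?_) hS hL hlim
  have hlt : frob (blk (Matrix.of W) i *
      ((dat A (mask (σ • Matrix.of W) i))ᵀ * T (mask (σ • Matrix.of W) i)))
      ≤ 4 * n * opNorm A * ρ := by
    by_contra hcon
    exact hWi i ⟨hw, pow_le_pow_left₀ (by positivity) (not_le.1 hcon).le 2⟩
  rw [blk_smul, Matrix.smul_mul, frob_smul, abs_of_pos hσ]
  exact (mul_le_mul_of_nonneg_left hlt hσ.le).trans hrow

end GOPP
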